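/- arXiv:1412.2035 — 3 statements merged into one kernel-verified Lean document; each statement's English description precedes it below -/
import Mathlib

section
/- For every integer d ≥ 2 and every integer r ≥ 1, the sequence n ↦ A_{d,r}(n) is P-recursive: there exist a natural number k and polynomials p_0, p_1, ..., p_k with rational coefficients, not all zero, such that for every natural number n, p_0(n)·A_{d,r}(n) + p_1(n)·A_{d,r}(n+1) + ... + p_k(n)·A_{d,r}(n+k) = 0. -/
/-- A word `w : Fin N → Fin n` is `12...d`-avoiding if there is no strictly
increasing sequence of `d` positions on which the values are strictly increasing. -/
def Avoids (d : ℕ) {N n : ℕ} (w : Fin N → Fin n) : Prop :=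
  ¬ ∃ s : Fin d → Fin N, StrictMono s ∧ StrictMono (w ∘ s)

/-- `A d r n` is the number of `12...d`-avoiding words on the alphabet `{1,...,n}`
in which each letter occurs exactly `r` times. -/
noncomputable def A (d r n : ℕ) : ℕ :=
  Nat.card {w : Fin (n * r) → Fin n //
    (∀ v : Fin n, Nat.card {i : Fin (n * r) // w i = v} = r) ∧ Avoids d w}

open Finset

/-- Laurent polynomials in `m` variables over `ℚ`. -/
abbrev Laurent (m : ℕ) : Type := AddMonoidAlgebra ℚ (Fin m → ℤ)

namespace Laurent

open AddMonoidAlgebra (single)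

variable {m : ℕ}

/-- The scalar by which `∂^γ` multiplies the monomial with exponent `a`. -/
noncomputable def derivWeight (γ : Fin m → ℕ) (a : Fin m → ℤ) : ℚ :=
  ∏ i, (descPochhammer ℚ (γ i)).eval (a i : ℚ)

/-- The iterated partial derivative `∂^γ` on Laurent polynomials. -/
noncomputable def deriv (γ : Fin m → ℕ) : Laurent m →ₗ[ℚ] Laurent m :=
  (Finsupp.linearCombination ℚ fun a ↦
      (single (a - fun i ↦ (γ i : ℤ)) (derivWeight γ a) : Laurent m)) ∘ₗ
    (AddMonoidAlgebra.coeffLinearEquiv ℚ).toLinearMap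

theorem deriv_single (γ : Fin m → ℕ) (a : Fin m → ℤ) (c : ℚ) :
    deriv γ (single a c) = single (a - fun i ↦ (γ i : ℤ)) (c * derivWeight γ a) := by
  simp [deriv, AddMonoidAlgebra.coeffLinearEquiv]

theorem derivWeight_zero (a : Fin m → ℤ) : derivWeight 0 a = 1 := by
  simp [derivWeight]

theorem derivWeight_basis (i : Fin m) (a : Fin m → ℤ) :
    derivWeight (Pi.single i 1) a = a i := by
  rw [derivWeight, Finset.prod_eq_single i]
  · simp
  · intro j _ hj; simp [hj]
  · simp

theorem derivWeight_add_basis (γ : Fin m → ℕ) (i : Fin m) (a : Fin m → ℤ) :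
    derivWeight (γ + Pi.single i 1) a = derivWeight γ a * (a i - γ i) := by
  have h : (a i - γ i : ℚ) = ∏ j, if j = i then (a i - γ i : ℚ) else 1 := by simp
  rw [h, derivWeight, derivWeight, ← Finset.prod_mul_distrib]
  refine Finset.prod_congr rfl fun j _ ↦ ?_
  by_cases hj : j = i
  · subst hj
    simp [descPochhammer_succ_eval]
  · simp [hj]

theorem deriv_zero (f : Laurent m) : deriv 0 f = f := by
  induction f using AddMonoidAlgebra.induction_linear with
  | zero => simp
  | add f g hf hg => rw [map_add, hf, hg]
  | single a c =>
    rw [deriv_single, derivWeight_zero]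
    congr 1
    · ext; simp
    · simp

theorem deriv_add_basis (γ : Fin m → ℕ) (i : Fin m) (f : Laurent m) :
    deriv (γ + Pi.single i 1) f = deriv (Pi.single i 1) (deriv γ f) := by
  induction f using AddMonoidAlgebra.induction_linear with
  | zero => simp
  | add f g hf hg => simp only [map_add, hf, hg]
  | single a c =>
    rw [deriv_single, deriv_single, deriv_single, derivWeight_add_basis, derivWeight_basis]
    congr 1
    · ext j; simp; ring
    · simp; ring

theorem deriv_basis_mul (i : Fin m) (f g : Laurent m) :
    deriv (Pi.single i 1) (f * g) =
      deriv (Pi.single i 1) f * g + f * deriv (Pi.single i 1) g := by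
  induction f using AddMonoidAlgebra.induction_linear with
  | zero => simp
  | add f f' hf hf' => simp only [map_add, add_mul, hf, hf']; ring
  | single a c =>
    induction g using AddMonoidAlgebra.induction_linear with
    | zero => simp
    | add g g' hg hg' => simp only [map_add, mul_add, hg, hg']; ring
    | single b c' =>
      simp only [deriv_single, AddMonoidAlgebra.single_mul_single, derivWeight_basis]
      rw [sub_add_eq_add_sub, ← add_sub_assoc, ← AddMonoidAlgebra.single_add]
      congr 1
      simp; ring

theorem deriv_basis_pow (i : Fin m) (f : Laurent m) (k : ℕ) :
    deriv (Pi.single i 1) (f ^ (k + 1)) =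
      ((k : ℚ) + 1) • (f ^ k * deriv (Pi.single i 1) f) := by
  induction k with
  | zero => simp
  | succ k ih =>
    rw [pow_succ, deriv_basis_mul, ih, smul_mul_assoc]
    push_cast
    simp only [Algebra.smul_def, map_add, map_one]
    ring

theorem coeff_deriv (γ : Fin m → ℕ) (f : Laurent m) (b : Fin m → ℤ) :
    (deriv γ f).coeff b =
      derivWeight γ (b + fun i ↦ (γ i : ℤ)) * f.coeff (b + fun i ↦ (γ i : ℤ)) := by
  induction f using AddMonoidAlgebra.induction_linear with
  | zero => simp
  | add f g hf hg => simp [hf, hg, mul_add]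
  | single a c =>
    rw [deriv_single, AddMonoidAlgebra.coeff_single, AddMonoidAlgebra.coeff_single,
      Finsupp.single_apply, Finsupp.single_apply]
    by_cases h : a = b + fun i ↦ (γ i : ℤ)
    · subst h
      simp [mul_comm]
    · have : ¬ (a - fun i ↦ (γ i : ℤ)) = b := fun h' ↦ h (by rw [← h']; simp)
      simp [h, this]

/-- Exponent vectors with all entries of absolute value at most `s`. -/
noncomputable def box (m s : ℕ) : Finset (Fin m → ℤ) :=
  Fintype.piFinset fun _ ↦ Finset.Icc (-(s : ℤ)) s

theorem mem_box {s : ℕ} {a : Fin m → ℤ} : a ∈ box m s ↔ ∀ i, |a i| ≤ s := by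
  simp [box, abs_le]

theorem card_box (s : ℕ) : (box m s).card = (2 * s + 1) ^ m := by
  simp only [box, Fintype.card_piFinset, Int.card_Icc, Finset.prod_const, Finset.card_univ,
    Fintype.card_fin]
  congr 1
  omega

theorem add_mem_box {s t : ℕ} {a b : Fin m → ℤ} (ha : a ∈ box m s) (hb : b ∈ box m t) :
    a + b ∈ box m (s + t) := by
  rw [mem_box] at *
  intro i
  push_cast
  exact (abs_add_le _ _).trans (add_le_add (ha i) (hb i))

theorem box_mono {s t : ℕ} (h : s ≤ t) : box m s ⊆ box m t := by
  intro a ha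
  rw [mem_box] at *
  exact fun i ↦ (ha i).trans (by exact_mod_cast h)

theorem exists_support_subset_box (f : Laurent m) : ∃ s, f.coeff.support ⊆ box m s := by
  refine ⟨f.coeff.support.sup fun a ↦ Finset.univ.sup fun i ↦ (a i).natAbs, fun a ha ↦ ?_⟩
  rw [mem_box]
  intro i
  have h₁ : (a i).natAbs ≤ Finset.univ.sup fun i ↦ (a i).natAbs :=
    Finset.le_sup (f := fun i ↦ (a i).natAbs) (Finset.mem_univ i)
  have h₂ := Finset.le_sup (f := fun a : Fin m → ℤ ↦ Finset.univ.sup fun i ↦ (a i).natAbs) ha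
  rw [Int.abs_eq_natAbs]
  exact_mod_cast h₁.trans h₂

variable (Q : Laurent m)

/-- The sequence `n ↦ n ^ t * x ^ a * Q ^ (n + k)`. -/
noncomputable def monomialSeq (k : ℕ) (x : ℕ × (Fin m → ℤ)) (n : ℕ) : Laurent m :=
  (n : ℚ) ^ x.1 • (single x.2 1 * Q ^ (n + k))

/-- Sequences `n ↦ R(n, x) * Q ^ (n + k)` with `R` of degree at most `D` in `n` and with
exponents of `x` in a box of size `s`. -/
noncomputable def boundedSeq (D s k : ℕ) : Submodule ℚ (ℕ → Laurent m) :=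
  Submodule.span ℚ (monomialSeq Q k '' ((Finset.range (D + 1) ×ˢ box m s : Finset _) : Set _))

variable {Q}

theorem boundedSeq_mono {D D' s s' k : ℕ} (hD : D ≤ D') (hs : s ≤ s') :
    boundedSeq Q D s k ≤ boundedSeq Q D' s' k := by
  refine Submodule.span_mono (Set.image_mono ?_)
  exact_mod_cast Finset.product_subset_product (Finset.range_mono (by omega)) (box_mono hs)

theorem mem_boundedSeq {D s k t : ℕ} (ht : t ≤ D) {f : Laurent m}
    (hf : f.coeff.support ⊆ box m s) :
    (fun n : ℕ ↦ (n : ℚ) ^ t • (f * Q ^ (n + k))) ∈ boundedSeq Q D s k := by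
  have : (fun n : ℕ ↦ (n : ℚ) ^ t • (f * Q ^ (n + k))) =
      ∑ a ∈ f.coeff.support, f.coeff a • monomialSeq Q k (t, a) := by
    funext n
    conv_lhs => rw [← AddMonoidAlgebra.sum_coeff_single f]
    simp only [Finsupp.sum, Finset.sum_mul, Finset.smul_sum, Finset.sum_apply, Pi.smul_apply,
      monomialSeq]
    refine Finset.sum_congr rfl fun a _ ↦ ?_
    simp only [← smul_mul_assoc, AddMonoidAlgebra.smul_single, smul_eq_mul, mul_one,
      mul_comm (f.coeff a)]
  rw [this]
  refine Submodule.sum_mem _ fun a ha ↦ Submodule.smul_mem _ _ (Submodule.subset_span ?_)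
  refine ⟨(t, a), ?_, rfl⟩
  simp only [Finset.coe_product, Set.mem_prod, Finset.mem_coe, Finset.mem_range]
  exact ⟨by omega, hf ha⟩

theorem support_mul_subset_box {f g : Laurent m} {s t : ℕ} (hf : f.coeff.support ⊆ box m s)
    (hg : g.coeff.support ⊆ box m t) : (f * g).coeff.support ⊆ box m (s + t) := by
  classical
  intro a ha
  obtain ⟨b, hb, c, hc, rfl⟩ :=
    Finset.mem_add.1 (AddMonoidAlgebra.support_coeff_mul_subset f g ha)
  exact add_mem_box (hf hb) (hg hc)

theorem support_single_subset_box {a : Fin m → ℤ} {s : ℕ} (ha : a ∈ box m s) (c : ℚ) :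
    (single a c : Laurent m).coeff.support ⊆ box m s := by
  rw [AddMonoidAlgebra.coeff_single]
  exact Finsupp.support_single_subset.trans (by simpa using ha)

theorem support_deriv_subset_box {f : Laurent m} {s : ℕ} (hf : f.coeff.support ⊆ box m s)
    (i : Fin m) : (deriv (Pi.single i 1) f).coeff.support ⊆ box m (s + 1) := by
  intro b hb
  rw [Finsupp.mem_support_iff, coeff_deriv] at hb
  have := hf (Finsupp.mem_support_iff.2 (right_ne_zero_of_mul hb))
  have h₁ : (-(fun j ↦ ((Pi.single i 1 : Fin m → ℕ) j : ℤ))) ∈ box m 1 := by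
    rw [mem_box]
    intro j
    by_cases hj : j = i
    · subst hj; simp
    · simp [hj]
  simpa using add_mem_box this h₁

theorem deriv_mem_boundedSeq {q : ℕ} (hQ : Q.coeff.support ⊆ box m q) (i : Fin m) {D s k : ℕ}
    {F : ℕ → Laurent m} (hF : F ∈ boundedSeq Q D s (k + 1)) :
    (fun n ↦ deriv (Pi.single i 1) (F n)) ∈ boundedSeq Q (D + 1) (s + (q + 1)) k := by
  induction hF using Submodule.span_induction with
  | zero =>
    convert Submodule.zero_mem (boundedSeq Q (D + 1) (s + (q + 1)) k) using 1
    funext n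
    simp
  | add F G _ _ hF hG =>
    convert Submodule.add_mem _ hF hG using 1
    funext n
    simp
  | smul c F _ hF =>
    convert Submodule.smul_mem _ c hF using 1
    funext n
    simp
  | mem F hF =>
    obtain ⟨⟨t, a⟩, hx, rfl⟩ := hF
    simp only [Finset.coe_product, Set.mem_prod, Finset.mem_coe, Finset.mem_range] at hx
    have ha := support_single_subset_box hx.2 1
    have h₁ : (fun n : ℕ ↦ (n : ℚ) ^ t •
        (deriv (Pi.single i 1) (single a 1) * Q * Q ^ (n + k))) ∈
        boundedSeq Q (D + 1) (s + (q + 1)) k :=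
      mem_boundedSeq (by omega) (by
        rw [add_comm q, ← add_assoc]
        exact support_mul_subset_box (support_deriv_subset_box ha i) hQ)
    have hb : (single a 1 * deriv (Pi.single i 1) Q).coeff.support ⊆ box m (s + (q + 1)) :=
      support_mul_subset_box ha (support_deriv_subset_box hQ i)
    have h₂ : (fun n : ℕ ↦ (n : ℚ) ^ (t + 1) •
        (single a 1 * deriv (Pi.single i 1) Q * Q ^ (n + k))) ∈
        boundedSeq Q (D + 1) (s + (q + 1)) k := mem_boundedSeq (by omega) hb
    have h₃ : (fun n : ℕ ↦ (n : ℚ) ^ t •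
        (single a 1 * deriv (Pi.single i 1) Q * Q ^ (n + k))) ∈
        boundedSeq Q (D + 1) (s + (q + 1)) k := mem_boundedSeq (by omega) hb
    convert Submodule.add_mem _ (Submodule.add_mem _ h₁ h₂)
      (Submodule.smul_mem _ ((k : ℚ) + 1) h₃) using 1
    funext n
    simp only [monomialSeq, map_smul, ← add_assoc, deriv_basis_mul, deriv_basis_pow, Pi.add_apply,
      Pi.smul_apply]
    simp only [Algebra.smul_def, map_add, map_pow, map_one, Nat.cast_add]
    ring

theorem iteratedDeriv_mem_boundedSeq {P : Laurent m} {p q : ℕ} (hP : P.coeff.support ⊆ box m p)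
    (hQ : Q.coeff.support ⊆ box m q) (γ : Fin m → ℕ) (k : ℕ) :
    (fun n ↦ deriv γ (P * Q ^ (n + (k + ∑ i, γ i)))) ∈
      boundedSeq Q (∑ i, γ i) (p + (∑ i, γ i) * (q + 1)) k := by
  induction h : ∑ i, γ i generalizing γ k with
  | zero =>
    have : γ = 0 := by
      funext i
      simpa using (Finset.sum_eq_zero_iff.1 h) i (Finset.mem_univ i)
    subst this
    simpa [deriv_zero] using mem_boundedSeq (Q := Q) (k := k) (D := 0) (t := 0) le_rfl hP
  | succ M ih =>
    obtain ⟨i, hi⟩ : ∃ i, γ i ≠ 0 := by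
      by_contra! hγ
      simp [hγ] at h
    obtain ⟨γ', rfl⟩ : ∃ γ' : Fin m → ℕ, γ = γ' + Pi.single i 1 := by
      refine ⟨γ - Pi.single i 1, ?_⟩
      funext j
      by_cases hj : j = i
      · subst hj; simp; omega
      · simp [hj]
    have hM : ∑ j, γ' j = M := by
      simpa [Finset.sum_add_distrib] using h
    have := deriv_mem_boundedSeq hQ i (ih γ' (k + 1) hM)
    simp only [deriv_add_basis]
    rw [show k + (M + 1) = k + 1 + M by ring, Nat.succ_mul, ← add_assoc p]
    exact this

theorem natPow_smul_mem_boundedSeq {D s k : ℕ} (t : ℕ) {F : ℕ → Laurent m}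
    (hF : F ∈ boundedSeq Q D s k) :
    (fun n : ℕ ↦ (n : ℚ) ^ t • F n) ∈ boundedSeq Q (D + t) s k := by
  induction hF using Submodule.span_induction with
  | zero =>
    convert Submodule.zero_mem (boundedSeq Q (D + t) s k) using 1
    funext n
    simp
  | add F G _ _ hF hG =>
    convert Submodule.add_mem _ hF hG using 1
    funext n
    simp
  | smul c F _ hF =>
    convert Submodule.smul_mem _ c hF using 1
    funext n
    simp [smul_comm c]
  | mem F hF =>
    obtain ⟨⟨t', a⟩, hx, rfl⟩ := hF
    simp only [Finset.coe_product, Set.mem_prod, Finset.mem_coe, Finset.mem_range] at hx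
    refine Submodule.subset_span ⟨(t' + t, a), ?_, ?_⟩
    · simp only [Finset.coe_product, Set.mem_prod, Finset.mem_coe, Finset.mem_range]
      exact ⟨by omega, hx.2⟩
    · funext n
      simp [monomialSeq, smul_smul, pow_add, mul_comm]

theorem boundedSeq_succ_le {q : ℕ} (hQ : Q.coeff.support ⊆ box m q) (D s k : ℕ) :
    boundedSeq Q D s (k + 1) ≤ boundedSeq Q D (s + q) k := by
  refine Submodule.span_le.2 ?_
  rintro _ ⟨⟨t, a⟩, hx, rfl⟩
  simp only [Finset.coe_product, Set.mem_prod, Finset.mem_coe, Finset.mem_range] at hx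
  have := mem_boundedSeq (Q := Q) (k := k) (show t ≤ D by omega)
    (support_mul_subset_box (support_single_subset_box hx.2 1) hQ)
  have h : monomialSeq Q (k + 1) (t, a) =
      fun n : ℕ ↦ (n : ℚ) ^ t • (single a 1 * Q * Q ^ (n + k)) := by
    funext n
    simp only [monomialSeq]
    congr 1
    ring
  rwa [SetLike.mem_coe, h]

theorem boundedSeq_le {q : ℕ} (hQ : Q.coeff.support ⊆ box m q) (D s k : ℕ) :
    boundedSeq Q D s k ≤ boundedSeq Q D (s + k * q) 0 := by
  induction k generalizing s with
  | zero => simp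
  | succ k ih =>
    refine (boundedSeq_succ_le hQ D s k).trans ((ih (s + q)).trans ?_)
    exact boundedSeq_mono le_rfl (by linarith [Nat.succ_mul k q])

theorem derivWeight_residue_eq_zero {γ γ₀ : Fin m → ℕ} (h : ¬ γ ≤ γ₀) :
    derivWeight γ ((fun i ↦ -1 - (γ₀ i : ℤ)) + fun i ↦ (γ i : ℤ)) = 0 := by
  rw [Pi.le_def] at h
  push Not at h
  obtain ⟨i, hi⟩ := h
  refine Finset.prod_eq_zero (Finset.mem_univ i) ?_
  rw [← descPochhammer_eval_coe_nat_of_lt (R := ℚ) (show γ i - 1 - γ₀ i < γ i by omega)]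
  congr 1
  rw [Nat.sub_sub, Nat.cast_sub (by omega)]
  simp
  ring

theorem derivWeight_residue_ne_zero (γ : Fin m → ℕ) :
    derivWeight γ ((fun i ↦ -1 - (γ i : ℤ)) + fun i ↦ (γ i : ℤ)) ≠ 0 := by
  refine Finset.prod_ne_zero_iff.2 fun i _ ↦ ?_
  rw [descPochhammer_eval_eq_prod_range]
  refine Finset.prod_ne_zero_iff.2 fun j _ ↦ ?_
  have : (0 : ℚ) ≤ j := by positivity
  simp only [Pi.add_apply]
  push_cast
  linarith

theorem exists_card_lt (m p q : ℕ) :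
    ∃ N, (N + m * N + 1) * (2 * (p + m * N * (q + 1) + (m * N + N) * q) + 1) ^ m <
      (N + 1) * ((N + 1) * (N + 1) ^ m) := by
  set B := 2 * (p + m * (q + 1) + (m + 1) * q) + 1
  refine ⟨(m + 1) * B ^ m, ?_⟩
  generalize hN : (m + 1) * B ^ m = N
  have h₁ : N + m * N + 1 ≤ (m + 1) * (N + 1) := by nlinarith
  have h₂ : 2 * (p + m * N * (q + 1) + (m * N + N) * q) + 1 ≤ B * (N + 1) := by
    simp only [B]
    nlinarith [Nat.zero_le (p * N), Nat.zero_le m, Nat.zero_le (m * q), Nat.zero_le q]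
  calc _ ≤ (m + 1) * (N + 1) * (B * (N + 1)) ^ m :=
        Nat.mul_le_mul h₁ (Nat.pow_le_pow_left h₂ m)
    _ = ((m + 1) * B ^ m) * ((N + 1) * (N + 1) ^ m) := by rw [mul_pow]; ring
    _ < _ := by
        rw [hN]
        exact Nat.mul_lt_mul_of_pos_right (Nat.lt_succ_self N) (by positivity)

/-- The exponent shifted family whose linear dependence yields a recurrence. -/
noncomputable def shiftSeq (P Q : Laurent m) (N : ℕ)
    (x : Fin (N + 1) × Fin (N + 1) × (Fin m → Fin (N + 1))) (n : ℕ) : Laurent m :=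
  (n : ℚ) ^ (x.1 : ℕ) • deriv (fun i ↦ (x.2.2 i : ℕ)) (P * Q ^ (n + (m * N + x.2.1)))

theorem shiftSeq_mem_boundedSeq {P : Laurent m} {p q : ℕ} (hP : P.coeff.support ⊆ box m p)
    (hQ : Q.coeff.support ⊆ box m q) (N : ℕ)
    (x : Fin (N + 1) × Fin (N + 1) × (Fin m → Fin (N + 1))) :
    shiftSeq P Q N x ∈
      boundedSeq Q (N + m * N) (p + m * N * (q + 1) + (m * N + N) * q) 0 := by
  obtain ⟨i, b, γ⟩ := x
  set γ' : Fin m → ℕ := fun j ↦ (γ j : ℕ)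
  have hγ : ∑ j, γ' j ≤ m * N := by
    refine (Finset.sum_le_card_nsmul _ _ N fun j _ ↦ ?_).trans (by simp)
    exact Nat.lt_succ_iff.1 (γ j).2
  have h := natPow_smul_mem_boundedSeq i <| boundedSeq_le hQ _ _ _ <|
    iteratedDeriv_mem_boundedSeq hP hQ γ' (m * N + b - ∑ j, γ' j)
  rw [Nat.sub_add_cancel (by omega)] at h
  refine boundedSeq_mono (by omega) ?_ h
  refine Nat.add_le_add (Nat.add_le_add le_rfl (Nat.mul_le_mul_right _ hγ))
    (Nat.mul_le_mul_right _ ?_)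
  omega

theorem exists_shiftSeq_relation (P Q : Laurent m) :
    ∃ (N : ℕ) (c : Fin (N + 1) × Fin (N + 1) × (Fin m → Fin (N + 1)) → ℚ),
      ∑ x, c x • shiftSeq P Q N x = 0 ∧ ∃ x, c x ≠ 0 := by
  obtain ⟨p, hP⟩ := exists_support_subset_box P
  obtain ⟨q, hQ⟩ := exists_support_subset_box Q
  obtain ⟨N, hN⟩ := exists_card_lt m p q
  refine ⟨N, Fintype.not_linearIndependent_iff.1 fun hli ↦ ?_⟩
  classical
  have hspan := linearIndependent_le_span_aux' (shiftSeq P Q N) hli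
    (((Finset.range (N + m * N + 1) ×ˢ
      box m (p + m * N * (q + 1) + (m * N + N) * q)).image (monomialSeq Q 0) : Finset _) : Set _)
    (by
      rintro _ ⟨x, rfl⟩
      rw [Finset.coe_image]
      exact shiftSeq_mem_boundedSeq hP hQ N x)
  have hcard : Fintype.card (Fin (N + 1) × Fin (N + 1) × (Fin m → Fin (N + 1))) =
      (N + 1) * ((N + 1) * (N + 1) ^ m) := by simp
  rw [hcard] at hspan
  refine absurd (hspan.trans ?_) hN.not_ge
  simp only [Finset.coe_sort_coe, Fintype.card_coe]
  refine Finset.card_image_le.trans ?_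
  rw [Finset.card_product, Finset.card_range, card_box]

/-- The coefficients of a fixed monomial in `P * Q ^ n` form a P-recursive sequence. -/
theorem exists_recurrence_coeff (P Q : Laurent m) :
    ∃ (k : ℕ) (p : Fin (k + 1) → Polynomial ℚ), (∃ i, p i ≠ 0) ∧
      ∀ n : ℕ, ∑ i : Fin (k + 1),
        (p i).eval (n : ℚ) * (P * Q ^ (n + (i : ℕ))).coeff (fun _ ↦ -1) = 0 := by
  obtain ⟨N, c, hc, x₀, hx₀⟩ := exists_shiftSeq_relation P Q
  obtain ⟨γ₀, ⟨⟨i₀, b₀, h₀⟩, hmin⟩⟩ : ∃ γ, Minimal (fun γ ↦ ∃ i b, c (i, b, γ) ≠ 0) γ :=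
    (Set.toFinite {γ | ∃ i b, c (i, b, γ) ≠ 0}).exists_minimal ⟨x₀.2.2, x₀.1, x₀.2.1, hx₀⟩
  have hker : ∀ n : ℕ, ∑ i : Fin (N + 1), ∑ b : Fin (N + 1),
      c (i, b, γ₀) * ((n : ℚ) ^ (i : ℕ) *
        (P * Q ^ (n + (m * N + b))).coeff (fun _ ↦ -1)) = 0 := by
    intro n
    have h := congrArg (fun f : Laurent m ↦ f.coeff fun j ↦ -1 - (γ₀ j : ℤ)) (congrFun hc n)
    simp only [Finset.sum_apply, Pi.smul_apply, shiftSeq, AddMonoidAlgebra.coeff_sum,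
      Finsupp.coe_finsetSum, AddMonoidAlgebra.coeff_smul, Finsupp.smul_apply, coeff_deriv,
      Pi.zero_apply, AddMonoidAlgebra.coeff_zero, Finsupp.coe_zero, smul_eq_mul,
      Fintype.sum_prod_type] at h
    refine (mul_eq_zero.1 (Eq.trans ?_ h)).resolve_left
      (derivWeight_residue_ne_zero fun j ↦ (γ₀ j : ℕ))
    rw [Finset.mul_sum]
    refine Finset.sum_congr rfl fun i _ ↦ ?_
    rw [Finset.mul_sum]
    refine Finset.sum_congr rfl fun b _ ↦ ?_
    rw [Finset.sum_eq_single γ₀]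
    · have : ((fun j ↦ -1 - (γ₀ j : ℤ)) + fun j ↦ ((γ₀ j : ℕ) : ℤ)) = fun _ ↦ -1 := by
        funext j; simp
      rw [this]
      ring
    · intro γ _ hγ
      by_cases hle : γ ≤ γ₀
      · have : c (i, b, γ) = 0 := by
          by_contra hne
          exact hγ (le_antisymm hle (hmin ⟨i, b, hne⟩ hle))
        rw [this, zero_mul]
      · rw [derivWeight_residue_eq_zero fun h ↦ hle fun j ↦ h j]
        ring
    · simp
  refine ⟨m * N + N, fun j ↦ if h : m * N ≤ j then
    ∑ i : Fin (N + 1), Polynomial.C (c (i, ⟨j - m * N, by omega⟩, γ₀)) * Polynomial.X ^ (i : ℕ)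
    else 0, ⟨⟨m * N + b₀, by omega⟩, fun h ↦ h₀ ?_⟩, fun n ↦ ?_⟩
  · have := congrArg (fun f ↦ f.coeff (i₀ : ℕ)) h
    simpa [Polynomial.coeff_C_mul, Polynomial.coeff_X_pow, Fin.val_inj] using this
  · refine Eq.trans ?_ (hker n)
    rw [Finset.sum_comm]
    refine (Fin.sum_univ_add (a := m * N) (b := N + 1) _).trans ?_
    simp [Polynomial.eval_finsetSum, Finset.sum_mul, mul_assoc]
    refine Finset.sum_eq_zero fun x _ ↦ ?_
    rw [if_neg (by omega), Polynomial.eval_zero, zero_mul]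

/-- The constant terms of `P * Q ^ n` form a P-recursive sequence. -/
theorem exists_recurrence_coeff_zero (P Q : Laurent m) :
    ∃ (k : ℕ) (p : Fin (k + 1) → Polynomial ℚ), (∃ i, p i ≠ 0) ∧
      ∀ n : ℕ, ∑ i : Fin (k + 1),
        (p i).eval (n : ℚ) * (P * Q ^ (n + (i : ℕ))).coeff 0 = 0 := by
  obtain ⟨k, p, hp, h⟩ := exists_recurrence_coeff (single (fun _ ↦ -1) 1 * P) Q
  refine ⟨k, p, hp, fun n ↦ Eq.trans (Finset.sum_congr rfl fun i _ ↦ ?_) (h n)⟩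
  rw [mul_assoc, AddMonoidAlgebra.coeff_single_mul_eq_mul_coeff (m₂ := 0), one_mul]
  simp

end Laurent

namespace Patience

/-- The first `v` entries of a Boolean vector that are `true`, counted. -/
def countBelow : {n : ℕ} → (Fin n → Bool) → ℕ → ℕ
  | 0, _, _ => 0
  | _ + 1, _, 0 => 0
  | _ + 1, T, v + 1 => (T 0).toNat + countBelow (Fin.tail T) v

/-- The number of `true` entries of a Boolean vector. -/
def size {n : ℕ} (T : Fin n → Bool) : ℕ := countBelow T n

/-- Replace the first `true` entry, if any, by `false`. -/
def eraseFirst : {n : ℕ} → (Fin n → Bool) → (Fin n → Bool)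
  | 0, T => T
  | _ + 1, T => Fin.cons false (if T 0 then Fin.tail T else eraseFirst (Fin.tail T))

/-- Patience sorting: mark the letter `a` and unmark the next larger marked letter, if `a` was not
marked yet. -/
def insert : {n : ℕ} → Fin n → (Fin n → Bool) → (Fin n → Bool)
  | _ + 1, a, T => Fin.cases
      (Fin.cons true (if T 0 then Fin.tail T else eraseFirst (Fin.tail T)))
      (fun a ↦ Fin.cons (T 0) (insert a (Fin.tail T))) a

/-- The state of patience sorting after reading a word. -/
def state {n : ℕ} : {L : ℕ} → (Fin L → Fin n) → (Fin n → Bool)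
  | 0, _ => fun _ ↦ false
  | L + 1, w => insert (w (Fin.last L)) (state (Fin.init w))

variable {n : ℕ}

@[simp] theorem size_nil (T : Fin 0 → Bool) : size T = 0 := rfl

@[simp] theorem size_cons (b : Bool) (T : Fin n → Bool) :
    size (Fin.cons b T : Fin (n + 1) → Bool) = b.toNat + size T := rfl

@[simp] theorem eraseFirst_cons (b : Bool) (T : Fin n → Bool) :
    eraseFirst (Fin.cons b T : Fin (n + 1) → Bool) =
      Fin.cons false (if b then T else eraseFirst T) := rfl

@[simp] theorem insert_zero_cons (b : Bool) (T : Fin n → Bool) :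
    insert 0 (Fin.cons b T : Fin (n + 1) → Bool) =
      Fin.cons true (if b then T else eraseFirst T) := rfl

@[simp] theorem insert_succ_cons (a : Fin n) (b : Bool) (T : Fin n → Bool) :
    insert a.succ (Fin.cons b T : Fin (n + 1) → Bool) = Fin.cons b (insert a T) := rfl

theorem countBelow_eraseFirst (T : Fin n → Bool) (v : ℕ) :
    countBelow (eraseFirst T) v = countBelow T v - 1 := by
  induction n generalizing v with
  | zero => rfl
  | succ n ih =>
    cases v with
    | zero => rfl
    | succ v =>
      cases h : T 0 <;> simp [countBelow, eraseFirst, h, ih]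

theorem countBelow_insert (a : Fin n) (T : Fin n → Bool) (v : ℕ) :
    countBelow (insert a T) v =
      if v ≤ a then countBelow T v else max (countBelow T v) (countBelow T a + 1) := by
  induction n generalizing v with
  | zero => exact a.elim0
  | succ n ih =>
    cases v with
    | zero => simp [countBelow]
    | succ v =>
      refine Fin.cases ?_ (fun a ↦ ?_) a
      · cases h : T 0 <;> simp [countBelow, insert, h, countBelow_eraseFirst]
        omega
      · simp only [countBelow, insert, Fin.cases_succ, Fin.cons_zero, Fin.tail_cons, ih,
          Fin.val_succ, Nat.add_le_add_iff_right]
        split_ifs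
        · rfl
        · omega

theorem size_le_size_insert (a : Fin n) (T : Fin n → Bool) : size T ≤ size (insert a T) := by
  rw [size, size, countBelow_insert, if_neg (by omega)]
  exact le_max_left _ _

theorem countBelow_false (v : ℕ) : countBelow (fun _ : Fin n ↦ false) v = 0 := by
  induction n generalizing v with
  | zero => rfl
  | succ n ih =>
    cases v with
    | zero => rfl
    | succ v =>
      rw [countBelow]
      exact (zero_add _).trans (ih v)

/-- The word `w` has a strictly increasing subsequence of length `k` with letters below `v`. -/
def HasChain {L : ℕ} (w : Fin L → Fin n) (k v : ℕ) : Prop :=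
  ∃ s : Fin k → Fin L, StrictMono s ∧ StrictMono (w ∘ s) ∧ ∀ j, (w (s j) : ℕ) < v

theorem hasChain_zero {L : ℕ} (w : Fin L → Fin n) (v : ℕ) : HasChain w 0 v :=
  ⟨Fin.elim0, fun i ↦ i.elim0, fun i ↦ i.elim0, fun i ↦ i.elim0⟩

theorem hasChain_of_init {L : ℕ} {w : Fin (L + 1) → Fin n} {k v : ℕ}
    (h : HasChain (Fin.init w) k v) : HasChain w k v := by
  obtain ⟨s, hs, hw, hv⟩ := h
  exact ⟨fun j ↦ (s j).castSucc, fun i j hij ↦ hs hij, hw, hv⟩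

theorem hasChain_succ_iff {L : ℕ} (w : Fin (L + 1) → Fin n) (k v : ℕ) :
    HasChain w (k + 1) v ↔ HasChain (Fin.init w) (k + 1) v ∨
      (w (Fin.last L) : ℕ) < v ∧ HasChain (Fin.init w) k (w (Fin.last L)) := by
  constructor
  · rintro ⟨s, hs, hw, hv⟩
    by_cases h : s (Fin.last k) = Fin.last L
    · refine Or.inr ⟨h ▸ hv (Fin.last k), ?_⟩
      have hlt (j : Fin k) : s j.castSucc < Fin.last L := h ▸ hs (Fin.castSucc_lt_last j)
      refine ⟨fun j ↦ (s j.castSucc).castPred (hlt j).ne, fun i j hij ↦ ?_, fun i j hij ↦ ?_,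
        fun j ↦ ?_⟩
      · exact hs (Fin.castSucc_lt_castSucc_iff.2 hij)
      · simpa [Fin.init] using hw (Fin.castSucc_lt_castSucc_iff.2 hij)
      · simpa [Fin.init, h] using hw (Fin.castSucc_lt_last j)
    · have hlt (j : Fin (k + 1)) : s j < Fin.last L :=
        (hs.monotone (Fin.le_last j)).trans_lt (Fin.lt_last_iff_ne_last.2 h)
      refine Or.inl ⟨fun j ↦ (s j).castPred (hlt j).ne, fun i j hij ↦ hs hij,
        fun i j hij ↦ ?_, fun j ↦ ?_⟩
      · simpa [Fin.init] using hw hij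
      · simpa [Fin.init] using hv j
  · rintro (h | ⟨h, s, hs, hw, hv⟩)
    · exact hasChain_of_init h
    · refine ⟨Fin.snoc (fun j ↦ (s j).castSucc) (Fin.last L), ?_, ?_, ?_⟩
      · intro i j
        refine Fin.lastCases ?_ (fun j ↦ ?_) j
        · refine Fin.lastCases (by simp) (fun i ↦ ?_) i
          simp [Fin.castSucc_lt_last]
        · refine Fin.lastCases (fun hij ↦ ?_) (fun i hij ↦ ?_) i
          · exact absurd hij (Fin.castSucc_lt_last j).not_gt
          · simpa using hs (by simpa using hij)
      · intro i j
        refine Fin.lastCases ?_ (fun j ↦ ?_) j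
        · refine Fin.lastCases (by simp) (fun i ↦ ?_) i
          simpa [Fin.castSucc_lt_last, Fin.init] using hv i
        · refine Fin.lastCases (fun hij ↦ ?_) (fun i hij ↦ ?_) i
          · exact absurd hij (Fin.castSucc_lt_last j).not_gt
          · simpa [Fin.init] using hw (by simpa using hij)
      · refine Fin.lastCases (by simpa using h) (fun j ↦ ?_)
        simpa [Fin.init] using (hv j).trans h

theorem hasChain_iff {L : ℕ} (w : Fin L → Fin n) (k v : ℕ) :
    HasChain w k v ↔ k ≤ countBelow (state w) v := by
  induction L generalizing k v with
  | zero =>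
    cases k with
    | zero => simp [hasChain_zero]
    | succ k =>
      simp only [state, countBelow_false]
      exact iff_of_false (fun ⟨s, _⟩ ↦ (s 0).elim0) (by omega)
  | succ L ih =>
    cases k with
    | zero => simp [hasChain_zero]
    | succ k =>
      rw [hasChain_succ_iff, ih, ih, state, countBelow_insert]
      split_ifs <;> omega

theorem avoids_succ_iff {L : ℕ} (w : Fin L → Fin n) (m : ℕ) :
    Avoids (m + 1) w ↔ size (state w) ≤ m := by
  have h : (∃ s : Fin (m + 1) → Fin L, StrictMono s ∧ StrictMono (w ∘ s)) ↔
      HasChain w (m + 1) n := by simp [HasChain]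
  rw [Avoids, h, hasChain_iff, size, not_le, Nat.lt_succ_iff]

/-- The number of occurrences of each letter in a word. -/
def content {L : ℕ} (w : Fin L → Fin n) (v : Fin n) : ℕ := #{i | w i = v}

theorem content_succ {L : ℕ} (w : Fin (L + 1) → Fin n) :
    content w = content (Fin.init w) + Pi.single (w (Fin.last L)) 1 := by
  funext v
  simp only [content, Finset.card_filter, Fin.sum_univ_castSucc, Pi.add_apply, Fin.init]
  congr 1
  · exact (Finset.card_filter _ _).symm
  · simp [Pi.single_apply, eq_comm]

/-- The number of words of length `L` with given content that lead to a given state. -/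
def wordCount (L : ℕ) (c : Fin n → ℕ) (T : Fin n → Bool) : ℕ :=
  #{w : Fin L → Fin n | content w = c ∧ state w = T}

theorem wordCount_zero (T : Fin n → Bool) :
    wordCount 0 0 T = if T = fun _ ↦ false then 1 else 0 := by
  have h (w : Fin 0 → Fin n) : content w = 0 := by funext v; simp [content]
  simp only [wordCount, h, true_and, state]
  by_cases hT : T = fun _ ↦ false
  · simp [hT]
  · simp [hT, Ne.symm hT]

theorem add_single_eq_iff (c c' : Fin n → ℕ) (a : Fin n) :
    c' + Pi.single a 1 = c ↔ 0 < c a ∧ c' = c - Pi.single a 1 := by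
  constructor
  · rintro rfl
    simp
  · rintro ⟨h, rfl⟩
    funext v
    by_cases hv : v = a
    · subst hv
      simp
      omega
    · simp [hv]

theorem wordCount_succ (L : ℕ) (c : Fin n → ℕ) (T : Fin n → Bool) :
    wordCount (L + 1) c T = ∑ a, ∑ T', if 0 < c a ∧ insert a T' = T then
      wordCount L (c - Pi.single a 1) T' else 0 := by
  simp only [wordCount, Finset.card_filter]
  rw [← (Fin.snocEquiv fun _ : Fin (L + 1) ↦ Fin n).sum_comp, Fintype.sum_prod_type]
  refine Finset.sum_congr rfl fun a _ ↦ ?_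
  have h (w : Fin L → Fin n) :
      (if content (Fin.snoc w a : Fin (L + 1) → Fin n) = c ∧
        state (Fin.snoc w a : Fin (L + 1) → Fin n) = T then 1 else 0) =
      ∑ T', if 0 < c a ∧ insert a T' = T then
        (if content w = c - Pi.single a 1 ∧ state w = T' then 1 else 0) else 0 := by
    rw [Finset.sum_eq_single (state w)]
    · simp only [content_succ, Fin.init_snoc, Fin.snoc_last, state,
        add_single_eq_iff]
      split_ifs <;> tauto
    · intro T' _ hT'
      simp [hT'.symm]
    · simp
  refine (Finset.sum_congr rfl fun w _ ↦ h w).trans ?_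
  rw [Finset.sum_comm]
  refine Finset.sum_congr rfl fun T' _ ↦ ?_
  split_ifs <;> simp

theorem card_avoids (L m : ℕ) (c : Fin n → ℕ) :
    Nat.card {w : Fin L → Fin n // (∀ v, Nat.card {i // w i = v} = c v) ∧ Avoids (m + 1) w} =
      ∑ T with size T ≤ m, wordCount L c T := by
  classical
  simp only [Nat.card_eq_fintype_card, Fintype.card_subtype, avoids_succ_iff]
  simp only [wordCount]
  rw [← Finset.card_biUnion]
  · congr 1
    ext w
    simp only [Finset.mem_filter_univ, Finset.mem_biUnion, content, funext_iff]
    exact ⟨fun h ↦ ⟨_, h.2, h.1, fun _ ↦ rfl⟩, fun ⟨T, hT, h, h'⟩ ↦ ⟨h, funext h' ▸ hT⟩⟩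
  · intro T _ T' _ h
    rw [Function.onFun, Finset.disjoint_left]
    rintro w hw hw'
    simp only [Finset.mem_filter] at hw hw'
    exact h (hw.2.2.symm.trans hw'.2.2)

end Patience

namespace Laurent

open AddMonoidAlgebra (single)

variable {m : ℕ}

/-- The power `x_i ^ e` of a variable; it is `1` if `m ≤ i`. -/
noncomputable def varPow (i : ℕ) (e : ℤ) : Laurent m :=
  single (fun j ↦ if (j : ℕ) = i then e else 0) 1

theorem varPow_mul (i : ℕ) (e e' : ℤ) :
    (varPow i e * varPow i e' : Laurent m) = varPow i (e + e') := by
  rw [varPow, varPow, varPow, AddMonoidAlgebra.single_mul_single, mul_one]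
  congr 1
  funext j
  by_cases h : (j : ℕ) = i <;> simp [h]

theorem varPow_zero (i : ℕ) : (varPow i 0 : Laurent m) = 1 := by
  rw [varPow, AddMonoidAlgebra.one_def]
  congr 1
  funext j
  simp

theorem varPow_neg_one_mul (i : ℕ) : (varPow i (-1) * varPow i 1 : Laurent m) = 1 := by
  rw [varPow_mul, neg_add_cancel, varPow_zero]

theorem prod_single {ι : Type*} (s : Finset ι) (g : ι → Fin m → ℤ) :
    ∏ i ∈ s, (single (g i) 1 : Laurent m) = single (∑ i ∈ s, g i) 1 := by
  classical
  induction s using Finset.induction_on with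
  | empty => simp [AddMonoidAlgebra.one_def]
  | insert i s hi ih =>
    rw [Finset.prod_insert hi, ih, AddMonoidAlgebra.single_mul_single, Finset.sum_insert hi,
      mul_one]

theorem prod_varPow (f : Fin m → ℤ) : ∏ i : Fin m, (varPow i (f i) : Laurent m) = single f 1 := by
  simp only [varPow, prod_single]
  congr 1
  funext j
  simp [Finset.sum_apply, Fin.val_inj]

/-- The transposition of `i` and `i + 1`. -/
def finSwap (i : ℕ) (h : i + 1 < m) : Equiv.Perm (Fin m) :=
  Equiv.swap ⟨i, i.lt_succ_self.trans h⟩ ⟨i + 1, h⟩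

/-- The automorphism exchanging the variables `i` and `i + 1`. -/
noncomputable def swapVar (i : ℕ) (h : i + 1 < m) : Laurent m →+* Laurent m :=
  AddMonoidAlgebra.mapDomainRingHom ℚ
    (AddEquiv.arrowCongr (finSwap i h) (AddEquiv.refl ℤ)).toAddMonoidHom

theorem val_swap (i : ℕ) (h : i + 1 < m) (j : Fin m) :
    (finSwap i h j : ℕ) =
      Equiv.swap i (i + 1) (j : ℕ) := by
  simp only [finSwap, Equiv.swap_apply_def, Fin.ext_iff]
  split_ifs <;> rfl

theorem swapVar_single (i : ℕ) (h : i + 1 < m) (a : Fin m → ℤ) (c : ℚ) :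
    swapVar i h (single a c) =
      single (fun j ↦ a (finSwap i h j)) c := by
  rw [swapVar, AddMonoidAlgebra.mapDomainRingHom_apply, AddMonoidAlgebra.mapDomain_single]
  rfl

theorem swapVar_varPow (i : ℕ) (h : i + 1 < m) (j : ℕ) (e : ℤ) :
    swapVar i h (varPow j e) = varPow (Equiv.swap i (i + 1) j) e := by
  rw [varPow, swapVar_single, varPow]
  congr 1
  funext k
  rw [val_swap]
  simp only [Equiv.swap_apply_eq_iff]

theorem swapVar_varPow_of_lt {i j : ℕ} (h : i + 1 < m) (hj : i + 1 < j) (e : ℤ) :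
    swapVar i h (varPow j e) = varPow j e := by
  rw [swapVar_varPow, Equiv.swap_apply_of_ne_of_ne (by omega) (by omega)]

theorem swapVar_varPow_of_gt {i j : ℕ} (h : i + 1 < m) (hj : j < i) (e : ℤ) :
    swapVar i h (varPow j e) = varPow j e := by
  rw [swapVar_varPow, Equiv.swap_apply_of_ne_of_ne (by omega) (by omega)]

theorem coeff_zero_swapVar (i : ℕ) (h : i + 1 < m) (f : Laurent m) :
    (swapVar i h f).coeff 0 = f.coeff 0 := by
  induction f using AddMonoidAlgebra.induction_linear with
  | zero => simp
  | add f g hf hg => simp [hf, hg]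
  | single a c =>
    rw [swapVar_single, AddMonoidAlgebra.coeff_single, AddMonoidAlgebra.coeff_single,
      Finsupp.single_apply, Finsupp.single_apply]
    congr 1
    refine propext ⟨fun h' ↦ ?_, fun h' ↦ ?_⟩
    · funext j
      have := congrFun h' (finSwap i h j)
      simpa [finSwap] using this
    · subst h'
      rfl

/-- Laurent polynomials without positive powers of the last variable. -/
def lastNonpos (m : ℕ) : Subring (Laurent m) where
  carrier := {f | ∀ a ∈ f.coeff.support, ∀ j : Fin m, (j : ℕ) + 1 = m → a j ≤ 0}
  mul_mem' {f g} hf hg a ha j hj := by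
    classical
    obtain ⟨b, hb, c, hc, rfl⟩ :=
      Finset.mem_add.1 (AddMonoidAlgebra.support_coeff_mul_subset f g ha)
    exact add_nonpos (hf b hb j hj) (hg c hc j hj)
  one_mem' a ha j hj := by
    rw [AddMonoidAlgebra.one_def, AddMonoidAlgebra.coeff_single] at ha
    have := Finsupp.support_single_subset ha
    rw [Finset.mem_singleton] at this
    simp [this]
  add_mem' {f g} hf hg a ha j hj := by
    classical
    rw [AddMonoidAlgebra.coeff_add] at ha
    rcases Finset.mem_union.1 (Finsupp.support_add ha) with h | h
    · exact hf a h j hj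
    · exact hg a h j hj
  zero_mem' a ha := by simp at ha
  neg_mem' {f} hf a ha j hj := by
    rw [AddMonoidAlgebra.coeff_neg, Finsupp.support_neg] at ha
    exact hf a ha j hj

theorem single_mem_lastNonpos {a : Fin m → ℤ} (h : ∀ j : Fin m, (j : ℕ) + 1 = m → a j ≤ 0)
    (c : ℚ) : single a c ∈ lastNonpos m := by
  intro b hb
  rw [AddMonoidAlgebra.coeff_single] at hb
  have := Finsupp.support_single_subset hb
  rw [Finset.mem_singleton] at this
  rwa [this]

theorem varPow_mem_lastNonpos {i : ℕ} (h : i + 1 ≠ m) (e : ℤ) : varPow i e ∈ lastNonpos m := by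
  refine single_mem_lastNonpos (fun j hj ↦ ?_) _
  rw [if_neg (by omega)]

theorem varPow_neg_one_mem_lastNonpos (i : ℕ) : varPow i (-1) ∈ lastNonpos m := by
  refine single_mem_lastNonpos (fun j hj ↦ ?_) _
  split_ifs <;> simp

/-- The Weyl-denominator type prefactor `∏_{i < j} (1 - x_j / x_i)`, as a determinant. -/
noncomputable def weyl (m : ℕ) : Laurent m :=
  (Matrix.of fun k j : Fin m ↦ (varPow j ((k : ℤ) - j) : Laurent m)).det

theorem weyl_eq_sum :
    weyl m = ∑ σ : Equiv.Perm (Fin m),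
      Equiv.Perm.sign σ • single (fun j ↦ ((σ j : ℕ) : ℤ) - (j : ℕ)) 1 := by
  rw [weyl, Matrix.det_apply]
  refine Finset.sum_congr rfl fun σ _ ↦ ?_
  rw [← prod_varPow]
  rfl

theorem coeff_zero_weyl : (weyl m).coeff 0 = 1 := by
  rw [weyl_eq_sum, AddMonoidAlgebra.coeff_sum, Finsupp.finsetSum_apply,
    Finset.sum_eq_single 1]
  · simp [AddMonoidAlgebra.coeff_single, Finsupp.single_apply]
    rfl
  · intro σ _ hσ
    have : (fun j ↦ ((σ j : ℕ) : ℤ) - (j : ℕ)) ≠ 0 := by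
      intro h
      refine hσ (Equiv.ext fun j ↦ Fin.ext ?_)
      have := congrFun h j
      simp only [Pi.zero_apply] at this
      simp
      omega
    rcases Int.units_eq_one_or (Equiv.Perm.sign σ) with h | h <;>
      simp [h, AddMonoidAlgebra.coeff_single, this]
  · simp

theorem weyl_mem_lastNonpos : weyl m ∈ lastNonpos m := by
  rw [weyl_eq_sum]
  refine Subring.sum_mem _ fun σ _ ↦ ?_
  have h : single (fun j ↦ ((σ j : ℕ) : ℤ) - (j : ℕ)) 1 ∈ lastNonpos m :=
    single_mem_lastNonpos (fun j hj ↦ by have := (σ j).2; omega) 1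
  rcases Int.units_eq_one_or (Equiv.Perm.sign σ) with h' | h' <;> rw [h']
  · simpa using h
  · simpa using h

theorem swapVar_varPow_mul_weyl (i : ℕ) (h : i + 1 < m) :
    swapVar i h (varPow (i + 1) 1 * weyl m) = -(varPow (i + 1) 1 * weyl m) := by
  set e : Equiv.Perm (Fin m) := finSwap i h with he
  set B : Matrix (Fin m) (Fin m) (Laurent m) := Matrix.of fun k j ↦
    varPow j ((k : ℤ) - j + if (j : ℕ) = i + 1 then 1 else 0) with hB
  have hdet : varPow (i + 1) 1 * weyl m = B.det := by
    have hprod : (varPow (i + 1) 1 : Laurent m) =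
        ∏ j : Fin m, varPow j (if (j : ℕ) = i + 1 then 1 else 0) := by
      rw [prod_varPow (fun j : Fin m ↦ if (j : ℕ) = i + 1 then 1 else 0)]
      rfl
    rw [hprod, weyl, ← Matrix.det_mul_row]
    congr 1
    ext1 k j
    simp only [Matrix.of_apply, B, varPow_mul, add_comm]
  have hswap : (swapVar i h).mapMatrix B = B.submatrix id e := by
    ext1 k j
    simp only [RingHom.mapMatrix_apply, Matrix.map_apply, Matrix.submatrix_apply, id, B,
      Matrix.of_apply, swapVar_varPow, val_swap, e]
    congr 1
    rw [Equiv.swap_apply_def]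
    split_ifs <;> push_cast <;> omega
  rw [hdet, RingHom.map_det, hswap, Matrix.det_permute', he, finSwap, Equiv.Perm.sign_swap]
  · simp
  · simp [Fin.ext_iff]

/-- The submonoid of functions symmetric in the variables from `p` on, and without positive powers
of the last variable if `p < m`. -/
def symmFrom (m p : ℕ) : Submonoid (Laurent m) where
  carrier := {S | (∀ (i : ℕ) (h : i + 1 < m), p ≤ i → swapVar i h S = S) ∧
    (p < m → S ∈ lastNonpos m)}
  mul_mem' {S T} hS hT := ⟨fun i h hi ↦ by rw [map_mul, hS.1 i h hi, hT.1 i h hi],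
    fun h ↦ Subring.mul_mem _ (hS.2 h) (hT.2 h)⟩
  one_mem' := ⟨fun i h _ ↦ map_one _, fun _ ↦ Subring.one_mem _⟩

theorem symmFrom_mono {p q : ℕ} (h : p ≤ q) : symmFrom m p ≤ symmFrom m q :=
  fun _ hS ↦ ⟨fun i hi hq ↦ hS.1 i hi (h.trans hq), fun hq ↦ hS.2 (h.trans_lt hq)⟩

/-- The functions `f` such that `weyl m * (S * f)` has constant term zero for all `S` in
`symmFrom m p`. -/
def nullFrom (m p : ℕ) : AddSubgroup (Laurent m) where
  carrier := {f | ∀ S ∈ symmFrom m p, (weyl m * (S * f)).coeff 0 = 0}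
  add_mem' {f g} hf hg S hS := by simp [mul_add, hf S hS, hg S hS]
  zero_mem' S _ := by simp
  neg_mem' {f} hf S hS := by simp [hf S hS]

theorem mul_mem_nullFrom {p q : ℕ} (hpq : p ≤ q) {S f : Laurent m} (hS : S ∈ symmFrom m q)
    (hf : f ∈ nullFrom m q) : S * f ∈ nullFrom m p := fun S' hS' ↦ by
  rw [← mul_assoc S']
  exact hf _ (mul_mem (symmFrom_mono hpq hS') hS)

theorem varPow_one_mul_mem_nullFrom {p i : ℕ} (h : i + 1 < m) (hp : p ≤ i) {g : Laurent m}
    (hg : swapVar i h g = g) : varPow (i + 1) 1 * g ∈ nullFrom m p := by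
  intro S hS
  have h₁ : weyl m * (S * (varPow (i + 1) 1 * g)) = varPow (i + 1) 1 * weyl m * (S * g) := by
    ring
  have h₂ := coeff_zero_swapVar i h (varPow (i + 1) 1 * weyl m * (S * g))
  rw [map_mul, swapVar_varPow_mul_weyl, map_mul, hg, hS.1 i h hp, neg_mul,
    AddMonoidAlgebra.coeff_neg, Finsupp.neg_apply] at h₂
  rw [h₁]
  linarith

theorem varPow_neg_one_mem_nullFrom {p j : ℕ} (hp : p ≤ j) (hj : j < m) :
    varPow j (-1) ∈ nullFrom m p := by
  by_cases h : j + 1 < m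
  · have h₁ : (varPow j (-1) : Laurent m) =
        varPow (j + 1) 1 * (varPow j (-1) * varPow (j + 1) (-1)) := by
      rw [mul_left_comm, mul_comm (varPow (j + 1) 1), varPow_neg_one_mul, mul_one]
    rw [h₁]
    refine varPow_one_mul_mem_nullFrom h hp ?_
    rw [map_mul, swapVar_varPow, swapVar_varPow, Equiv.swap_apply_left, Equiv.swap_apply_right,
      mul_comm]
  · intro S hS
    have hmem : weyl m * S ∈ lastNonpos m :=
      Subring.mul_mem _ weyl_mem_lastNonpos (hS.2 (hp.trans_lt hj))
    rw [← mul_assoc, mul_comm, varPow]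
    by_contra hne
    classical
    obtain ⟨b, hb, c, hc, hbc⟩ := Finset.mem_add.1
      (AddMonoidAlgebra.support_coeff_mul_subset _ _ (Finsupp.mem_support_iff.2 hne))
    rw [AddMonoidAlgebra.coeff_single] at hb
    have := Finsupp.support_single_subset hb
    rw [Finset.mem_singleton] at this
    subst this
    have h₁ := hmem c hc ⟨j, hj⟩ (by simp only; omega)
    have h₂ := congrFun hbc ⟨j, hj⟩
    simp at h₂
    omega

/-- The generating function of the complete homogeneous symmetric functions in the first `p`
variables. -/
noncomputable def completeSeries (p : ℕ) : PowerSeries (Laurent m) :=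
  ∏ i ∈ Finset.range p, PowerSeries.mk fun k ↦ varPow i k

/-- The complete homogeneous symmetric function of degree `c` in the first `p` variables. -/
noncomputable def complete (p c : ℕ) : Laurent m := PowerSeries.coeff c (completeSeries p)

/-- The complete homogeneous symmetric function of degree `c - 1`; it is zero for `c = 0`. -/
noncomputable def completePred (p : ℕ) : ℕ → Laurent m
  | 0 => 0
  | c + 1 => complete p c

theorem completePred_succ (p c : ℕ) : (completePred p (c + 1) : Laurent m) = complete p c := rfl

theorem completeSeries_succ (p : ℕ) : (completeSeries (p + 1) : PowerSeries (Laurent m)) =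
    completeSeries p + PowerSeries.X * (PowerSeries.C (varPow p 1) * completeSeries (p + 1)) := by
  have h : (PowerSeries.mk fun k : ℕ ↦ varPow p k : PowerSeries (Laurent m)) =
      1 + PowerSeries.X * (PowerSeries.C (varPow p 1) * PowerSeries.mk fun k : ℕ ↦ varPow p k) := by
    ext1 k
    cases k with
    | zero => simp [varPow_zero]
    | succ k =>
      rw [map_add, PowerSeries.coeff_succ_X_mul, PowerSeries.coeff_C_mul, PowerSeries.coeff_mk,
        PowerSeries.coeff_mk, varPow_mul, PowerSeries.coeff_one, if_neg (by omega), zero_add,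
        Nat.cast_succ, add_comm]
  have h' : (completeSeries (p + 1) : PowerSeries (Laurent m)) =
      completeSeries p * PowerSeries.mk fun k ↦ varPow p k := Finset.prod_range_succ _ _
  rw [h']
  linear_combination completeSeries p * h

theorem complete_succ (p c : ℕ) : (complete (p + 1) c : Laurent m) =
    complete p c + varPow p 1 * completePred (p + 1) c := by
  rw [complete, completeSeries_succ, map_add]
  congr 1
  cases c with
  | zero => simp [completePred]
  | succ c => rw [PowerSeries.coeff_succ_X_mul, PowerSeries.coeff_C_mul]; rfl

theorem complete_zero_right (p : ℕ) : (complete p 0 : Laurent m) = 1 := by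
  simp [complete, completeSeries, varPow_zero]

theorem complete_zero_left_succ (c : ℕ) : (complete 0 (c + 1) : Laurent m) = 0 := by
  simp [complete, completeSeries, PowerSeries.coeff_one]

theorem map_swapVar_completeSeries {i p : ℕ} (h : i + 1 < m) (hp : i + 1 ≠ p) :
    PowerSeries.map (swapVar i h) (completeSeries p) = completeSeries p := by
  have h₁ : PowerSeries.map (swapVar i h) (completeSeries p) =
      ∏ j ∈ Finset.range p, PowerSeries.mk fun k ↦ varPow (Equiv.swap i (i + 1) j) k := by
    rw [completeSeries, map_prod]
    refine Finset.prod_congr rfl fun j _ ↦ ?_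
    ext1 k
    simp [swapVar_varPow]
  rw [h₁]
  by_cases hip : i < p
  · refine Equiv.Perm.prod_comp (Equiv.swap i (i + 1)) (Finset.range p)
      (fun j ↦ PowerSeries.mk fun k ↦ varPow j k) fun j hj ↦ ?_
    simp only [Finset.coe_range, Set.mem_Iio]
    by_contra hjp
    exact hj (Equiv.swap_apply_of_ne_of_ne (by omega) (by omega))
  · refine Finset.prod_congr rfl fun j hj ↦ ?_
    rw [Finset.mem_range] at hj
    rw [Equiv.swap_apply_of_ne_of_ne (by omega) (by omega)]

theorem swapVar_complete {i p : ℕ} (h : i + 1 < m) (hp : i + 1 ≠ p) (c : ℕ) :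
    swapVar i h (complete p c) = complete p c := by
  rw [complete, ← PowerSeries.coeff_map, map_swapVar_completeSeries h hp]

theorem swapVar_completePred {i p : ℕ} (h : i + 1 < m) (hp : i + 1 ≠ p) (c : ℕ) :
    swapVar i h (completePred p c) = completePred p c := by
  cases c with
  | zero => exact map_zero _
  | succ c => exact swapVar_complete h hp c

theorem complete_mem_lastNonpos {p : ℕ} (hp : p < m) (c : ℕ) : complete p c ∈ lastNonpos m := by
  refine Subring.mem_carrier.1 ?_
  induction p generalizing c with
  | zero =>
    cases c with
    | zero => rw [complete_zero_right]; exact Subring.one_mem _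
    | succ c => rw [complete_zero_left_succ]; exact Subring.zero_mem _
  | succ p ih =>
    induction c with
    | zero => rw [complete_zero_right]; exact Subring.one_mem _
    | succ c ihc =>
      rw [complete_succ]
      exact Subring.add_mem _ (ih (by omega) _)
        (Subring.mul_mem _ (varPow_mem_lastNonpos (by omega) _) ihc)

theorem complete_mem_symmFrom (p c : ℕ) : complete p c ∈ symmFrom m p :=
  ⟨fun _ h hi ↦ swapVar_complete h (by omega) c, fun h ↦ complete_mem_lastNonpos h c⟩

theorem varPow_mul_completePred_mem_symmFrom (p c : ℕ) :
    varPow p 1 * completePred (p + 1) c ∈ symmFrom m (p + 1) := by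
  refine mul_mem ⟨fun i h hi ↦ swapVar_varPow_of_gt h (by omega) 1,
    fun h ↦ varPow_mem_lastNonpos (by omega) 1⟩ ?_
  cases c with
  | zero => exact ⟨fun i h _ ↦ map_zero _, fun _ ↦ Subring.zero_mem _⟩
  | succ c => exact complete_mem_symmFrom (p + 1) c

/-- The sum of the inverses of the variables. -/
noncomputable def invSum (m : ℕ) : Laurent m := ∑ j ∈ Finset.range m, varPow j (-1)

theorem invSum_mem_symmFrom : invSum m ∈ symmFrom m 0 := by
  refine ⟨fun i h _ ↦ ?_, fun _ ↦ Subring.sum_mem _ fun j _ ↦ varPow_neg_one_mem_lastNonpos j⟩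
  simp only [invSum, map_sum, swapVar_varPow]
  refine Equiv.Perm.sum_comp (Equiv.swap i (i + 1)) (Finset.range m)
    (fun j ↦ varPow j (-1)) fun j hj ↦ ?_
  simp only [Finset.coe_range, Set.mem_Iio]
  by_contra hjp
  exact hj (Equiv.swap_apply_of_ne_of_ne (by omega) (by omega))

end Laurent

namespace Patience

open Laurent

variable {m n : ℕ}

/-- The factor contributed by the smallest letter. -/
noncomputable def headWeight (p : ℕ) (b : Bool) (c : ℕ) : Laurent m :=
  if b then varPow p 1 * completePred (p + 1) c else complete p c

/-- The weight of a state of patience sorting relative to a content. -/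
noncomputable def weight : {n : ℕ} → ℕ → (Fin n → Bool) → (Fin n → ℕ) → Laurent m
  | 0, _, _, _ => 1
  | _ + 1, p, T, c =>
    headWeight p (T 0) (c 0) * weight (p + (T 0).toNat) (Fin.tail T) (Fin.tail c)

@[simp] theorem weight_cons (p : ℕ) (b : Bool) (T : Fin n → Bool) (c₀ : ℕ) (c : Fin n → ℕ) :
    (weight p (Fin.cons b T : Fin (n + 1) → Bool) (Fin.cons c₀ c : Fin (n + 1) → ℕ) : Laurent m) =
      headWeight p b c₀ * weight (p + b.toNat) T c := rfl

theorem headWeight_mem_symmFrom (p : ℕ) (b : Bool) (c : ℕ) :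
    headWeight p b c ∈ symmFrom m (p + b.toNat) := by
  cases b with
  | false => exact complete_mem_symmFrom p c
  | true => exact varPow_mul_completePred_mem_symmFrom p c

theorem swapVar_weight {i p : ℕ} (h : i + 1 < m) (hp : i + 1 < p) (T : Fin n → Bool)
    (c : Fin n → ℕ) : swapVar i h (weight p T c) = weight p T c := by
  induction n generalizing p with
  | zero => exact map_one _
  | succ n ih =>
    rw [weight, map_mul, ih (by omega)]
    congr 1
    cases T 0 with
    | false => exact swapVar_complete h (by omega) _
    | true =>
      rw [headWeight, if_pos rfl, map_mul, swapVar_varPow_of_lt h (by omega),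
        swapVar_completePred h (by omega)]

theorem weight_zero (p : ℕ) (T : Fin n → Bool) :
    (weight p T 0 : Laurent m) = if T = fun _ ↦ false then 1 else 0 := by
  induction n generalizing p with
  | zero => simp [weight, Subsingleton.elim T fun _ ↦ false]
  | succ n ih =>
    induction T using Fin.consCases with
    | _ b T =>
    have h₀ : (0 : Fin (n + 1) → ℕ) = Fin.cons 0 0 := by
      funext i
      refine Fin.cases rfl (fun _ ↦ rfl) i
    have h₁ : (fun _ ↦ false : Fin (n + 1) → Bool) = Fin.cons false fun _ ↦ false := by
      funext i
      refine Fin.cases rfl (fun _ ↦ rfl) i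
    rw [h₀, weight_cons, ih, h₁]
    cases b with
    | false => simp [headWeight, complete_zero_right, Fin.cons_inj]
    | true => simp [headWeight, completePred, Fin.cons_inj]

theorem sum_cons {M : Type*} [AddCommMonoid M] (f : (Fin (n + 1) → Bool) → M) :
    ∑ T, f T = ∑ T, f (Fin.cons true T) + ∑ T, f (Fin.cons false T) := by
  rw [← (Fin.consEquiv fun _ : Fin (n + 1) ↦ Bool).sum_comp, Fintype.sum_prod_type,
    Fintype.sum_bool]
  rfl

/-- The total weight of the states from which `T` arises by unmarking the first marked letter. -/
noncomputable def eraseWeight (p : ℕ) (T : Fin n → Bool) (c : Fin n → ℕ) : Laurent m :=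
  ∑ T', if eraseFirst T' = T then weight p T' c else 0

/-- The total weight of the states from which `T` arises by insertion of a letter. -/
noncomputable def insertWeight (p : ℕ) (T : Fin n → Bool) (c : Fin n → ℕ) : Laurent m :=
  ∑ a, ∑ T', if 0 < c a ∧ insert a T' = T then weight p T' (c - Pi.single a 1) else 0

theorem eraseWeight_cons_true (p : ℕ) (T : Fin n → Bool) (c : Fin (n + 1) → ℕ) :
    (eraseWeight p (Fin.cons true T : Fin (n + 1) → Bool) c : Laurent m) = 0 := by
  simp [eraseWeight, sum_cons, Fin.cons_inj]

theorem eraseWeight_cons_false (p : ℕ) (T : Fin n → Bool) (c₀ : ℕ) (c : Fin n → ℕ) :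
    (eraseWeight p (Fin.cons false T : Fin (n + 1) → Bool) (Fin.cons c₀ c : Fin (n + 1) → ℕ) :
      Laurent m) = varPow p 1 * completePred (p + 1) c₀ * weight (p + 1) T c +
        complete p c₀ * eraseWeight p T c := by
  simp [eraseWeight, sum_cons, Fin.cons_inj, headWeight, Finset.mul_sum]

theorem weight_sub_eraseWeight_mem_nullFrom {p : ℕ} (T : Fin n → Bool) (c : Fin n → ℕ)
    (h : p + 1 + size T ≤ m) : weight (p + 1) T c - eraseWeight p T c ∈ nullFrom m p := by
  induction n with
  | zero =>
    simp [weight, eraseWeight, Subsingleton.elim _ T]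
  | succ n ih =>
    induction T using Fin.consCases with
    | _ b T =>
    induction c using Fin.consCases with
    | _ c₀ c =>
    rw [size_cons] at h
    cases b with
    | false =>
      have : weight (p + 1) (Fin.cons false T : Fin (n + 1) → Bool)
          (Fin.cons c₀ c : Fin (n + 1) → ℕ) -
          eraseWeight p (Fin.cons false T : Fin (n + 1) → Bool) (Fin.cons c₀ c : Fin (n + 1) → ℕ) =
          complete p c₀ * (weight (p + 1) T c - eraseWeight p T c : Laurent m) := by
        rw [eraseWeight_cons_false, weight_cons, headWeight, if_neg (by simp), complete_succ]
        simp only [Bool.toNat_false, add_zero]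
        ring
      rw [this]
      exact mul_mem_nullFrom le_rfl (complete_mem_symmFrom p c₀) (ih T c (by simpa using h))
    | true =>
      rw [eraseWeight_cons_true, sub_zero, weight_cons, headWeight, if_pos rfl, mul_assoc]
      simp only [Bool.toNat_true] at h ⊢
      refine varPow_one_mul_mem_nullFrom (by omega) le_rfl ?_
      rw [map_mul, swapVar_completePred _ (by omega), swapVar_weight _ (by omega)]

theorem cons_sub_single_zero (c₀ : ℕ) (c : Fin n → ℕ) :
    (Fin.cons c₀ c - Pi.single 0 1 : Fin (n + 1) → ℕ) = Fin.cons (c₀ - 1) c := by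
  funext i
  refine Fin.cases ?_ (fun i ↦ ?_) i <;> simp

theorem cons_sub_single_succ (c₀ : ℕ) (c : Fin n → ℕ) (a : Fin n) :
    (Fin.cons c₀ c - Pi.single a.succ 1 : Fin (n + 1) → ℕ) =
      Fin.cons c₀ (c - Pi.single a 1) := by
  funext i
  refine Fin.cases ?_ (fun i ↦ ?_) i
  · simp
  · simp [Pi.single_apply]

theorem insertWeight_cons (p : ℕ) (b : Bool) (T : Fin n → Bool) (c₀ : ℕ) (c : Fin n → ℕ) :
    (insertWeight p (Fin.cons b T : Fin (n + 1) → Bool) (Fin.cons c₀ c : Fin (n + 1) → ℕ) :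
      Laurent m) = (if 0 < c₀ ∧ b = true then
        varPow p 1 * completePred (p + 1) (c₀ - 1) * weight (p + 1) T c +
          complete p (c₀ - 1) * eraseWeight p T c else 0) +
      headWeight p b c₀ * insertWeight (p + b.toNat) T c := by
  rw [insertWeight, Fin.sum_univ_succ]
  congr 1
  · by_cases hc : 0 < c₀ <;> cases b <;>
      simp [sum_cons, cons_sub_single_zero, Fin.cons_inj, eraseWeight, headWeight, hc,
        Finset.mul_sum]
  · simp only [insertWeight, Finset.mul_sum]
    refine Finset.sum_congr rfl fun a _ ↦ ?_
    by_cases hc : 0 < c a <;> cases b <;>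
      simp [sum_cons, cons_sub_single_succ, Fin.cons_inj, hc]

theorem sum_varPow_mul_weight_sub_insertWeight_mem_nullFrom {p : ℕ} (T : Fin n → Bool)
    (c : Fin n → ℕ) (h : p + size T ≤ m) :
    (∑ j ∈ Finset.Ico p m, varPow j (-1)) * weight p T c - insertWeight p T c ∈
      nullFrom m p := by
  induction n generalizing p with
  | zero =>
    simp only [weight, insertWeight, Finset.univ_eq_empty, Finset.sum_empty, sub_zero, mul_one]
    exact AddSubgroup.sum_mem _ fun j hj ↦
      varPow_neg_one_mem_nullFrom (Finset.mem_Ico.1 hj).1 (Finset.mem_Ico.1 hj).2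
  | succ n ih =>
    induction T using Fin.consCases with
    | _ b T =>
    induction c using Fin.consCases with
    | _ c₀ c =>
    rw [size_cons] at h
    have hrec : headWeight p b c₀ * ((∑ j ∈ Finset.Ico (p + b.toNat) m, varPow j (-1)) *
        weight (p + b.toNat) T c - insertWeight (p + b.toNat) T c) ∈ nullFrom m p :=
      mul_mem_nullFrom (Nat.le_add_right _ _) (headWeight_mem_symmFrom p b c₀)
        (ih T c (by omega))
    rw [weight_cons, insertWeight_cons]
    cases b with
    | false =>
      convert hrec using 1
      simp
      ring
    | true =>
      simp only [Bool.toNat_true] at h hrec ⊢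
      rw [Finset.sum_eq_sum_Ico_succ_bot (by omega)]
      cases c₀ with
      | zero =>
        convert hrec using 1
        simp [headWeight, completePred]
      | succ c₀ =>
        convert add_mem hrec (mul_mem_nullFrom le_rfl (complete_mem_symmFrom p c₀)
          (weight_sub_eraseWeight_mem_nullFrom T c (by omega))) using 1
        simp only [headWeight, if_true, completePred_succ, Nat.succ_pos, and_self,
          Nat.add_sub_cancel]
        linear_combination (complete (p + 1) c₀ * weight (p + 1) T c) * varPow_neg_one_mul p +
          weight (p + 1) T c * complete_succ p c₀

theorem cast_wordCount (L : ℕ) (c : Fin n → ℕ) (hc : ∑ v, c v = L) (T : Fin n → Bool)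
    (hT : size T ≤ m) :
    (wordCount L c T : ℚ) = (weyl m * (invSum m ^ L * weight 0 T c)).coeff 0 := by
  induction L generalizing c T with
  | zero =>
    have : c = 0 := by
      funext v
      exact (Finset.sum_eq_zero_iff.1 hc) v (Finset.mem_univ v)
    subst this
    rw [wordCount_zero, weight_zero]
    split_ifs <;> simp [coeff_zero_weyl]
  | succ L ih =>
    have h₁ := sum_varPow_mul_weight_sub_insertWeight_mem_nullFrom (p := 0) T c (by omega)
      (invSum m ^ L) (pow_mem invSum_mem_symmFrom L)
    rw [← Finset.range_eq_Ico, ← invSum, mul_sub, mul_sub, AddMonoidAlgebra.coeff_sub,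
      Finsupp.sub_apply, sub_eq_zero, ← mul_assoc (invSum m ^ L), ← pow_succ] at h₁
    rw [h₁, wordCount_succ, insertWeight]
    simp only [Finset.mul_sum, AddMonoidAlgebra.coeff_sum, Finsupp.finsetSum_apply]
    push_cast
    refine Finset.sum_congr rfl fun a _ ↦ Finset.sum_congr rfl fun T' _ ↦ ?_
    split_ifs with h
    · refine ih _ ?_ _ ((size_le_size_insert a T').trans (h.2 ▸ hT))
      have h₂ := (add_single_eq_iff c _ a).2 ⟨h.1, rfl⟩
      rw [← h₂] at hc
      simpa [Finset.sum_add_distrib] using hc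
    · simp

/-- The total weight of the states with at most `m - p` marked letters. -/
noncomputable def totalWeight (m p : ℕ) (c : Fin n → ℕ) : Laurent m :=
  ∑ T, if p + size T ≤ m then weight p T c else 0

theorem totalWeight_cons {p : ℕ} (hp : p ≤ m) (c₀ : ℕ) (c : Fin n → ℕ) :
    totalWeight m p (Fin.cons c₀ c : Fin (n + 1) → ℕ) = complete p c₀ * totalWeight m p c +
      varPow p 1 * completePred (p + 1) c₀ * if p < m then totalWeight m (p + 1) c else 0 := by
  rw [totalWeight, sum_cons, add_comm]
  congr 1
  · simp [totalWeight, headWeight, Finset.mul_sum]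
  · split_ifs with h
    · simp [totalWeight, headWeight, Finset.mul_sum, ← add_assoc]
    · refine (Finset.sum_eq_zero fun T _ ↦ ?_).trans (mul_zero _).symm
      rw [if_neg]
      simp
      omega

theorem complete_sub_mul_mem_nullFrom {p q : ℕ} (hpq : p + 1 ≤ q) (hq : q ≤ m) (c : ℕ)
    {F : Laurent m} (hF : ∀ (i : ℕ) (h : i + 1 < m), swapVar i h F = F) :
    (complete q c - complete (p + 1) c) * F ∈ nullFrom m p := by
  induction q, hpq using Nat.le_induction with
  | base => simp
  | succ q hpq ih =>
    obtain ⟨i, rfl⟩ : ∃ i, q = i + 1 := ⟨q - 1, by omega⟩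
    have : varPow (i + 1) 1 * (completePred (i + 1 + 1) c * F) ∈ nullFrom m p := by
      refine varPow_one_mul_mem_nullFrom hq (by omega) ?_
      rw [map_mul, swapVar_completePred _ (by omega), hF]
    convert add_mem (ih (by omega)) this using 1
    rw [complete_succ (i + 1)]
    ring

theorem prod_complete_sub_totalWeight_mem_nullFrom {p : ℕ} (hp : p ≤ m) (c : Fin n → ℕ) :
    ∏ v, complete m (c v) - totalWeight m p c ∈ nullFrom m p := by
  induction n generalizing p with
  | zero => simp [totalWeight, weight, hp]
  | succ n ih =>
    induction c using Fin.consCases with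
    | _ c₀ c =>
    rw [totalWeight_cons hp, Fin.prod_univ_succ]
    simp only [Fin.cons_zero, Fin.cons_succ]
    have h₁ := mul_mem_nullFrom le_rfl (complete_mem_symmFrom p c₀) (ih hp c)
    split_ifs with h
    · have h₂ := mul_mem_nullFrom (Nat.le_succ p) (varPow_mul_completePred_mem_symmFrom p c₀)
        (ih h c)
      have h₃ := complete_sub_mul_mem_nullFrom h le_rfl c₀ (F := ∏ v, complete m (c v))
        fun i hi ↦ by
          rw [map_prod]
          exact Finset.prod_congr rfl fun v _ ↦ swapVar_complete hi hi.ne _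
      convert add_mem (add_mem h₁ h₂) h₃ using 1
      rw [complete_succ]
      ring
    · obtain rfl : p = m := by omega
      convert h₁ using 1
      ring

theorem cast_card_avoids (L m : ℕ) (c : Fin n → ℕ) (hc : ∑ v, c v = L) :
    (Nat.card {w : Fin L → Fin n //
      (∀ v, Nat.card {i // w i = v} = c v) ∧ Avoids (m + 1) w} : ℚ) =
      (weyl m * (invSum m ^ L * ∏ v, complete m (c v))).coeff 0 := by
  have h := prod_complete_sub_totalWeight_mem_nullFrom (Nat.zero_le m) c (invSum m ^ L)
    (pow_mem invSum_mem_symmFrom L)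
  rw [mul_sub, mul_sub, AddMonoidAlgebra.coeff_sub, Finsupp.sub_apply, sub_eq_zero] at h
  rw [h, card_avoids, totalWeight, ← Finset.sum_filter]
  simp only [Finset.mul_sum, AddMonoidAlgebra.coeff_sum, Finsupp.finsetSum_apply, zero_add]
  push_cast
  exact Finset.sum_congr rfl fun T hT ↦ cast_wordCount L c hc T (Finset.mem_filter.1 hT).2

end Patience

theorem cast_A_eq_coeff (m r n : ℕ) :
    (A (m + 1) r n : ℚ) = (Laurent.weyl m *
      (Laurent.invSum m ^ r * Laurent.complete m r) ^ n).coeff 0 := by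
  rw [A, Patience.cast_card_avoids (n * r) m (fun _ ↦ r) (by simp)]
  simp [mul_pow, ← pow_mul, mul_comm n r]

/-- For every `d ≥ 2` and `r ≥ 1`, the sequence `n ↦ A d r n` is P-recursive. -/
theorem A_isPRecursive (d r : ℕ) (hd : 2 ≤ d) (hr : 1 ≤ r) :
    ∃ (k : ℕ) (p : Fin (k + 1) → Polynomial ℚ),
      (∃ i, p i ≠ 0) ∧
      ∀ n : ℕ, ∑ i : Fin (k + 1), (p i).eval (n : ℚ) * (A d r (n + i) : ℚ) = 0 := by
  obtain ⟨m, rfl⟩ : ∃ m, d = m + 1 := ⟨d - 1, by omega⟩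
  simp only [cast_A_eq_coeff]
  exact Laurent.exists_recurrence_coeff_zero _ _
end

section
/- For every integer d ≥ 2 and every integer r ≥ 1, the ordinary generating function f(x) = Σ_{n≥0} A_{d,r}(n) x^n, regarded as a formal power series with rational coefficients, is D-finite: there exist a natural number m and polynomials c_0(x), c_1(x), ..., c_m(x) with rational coefficients, not all zero, such that c_m(x)·f^{(m)}(x) + ... + c_1(x)·f'(x) + c_0(x)·f(x) = 0, where f^{(i)} denotes the i-th formal derivative of the power series f. -/
/-- Laurent polynomials over `ℚ` in `k` variables. -/
abbrev LaurentMv (k : ℕ) : Type := AddMonoidAlgebra ℚ (Fin k → ℤ)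

namespace LaurentMv

variable {k : ℕ}

/-- The Laurent monomial with exponent vector `m`. -/
noncomputable def mono (m : Fin k → ℤ) : LaurentMv k := AddMonoidAlgebra.single m 1

lemma mono_mul (m m' : Fin k → ℤ) : mono m * mono m' = mono (m + m') := by
  simp [mono]

@[simp] lemma mono_zero : mono (0 : Fin k → ℤ) = 1 := rfl

lemma coeff_mono_mul (m : Fin k → ℤ) (f : LaurentMv k) (x : Fin k → ℤ) :
    (mono m * f).coeff x = f.coeff (x - m) := by
  rw [mono, AddMonoidAlgebra.coeff_single_mul_eq_mul_coeff (m₂ := x - m), one_mul]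
  intro m' _
  constructor
  · rintro rfl; simp
  · rintro rfl; simp

lemma span_mono : Submodule.span ℚ (Set.range (mono (k := k))) = ⊤ := by
  refine top_unique fun f _ => ?_
  induction f using AddMonoidAlgebra.induction_linear with
  | zero => exact zero_mem _
  | add f g hf hg => exact add_mem (hf trivial) (hg trivial)
  | single m a =>
    have : AddMonoidAlgebra.single m a = a • mono m := by simp [mono]
    rw [this]
    exact Submodule.smul_mem _ _ (Submodule.subset_span ⟨m, rfl⟩)

/-- The partial derivative with respect to the `i`-th variable. -/
noncomputable def pderiv (i : Fin k) : LaurentMv k →ₗ[ℚ] LaurentMv k :=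
  Finsupp.linearCombination ℚ (fun m : Fin k → ℤ => (m i : ℚ) • mono (m - Pi.single i 1)) ∘ₗ
    (AddMonoidAlgebra.coeffLinearEquiv ℚ).toLinearMap

lemma pderiv_mono (i : Fin k) (m : Fin k → ℤ) :
    pderiv i (mono m) = (m i : ℚ) • mono (m - Pi.single i 1) := by
  simp [pderiv, mono]

/-- Two linear maps out of `LaurentMv k` agreeing on monomials are equal. -/
lemma linearMap_ext {N : Type*} [AddCommMonoid N] [Module ℚ N] {f g : LaurentMv k →ₗ[ℚ] N}
    (h : ∀ m, f (mono m) = g (mono m)) : f = g :=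
  LinearMap.ext_on_range span_mono h

lemma coeff_pderiv (i : Fin k) (f : LaurentMv k) (m : Fin k → ℤ) :
    (pderiv i f).coeff m = ((m i : ℚ) + 1) * f.coeff (m + Pi.single i 1) := by
  induction f using AddMonoidAlgebra.induction_linear with
  | zero => simp
  | add f g hf hg =>
    simp only [map_add, AddMonoidAlgebra.coeff_add, Finsupp.add_apply, hf, hg]
    ring
  | single m' a =>
    have : AddMonoidAlgebra.single m' a = a • mono m' := by simp [mono]
    rw [this, map_smul, pderiv_mono]
    simp only [mono, AddMonoidAlgebra.coeff_smul, AddMonoidAlgebra.coeff_single,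
      Finsupp.smul_apply, Finsupp.single_apply, smul_eq_mul, sub_eq_iff_eq_add]
    split_ifs with h
    · subst h; simp; ring
    · simp

lemma pderiv_mul (i : Fin k) (f g : LaurentMv k) :
    pderiv i (f * g) = pderiv i f * g + f * pderiv i g := by
  have key : (LinearMap.mul ℚ (LaurentMv k)).compr₂ (pderiv i) =
      (LinearMap.mul ℚ (LaurentMv k)).comp (pderiv i) +
        (LinearMap.mul ℚ (LaurentMv k)).compl₂ (pderiv i) := by
    refine linearMap_ext fun m => linearMap_ext fun m' => ?_
    simp only [LinearMap.compr₂_apply, LinearMap.mul_apply', LinearMap.add_apply,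
      LinearMap.comp_apply, LinearMap.compl₂_apply, pderiv_mono, mono_mul, smul_mul_assoc,
      mul_smul_comm, Pi.add_apply, Int.cast_add, add_smul]
    congr 3 <;> abel
  exact LinearMap.congr_fun₂ key f g

lemma pderiv_pow_succ (i : Fin k) (P : LaurentMv k) (n : ℕ) :
    pderiv i (P ^ (n + 1)) = ((n : ℚ) + 1) • (P ^ n * pderiv i P) := by
  induction n with
  | zero => simp
  | succ n ih =>
    rw [pow_succ, pderiv_mul, ih, smul_mul_assoc, mul_assoc, mul_comm (pderiv i P), ← mul_assoc,
      ← pow_succ]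
    push_cast
    module

lemma map_mem_of_mem_span {M N : Type*} [AddCommMonoid M] [Module ℚ M] [AddCommMonoid N]
    [Module ℚ N]
    (φ : M →ₗ[ℚ] N) {s : Set M} {p : Submodule ℚ N} (h : ∀ x ∈ s, φ x ∈ p) {x : M}
    (hx : x ∈ Submodule.span ℚ s) : φ x ∈ p :=
  (Submodule.span_le (p := p.comap φ)).2 h hx

/-- Laurent polynomials all of whose exponents lie in `[-B, B]`. -/
noncomputable def box (k B : ℕ) : Submodule ℚ (LaurentMv k) :=
  Submodule.span ℚ {f | ∃ m : Fin k → ℤ, (∀ i, |m i| ≤ B) ∧ f = mono m}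

lemma box_mono {B B' : ℕ} (h : B ≤ B') : box k B ≤ box k B' := by
  refine Submodule.span_mono ?_
  rintro _ ⟨m, hm, rfl⟩
  exact ⟨m, fun i => (hm i).trans (by exact_mod_cast h), rfl⟩

lemma exists_mem_box (f : LaurentMv k) : ∃ B, f ∈ box k B := by
  induction f using AddMonoidAlgebra.induction_linear with
  | zero => exact ⟨0, zero_mem _⟩
  | add f g hf hg =>
    obtain ⟨B, hB⟩ := hf
    obtain ⟨B', hB'⟩ := hg
    exact ⟨max B B', add_mem (box_mono (le_max_left _ _) hB) (box_mono (le_max_right _ _) hB')⟩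
  | single m a =>
    have : AddMonoidAlgebra.single m a = a • mono m := by simp [mono]
    rw [this]
    refine ⟨∑ i, (m i).natAbs, Submodule.smul_mem _ _ (Submodule.subset_span ⟨m, fun i => ?_, rfl⟩)⟩
    rw [Int.abs_eq_natAbs]
    exact_mod_cast Finset.single_le_sum (f := fun i => (m i).natAbs) (fun _ _ => Nat.zero_le _)
      (Finset.mem_univ i)

/-- The space of sequences `n ↦ P ^ (n + u) * Q n`, where `Q n` is a Laurent polynomial with
exponents in `[-B, B]` depending polynomially on `n` with degree at most `δ`. -/
noncomputable def powSpace (P : LaurentMv k) (u δ B : ℕ) : Submodule ℚ (ℕ → LaurentMv k) :=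
  Submodule.span ℚ {g | ∃ a ≤ δ, ∃ m : Fin k → ℤ, (∀ i, |m i| ≤ B) ∧
    g = fun n : ℕ => (n : ℚ) ^ a • (P ^ (n + u) * mono m)}

section powSpace

variable {P : LaurentMv k} {u δ B : ℕ} {g : ℕ → LaurentMv k}

lemma powSpace_mono {δ' B' : ℕ} (hδ : δ ≤ δ') (hB : B ≤ B') :
    powSpace P u δ B ≤ powSpace P u δ' B' := by
  refine Submodule.span_mono ?_
  rintro _ ⟨a, ha, m, hm, rfl⟩
  exact ⟨a, ha.trans hδ, m, fun i => (hm i).trans (by exact_mod_cast hB), rfl⟩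

lemma mul_mem_powSpace {Q : LaurentMv k} {c : ℕ} (hQ : Q ∈ box k c) (hg : g ∈ powSpace P u δ B) :
    (fun n => Q * g n) ∈ powSpace P u δ (B + c) := by
  have hgQ : LinearMap.mulLeft ℚ (fun _ : ℕ => Q) g ∈ powSpace P u δ (B + c) := by
    refine map_mem_of_mem_span _ ?_ hg
    rintro _ ⟨a, ha, m, hm, rfl⟩
    let φ : LaurentMv k →ₗ[ℚ] (ℕ → LaurentMv k) :=
      LinearMap.pi fun n => (n : ℚ) ^ a • LinearMap.mulLeft ℚ (P ^ (n + u) * mono m)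
    have hφ : φ Q ∈ powSpace P u δ (B + c) := by
      refine map_mem_of_mem_span _ ?_ hQ
      rintro _ ⟨m', hm', rfl⟩
      refine Submodule.subset_span ⟨a, ha, m + m', fun i => ?_, ?_⟩
      · push_cast
        exact (abs_add_le _ _).trans (add_le_add (hm i) (hm' i))
      · ext1 n
        simp [φ, mono_mul]
    convert hφ using 1
    ext1 n
    simp [φ, mul_comm, mul_left_comm]
  exact hgQ

lemma powSpace_succ_le {c : ℕ} (hP : P ∈ box k c) :
    powSpace P (u + 1) δ B ≤ powSpace P u δ (B + c) := by
  refine Submodule.span_le.2 ?_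
  rintro _ ⟨a, ha, m, hm, rfl⟩
  have := mul_mem_powSpace hP
    (Submodule.subset_span ⟨a, ha, m, hm, rfl⟩ : _ ∈ powSpace P u δ B)
  convert! this using 1
  ext1 n
  rw [mul_smul_comm, ← mul_assoc, ← pow_succ', add_assoc]

lemma powSpace_le {c : ℕ} (hP : P ∈ box k c) : powSpace P u δ B ≤ powSpace P 0 δ (B + u * c) := by
  induction u generalizing B with
  | zero => simp
  | succ u ih =>
    refine (powSpace_succ_le hP).trans (ih.trans (powSpace_mono le_rfl (le_of_eq ?_)))
    ring

lemma linear_smul_mem_powSpace (b : ℚ) (hg : g ∈ powSpace P u δ B) :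
    (fun n : ℕ => ((n : ℚ) + b) • g n) ∈ powSpace P u (δ + 1) B := by
  let φ : (ℕ → LaurentMv k) →ₗ[ℚ] (ℕ → LaurentMv k) :=
    LinearMap.pi fun n => ((n : ℚ) + b) • LinearMap.proj n
  have hφ : φ g ∈ powSpace P u (δ + 1) B := by
    refine map_mem_of_mem_span _ ?_ hg
    rintro _ ⟨a, ha, m, hm, rfl⟩
    have h1 : (fun n : ℕ => (n : ℚ) ^ (a + 1) • (P ^ (n + u) * mono m)) ∈ powSpace P u (δ + 1) B :=
      Submodule.subset_span ⟨a + 1, by omega, m, hm, rfl⟩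
    have h2 : (fun n : ℕ => (n : ℚ) ^ a • (P ^ (n + u) * mono m)) ∈ powSpace P u (δ + 1) B :=
      Submodule.subset_span ⟨a, by omega, m, hm, rfl⟩
    convert add_mem h1 (Submodule.smul_mem _ b h2) using 1
    ext1 n
    simp [φ]
    module
  exact hφ

lemma descFactorial_smul_mem_powSpace (s i : ℕ) (hg : g ∈ powSpace P u δ B) :
    (fun n => ((n + s).descFactorial i : ℚ) • g n) ∈ powSpace P u (δ + i) B := by
  induction i with
  | zero => simpa using hg
  | succ i ih =>
    rw [← add_assoc]
    convert! linear_smul_mem_powSpace ((s : ℚ) - i) ih using 1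
    ext1 n
    rw [smul_smul, Nat.descFactorial_succ]
    congr 1
    rcases le_or_gt i (n + s) with h | h
    · push_cast [h]; ring
    · simp [Nat.descFactorial_of_lt h]

lemma pderiv_mem_powSpace {C : ℕ} (i : Fin k) (hP : P ∈ box k C) (hP' : pderiv i P ∈ box k (C + 1))
    (hg : g ∈ powSpace P (u + 1) δ B) :
    (fun n => pderiv i (g n)) ∈ powSpace P u (δ + 1) (B + (C + 1)) := by
  have hφ : LinearMap.compLeft (pderiv i) ℕ g ∈ powSpace P u (δ + 1) (B + (C + 1)) := by
    refine map_mem_of_mem_span _ ?_ hg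
    rintro _ ⟨a, ha, m, hm, rfl⟩
    have h1 := linear_smul_mem_powSpace ((u : ℚ) + 1) (mul_mem_powSpace hP'
      (Submodule.subset_span ⟨a, ha, m, hm, rfl⟩ : _ ∈ powSpace P u δ B))
    have hm' : ∀ j, |(m - Pi.single i 1 : Fin k → ℤ) j| ≤ ((B + 1 : ℕ) : ℤ) := fun j => by
      refine (abs_sub _ _).trans ?_
      push_cast
      refine add_le_add (hm j) ?_
      rcases eq_or_ne j i with rfl | h <;> simp [*]
    have h2 := Submodule.smul_mem _ (m i : ℚ) (mul_mem_powSpace hP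
      (Submodule.subset_span ⟨a, ha, m - Pi.single i 1, hm', rfl⟩ : _ ∈ powSpace P u δ (B + 1)))
    have h2' := powSpace_mono (δ' := δ + 1) (B' := B + (C + 1)) (by omega) (by omega) h2
    convert add_mem h1 h2' using 1
    ext1 n
    simp only [LinearMap.compLeft_apply, Function.comp_apply, map_smul, pderiv_mul, ← add_assoc,
      pderiv_pow_succ, pderiv_mono, Pi.add_apply, Pi.smul_apply]
    simp only [smul_mul_assoc, mul_smul_comm, pow_succ]
    push_cast
    rw [show P ^ (n + u) * pderiv i P * mono m = pderiv i P * (P ^ (n + u) * mono m) by ring,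
      show P ^ (n + u) * P * mono (m - Pi.single i 1) = P * (P ^ (n + u) * mono (m - Pi.single i 1))
      by ring]
    module
  exact hφ

end powSpace

/-- The iterated partial derivative `∂^α` acts on coefficients by a product of linear factors, and
maps a space `powSpace` to another one with controlled parameters. -/
lemma exists_iterated_pderiv (α : Fin k → ℕ) :
    ∃ T : LaurentMv k →ₗ[ℚ] LaurentMv k,
      (∀ f m, (T f).coeff m =
        (∏ i, ∏ l ∈ Finset.range (α i), ((m i : ℚ) + 1 + l)) * f.coeff (m + fun i => (α i : ℤ))) ∧
      ∀ (P : LaurentMv k) (C : ℕ), P ∈ box k C → (∀ i, pderiv i P ∈ box k (C + 1)) →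
        ∀ (u δ B : ℕ) (g : ℕ → LaurentMv k), g ∈ powSpace P (u + ∑ i, α i) δ B →
          (fun n => T (g n)) ∈ powSpace P u (δ + ∑ i, α i) (B + (∑ i, α i) * (C + 1)) := by
  induction hs : ∑ i, α i generalizing α with
  | zero =>
    have hα : α = 0 := by
      ext i
      exact (Finset.sum_eq_zero_iff.1 hs) i (Finset.mem_univ i)
    subst hα
    exact ⟨LinearMap.id, fun f m => by simp [← Pi.zero_def], by simp⟩
  | succ s ih =>
    obtain ⟨i, -, hi⟩ : ∃ i ∈ Finset.univ, α i ≠ 0 :=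
      Finset.exists_ne_zero_of_sum_ne_zero (by omega)
    obtain ⟨β, rfl⟩ : ∃ β : Fin k → ℕ, α = β + Pi.single i 1 := by
      refine ⟨α - Pi.single i 1, ?_⟩
      ext j
      rcases eq_or_ne j i with rfl | h
      · simp; omega
      · simp [h]
    have hβ : ∑ i, β i = s := by
      simpa [Finset.sum_add_distrib] using hs
    obtain ⟨T, hT, hT'⟩ := ih β hβ
    refine ⟨pderiv i ∘ₗ T, fun f m => ?_, fun P C hP hP' u δ B g hg => ?_⟩
    · rw [LinearMap.comp_apply, coeff_pderiv, hT, ← mul_assoc]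
      congr 1
      · rw [Fintype.prod_eq_mul_prod_compl i, Fintype.prod_eq_mul_prod_compl i, ← mul_assoc]
        congr 1
        · simp [Finset.prod_range_succ', mul_comm, add_comm, add_left_comm]
        · refine Finset.prod_congr rfl fun j hj => ?_
          have hj : j ≠ i := by simpa using hj
          simp [hj]
      · congr 1
        ext j
        rcases eq_or_ne j i with rfl | h
        · simp; ring
        · simp [h]
    · have h1 := hT' P C hP hP' (u + 1) δ B g (by convert hg using 2; ring)
      have h2 := pderiv_mem_powSpace i hP (hP' i) h1
      have he : B + s * (C + 1) + (C + 1) = B + (s + 1) * (C + 1) := by ring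
      rw [he] at h2
      exact h2

lemma card_le_of_linearIndependent_powSpace {P : LaurentMv k} {δ B : ℕ} {ι : Type*} [Fintype ι]
    {v : ι → ℕ → LaurentMv k} (hv : ∀ i, v i ∈ powSpace P 0 δ B) (hli : LinearIndependent ℚ v) :
    Fintype.card ι ≤ (δ + 1) * (2 * B + 1) ^ k := by
  classical
  let w : Finset (ℕ → LaurentMv k) :=
    (Finset.range (δ + 1) ×ˢ Fintype.piFinset fun _ : Fin k => Finset.Icc (-B : ℤ) B).image
      fun p n => (n : ℚ) ^ p.1 • (P ^ (n + 0) * mono p.2)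
  have hw : Set.range v ≤ Submodule.span ℚ (w : Set (ℕ → LaurentMv k)) := by
    rintro _ ⟨i, rfl⟩
    refine Submodule.span_mono ?_ (hv i)
    rintro _ ⟨a, ha, m, hm, rfl⟩
    refine Finset.mem_coe.2 (Finset.mem_image.2 ⟨(a, m), ?_, rfl⟩)
    simp only [Finset.mem_product, Finset.mem_range, Fintype.mem_piFinset, Finset.mem_Icc]
    exact ⟨by omega, fun i => abs_le.1 (hm i)⟩
  have h1 := linearIndependent_le_span' v hli _ hw
  replace h1 : Fintype.card ι ≤ w.card := by simpa using h1
  refine h1.trans (Finset.card_image_le.trans ?_)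
  rw [Finset.card_product, Finset.card_range, Fintype.card_piFinset_const, Int.card_Icc]
  exact Nat.mul_le_mul_left _ (Nat.pow_le_pow_left (by omega) _)

lemma exists_common_box (P D : LaurentMv k) :
    ∃ C, P ∈ box k C ∧ D ∈ box k C ∧ ∀ i, pderiv i P ∈ box k (C + 1) := by
  obtain ⟨b, hb⟩ := exists_mem_box P
  obtain ⟨b', hb'⟩ := exists_mem_box D
  choose c hc using fun i => exists_mem_box (pderiv i P)
  refine ⟨b + b' + ∑ i, c i, box_mono (by omega) hb, box_mono (by omega) hb',
    fun i => box_mono ?_ (hc i)⟩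
  have := Finset.single_le_sum (f := c) (fun _ _ => Nat.zero_le _) (Finset.mem_univ i)
  omega

lemma prod_range_neg_sub_ne_zero (a : ℕ) :
    ∏ l ∈ Finset.range a, (((-1 - a : ℤ) : ℚ) + 1 + l) ≠ 0 := by
  refine Finset.prod_ne_zero_iff.2 fun l hl => ?_
  have := Finset.mem_range.1 hl
  have h : ((-1 - a : ℤ) + 1 + l) ≠ 0 := by omega
  exact_mod_cast h

/-- The constant terms of `D * P ^ n` satisfy a linear recurrence with polynomial coefficients,
expressed in the basis of falling factorials. -/
theorem exists_recurrence_coeff_zero (P D : LaurentMv k) :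
    ∃ (M J S : ℕ) (e : Fin (M + 1) → Fin (J + 1) → ℚ), J ≤ S ∧ (∃ i j, e i j ≠ 0) ∧
      ∀ n : ℕ, ∑ i, ∑ j, e i j * (((n + j).descFactorial (S + i) : ℕ) : ℚ) *
        (D * P ^ (n + j)).coeff 0 = 0 := by
  obtain ⟨C, hP, hD, hP'⟩ := exists_common_box P (mono (-1) * D)
  set E := (C + 1) * (k + 1) with hE
  set ℓ := 2 * (2 * E + 1) ^ k with hℓ
  set s := k * ℓ with hs
  set S := ℓ + s with hS
  set M := S + s with hM
  choose T hT hT' using exists_iterated_pderiv (k := k)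
  let v : Fin (M + 1) × Fin (ℓ + 1) × (Fin k → Fin (ℓ + 1)) → ℕ → LaurentMv k := fun x n =>
    ((n + (s + x.2.1)).descFactorial (S + x.1) : ℚ) •
      T (fun i => x.2.2 i) (mono (-1) * D * P ^ (n + (s + x.2.1)))
  have hv : ∀ x, v x ∈ powSpace P 0 (2 * M) (E * (ℓ + 1)) := by
    rintro ⟨i, j, α⟩
    have hα : ∑ i, (α i : ℕ) ≤ s := by
      refine (Finset.sum_le_card_nsmul _ _ ℓ fun i _ => ?_).trans (by simp [hs])
      have := (α i).2
      omega
    have h0 : (fun n => P ^ (n + (s + j)) * mono 0) ∈ powSpace P (s + j) 0 0 :=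
      Submodule.subset_span ⟨0, le_rfl, 0, by simp, by simp⟩
    have h1 := mul_mem_powSpace hD h0
    obtain ⟨u, hu⟩ := Nat.exists_eq_add_of_le (hα.trans (Nat.le_add_right s j))
    rw [hu, add_comm _ u] at h1
    have h2 := powSpace_le hP (hT' _ P C hP hP' _ _ _ _ h1)
    have h3 := descFactorial_smul_mem_powSpace (s + j) (S + i) h2
    have hi := i.2
    have hj := j.2
    refine powSpace_mono ?_ ?_ (by simpa [v, hu, add_comm u] using h3)
    · omega
    · have hu' : u + ∑ i, (α i : ℕ) = s + j := by omega
      calc C + (∑ i, (α i : ℕ)) * (C + 1) + u * C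
          ≤ (C + 1) + (u + ∑ i, (α i : ℕ)) * (C + 1) := by nlinarith
        _ ≤ (C + 1) + (s + ℓ) * (C + 1) := by rw [hu']; gcongr; omega
        _ ≤ E * (ℓ + 1) := by rw [hE, hs]; nlinarith
  have hli : ¬ LinearIndependent ℚ v := by
    intro hli
    have := card_le_of_linearIndependent_powSpace hv hli
    simp only [Fintype.card_prod, Fintype.card_fin, Fintype.card_fun] at this
    have h1 : (2 * (E * (ℓ + 1)) + 1) ^ k ≤ (2 * E + 1) ^ k * (ℓ + 1) ^ k := by
      rw [← mul_pow]
      exact Nat.pow_le_pow_left (by nlinarith) k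
    have h2 : 0 < (ℓ + 1) ^ k := by positivity
    have h3 : (2 * M + 1) * (2 * (E * (ℓ + 1)) + 1) ^ k <
        (M + 1) * ((ℓ + 1) * (ℓ + 1) ^ k) :=
      calc (2 * M + 1) * (2 * (E * (ℓ + 1)) + 1) ^ k
          ≤ (2 * M + 1) * ((2 * E + 1) ^ k * (ℓ + 1) ^ k) := Nat.mul_le_mul_left _ h1
        _ ≤ (M + 1) * (ℓ * (ℓ + 1) ^ k) := by
          have h4 : ℓ * (ℓ + 1) ^ k = 2 * (2 * E + 1) ^ k * (ℓ + 1) ^ k :=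
            congrArg (· * (ℓ + 1) ^ k) hℓ
          rw [h4]
          nlinarith [Nat.zero_le ((2 * E + 1) ^ k * (ℓ + 1) ^ k)]
        _ < _ := by
          refine Nat.mul_lt_mul_of_pos_left ?_ (by omega)
          exact Nat.mul_lt_mul_of_pos_right (by omega) h2
    omega
  obtain ⟨c, hc, ⟨x₀, hx₀⟩⟩ := Fintype.not_linearIndependent_iff.1 hli
  obtain ⟨α, ⟨i₀, j₀, hα⟩, hmin⟩ := (Set.toFinite {α : Fin k → Fin (ℓ + 1) |
    ∃ i j, c (i, j, α) ≠ 0}).exists_minimalFor (fun α => ∑ i, (α i : ℕ)) _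
      ⟨x₀.2.2, x₀.1, x₀.2.1, hx₀⟩
  refine ⟨M, ℓ, S, fun i j => c (i, j, α), by omega, ⟨i₀, j₀, hα⟩, fun n => ?_⟩
  rcases lt_or_ge n s with hn | hn
  · refine Finset.sum_eq_zero fun i _ => Finset.sum_eq_zero fun j _ => ?_
    rw [Nat.descFactorial_of_lt (by have := j.2; omega)]
    simp
  obtain ⟨n, rfl⟩ := Nat.exists_eq_add_of_le' hn
  have h := congrArg (fun f : LaurentMv k => f.coeff (fun i => -1 - (α i : ℤ))) (congrFun hc n)
  simp only [Finset.sum_apply, Pi.smul_apply, v, AddMonoidAlgebra.coeff_sum,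
    AddMonoidAlgebra.coeff_smul, Finsupp.coe_finsetSum, Finsupp.coe_smul, hT, smul_eq_mul,
    Pi.zero_apply, AddMonoidAlgebra.coeff_zero, Finsupp.coe_zero, Fintype.sum_prod_type] at h
  have hterm : ∀ i j, ∑ β : Fin k → Fin (ℓ + 1), c (i, j, β) *
      (((n + (s + j)).descFactorial (S + i) : ℚ) *
        ((∏ a, ∏ l ∈ Finset.range (β a), (((-1 - (α a : ℤ) : ℤ) : ℚ) + 1 + l)) *
          (mono (-1) * D * P ^ (n + (s + j))).coeff
            ((fun a => -1 - (α a : ℤ)) + fun a => ((β a : ℕ) : ℤ)))) =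
      (∏ a, ∏ l ∈ Finset.range (α a), (((-1 - (α a : ℤ) : ℤ) : ℚ) + 1 + l)) *
        (c (i, j, α) * ((n + s + j).descFactorial (S + i) : ℚ) *
          (D * P ^ (n + s + j)).coeff 0) := by
    intro i j
    rw [Finset.sum_eq_single α]
    · rw [mul_assoc (mono (-1)), coeff_mono_mul, ← add_assoc]
      have : ((fun a => -1 - (α a : ℤ)) + fun a => ((α a : ℕ) : ℤ)) - (-1) = 0 := by
        ext a; simp
      rw [this]
      ring
    · intro β _ hβ
      by_cases hle : ∃ a, (α a : ℕ) < β a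
      · obtain ⟨a, ha⟩ := hle
        rw [Finset.prod_eq_zero (Finset.mem_univ a), zero_mul, mul_zero, mul_zero]
        refine Finset.prod_eq_zero (Finset.mem_range.2 ha) ?_
        push_cast
        ring
      · push Not at hle
        by_contra hne
        have hc' : c (i, j, β) ≠ 0 := fun h0 => hne (by rw [h0, zero_mul])
        have hlt : ∑ a, (β a : ℕ) < ∑ a, (α a : ℕ) := by
          refine Finset.sum_lt_sum (fun a _ => hle a) ?_
          by_contra! hall
          exact hβ (funext fun a => Fin.ext (le_antisymm (hle a) (hall a (Finset.mem_univ a))))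
        exact absurd (hmin ⟨i, j, hc'⟩ hlt.le) (not_le.2 hlt)
    · simp
  have h' : ∑ i, ∑ j, (∏ a, ∏ l ∈ Finset.range (α a), (((-1 - (α a : ℤ) : ℤ) : ℚ) + 1 + l)) *
        (c (i, j, α) * ((n + s + j).descFactorial (S + i) : ℚ) *
          (D * P ^ (n + s + j)).coeff 0) = 0 := by
    rw [← h]
    exact Finset.sum_congr rfl fun i _ => Finset.sum_congr rfl fun j _ => (hterm i j).symm
  simp only [← Finset.mul_sum] at h'
  exact (mul_eq_zero.1 h').resolve_left
    (Finset.prod_ne_zero_iff.2 fun a _ => prod_range_neg_sub_ne_zero _)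

end LaurentMv

lemma PowerSeries.coeff_X_pow_mul_iterate_derivative (f : PowerSeries ℚ) (i s N : ℕ) :
    PowerSeries.coeff N (PowerSeries.X ^ (i + s) * (PowerSeries.derivative ℚ)^[i] f) =
      if s ≤ N then (((N - s).descFactorial i : ℕ) : ℚ) * PowerSeries.coeff (N - s) f else 0 := by
  rw [PowerSeries.coeff_X_pow_mul']
  split_ifs with h h' h'
  · rw [PowerSeries.coeff_iterate_derivative, show N - (i + s) + i = N - s by omega,
      ← Nat.add_descFactorial_eq_ascFactorial, show N - (i + s) + i = N - s by omega]
  · omega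
  · rw [Nat.descFactorial_of_lt (by omega)]; simp
  · rfl

/-- A nontrivial linear recurrence with coefficients in the basis of falling factorials gives a
linear differential equation for the generating function. -/
lemma exists_differential_equation_of_recurrence (a : ℕ → ℚ) (M J S : ℕ)
    (e : Fin (M + 1) → Fin (J + 1) → ℚ) (hJS : J ≤ S) (he : ∃ i j, e i j ≠ 0)
    (h : ∀ n : ℕ,
      ∑ i, ∑ j, e i j * (((n + j).descFactorial (S + i) : ℕ) : ℚ) * a (n + j) = 0) :
    ∃ (m : ℕ) (c : Fin (m + 1) → Polynomial ℚ), (∃ i, c i ≠ 0) ∧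
      ∑ i : Fin (m + 1), (c i : PowerSeries ℚ) *
        ((fun g : PowerSeries ℚ => PowerSeries.derivative ℚ g)^[(i : ℕ)]
          (PowerSeries.mk a)) = 0 := by
  let q : Fin (M + 1) → Polynomial ℚ := fun i =>
    ∑ j : Fin (J + 1), Polynomial.C (e i j) * Polynomial.X ^ ((S + i : ℕ) + (J - j : ℕ))
  have hq : ∀ (i) (j : Fin (J + 1)), (q i).coeff ((S + i : ℕ) + (J - j : ℕ)) = e i j := by
    intro i j
    simp only [q, Polynomial.finsetSum_coeff, Polynomial.coeff_C_mul_X_pow]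
    rw [Finset.sum_eq_single j]
    · simp
    · intro b _ hb
      rw [if_neg]
      intro h
      exact hb (Fin.ext (by omega))
    · simp
  let c : Fin (S + M + 1) → Polynomial ℚ := fun i =>
    if hi : S ≤ i then q ⟨i - S, by omega⟩ else 0
  refine ⟨S + M, c, ?_, ?_⟩
  · obtain ⟨i, j, hij⟩ := he
    refine ⟨⟨S + i, by omega⟩, fun h0 => hij ?_⟩
    rw [← hq i j]
    have : c ⟨S + i, by omega⟩ = q i := by simp [c]
    rw [← this, h0, Polynomial.coeff_zero]
  · have hsum : ∑ i : Fin (S + M + 1), (c i : PowerSeries ℚ) *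
        ((fun g : PowerSeries ℚ => PowerSeries.derivative ℚ g)^[(i : ℕ)] (PowerSeries.mk a)) =
        ∑ i : Fin (M + 1), (q i : PowerSeries ℚ) *
          (PowerSeries.derivative ℚ)^[S + i] (PowerSeries.mk a) := by
      symm
      refine Finset.sum_of_injOn (fun i => ⟨S + i, by omega⟩) ?_ (by simp) ?_ ?_
      · intro i _ j _ hij
        simpa [Fin.ext_iff] using hij
      · intro i _ hi
        have : ¬ S ≤ (i : ℕ) := fun hle => hi ⟨⟨i - S, by omega⟩, by simp, Fin.ext (by simp; omega)⟩
        simp [c, this]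
      · intro i _
        simp [c]
    rw [hsum]
    ext N
    simp only [map_sum, map_zero, q]
    have hco : ∀ i : Fin (M + 1), PowerSeries.coeff N
        (((∑ j : Fin (J + 1), Polynomial.C (e i j) * Polynomial.X ^ ((S + i : ℕ) + (J - j : ℕ)) :
          Polynomial ℚ) : PowerSeries ℚ) * (PowerSeries.derivative ℚ)^[S + i] (PowerSeries.mk a)) =
        ∑ j : Fin (J + 1), e i j * (if J - j ≤ N then
          (((N - (J - j)).descFactorial (S + i) : ℕ) : ℚ) * a (N - (J - j)) else 0) := by
      intro i
      rw [← Polynomial.coeToPowerSeries.ringHom_apply, map_sum, Finset.sum_mul, map_sum]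
      refine Finset.sum_congr rfl fun j _ => ?_
      rw [map_mul Polynomial.coeToPowerSeries.ringHom, map_pow]
      simp only [Polynomial.coeToPowerSeries.ringHom_apply, Polynomial.coe_C, Polynomial.coe_X]
      rw [mul_assoc, PowerSeries.coeff_C_mul, PowerSeries.coeff_X_pow_mul_iterate_derivative,
        PowerSeries.coeff_mk]
    simp only [hco]
    rcases le_or_gt J N with hN | hN
    · rw [← h (N - J)]
      refine Finset.sum_congr rfl fun i _ => Finset.sum_congr rfl fun j _ => ?_
      rw [if_pos (by omega), show N - (J - (j : ℕ)) = N - J + j by omega, mul_assoc]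
    · refine Finset.sum_eq_zero fun i _ => Finset.sum_eq_zero fun j _ => ?_
      rw [Nat.descFactorial_of_lt (by omega)]
      simp

section Words

variable {N n : ℕ}

/-- The word `w` has a strictly increasing subsequence of length `m` with letters at least `b`. -/
def HasChain (w : Fin N → Fin n) (m b : ℕ) : Prop :=
  ∃ s : Fin m → Fin N, StrictMono s ∧ StrictMono (w ∘ s) ∧ ∀ j, b ≤ (w (s j) : ℕ)

lemma hasChain_zero (w : Fin N → Fin n) (b : ℕ) : HasChain w 0 b :=
  ⟨Fin.elim0, fun i => i.elim0, fun i => i.elim0, fun i => i.elim0⟩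

lemma HasChain.mono {w : Fin N → Fin n} {m m' b b' : ℕ} (h : HasChain w m b) (hm : m' ≤ m)
    (hb : b' ≤ b) : HasChain w m' b' := by
  obtain ⟨s, hs, hws, hsb⟩ := h
  have hc : StrictMono (Fin.castLE hm) := fun i j hij => hij
  exact ⟨s ∘ Fin.castLE hm, hs.comp hc, hws.comp hc, fun j => hb.trans (hsb _)⟩

lemma hasChain_cons_succ (x : Fin n) (w : Fin N → Fin n) (m b : ℕ) :
    HasChain (Fin.cons x w : Fin (N + 1) → Fin n) (m + 1) b ↔
      HasChain w (m + 1) b ∨ (b ≤ (x : ℕ) ∧ HasChain w m (x + 1)) := by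
  constructor
  · rintro ⟨s, hs, hws, hsb⟩
    by_cases h0 : s 0 = 0
    · right
      have hne : ∀ j : Fin m, s j.succ ≠ 0 := fun j =>
        (h0 ▸ hs (Fin.succ_pos j) : (0 : Fin (N + 1)) < s j.succ).ne'
      have hw : ∀ j : Fin m, (Fin.cons x w : Fin (N + 1) → Fin n) (s j.succ) =
          w ((s j.succ).pred (hne j)) := fun j => by
        conv_lhs => rw [← Fin.succ_pred (s j.succ) (hne j)]
        rw [Fin.cons_succ]
      refine ⟨by simpa [h0] using hsb 0, fun j => (s j.succ).pred (hne j), ?_, ?_, ?_⟩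
      · intro i j hij
        exact Fin.pred_lt_pred_iff.2 (hs (Fin.succ_lt_succ_iff.2 hij))
      · intro i j hij
        have := hws (Fin.succ_lt_succ_iff.2 hij)
        simpa only [Function.comp_apply, hw] using this
      · intro j
        have := hws (Fin.succ_pos j)
        rw [Function.comp_apply, Function.comp_apply, hw, h0, Fin.cons_zero] at this
        exact this
    · left
      have hne : ∀ j, s j ≠ 0 := fun j hj => h0 (by
        have := hs.monotone (Fin.zero_le j)
        rw [hj] at this
        exact Fin.le_zero_iff.1 this)
      have hw : ∀ j, (Fin.cons x w : Fin (N + 1) → Fin n) (s j) = w ((s j).pred (hne j)) :=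
        fun j => by
          conv_lhs => rw [← Fin.succ_pred (s j) (hne j)]
          rw [Fin.cons_succ]
      refine ⟨fun j => (s j).pred (hne j), ?_, ?_, ?_⟩
      · intro i j hij
        exact Fin.pred_lt_pred_iff.2 (hs hij)
      · intro i j hij
        have := hws hij
        simpa only [Function.comp_apply, hw] using this
      · intro j
        rw [← hw]
        exact hsb j
  · rintro (⟨s, hs, hws, hsb⟩ | ⟨hbx, s, hs, hws, hsb⟩)
    · exact ⟨fun j => (s j).succ, fun i j hij => Fin.succ_lt_succ_iff.2 (hs hij),
        fun i j hij => by simpa using hws hij, fun j => by simpa using hsb j⟩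
    · refine ⟨Fin.cons 0 fun j => (s j).succ, ?_, ?_, ?_⟩
      · exact Fin.strictMono_cons.2
          ⟨fun j => Fin.succ_pos _, fun i j hij => Fin.succ_lt_succ_iff.2 (hs hij)⟩
      · have : (Fin.cons x w : Fin (N + 1) → Fin n) ∘
            (Fin.cons 0 fun j => (s j).succ : Fin (m + 1) → Fin (N + 1)) =
            Fin.cons x (w ∘ s) := by
          ext j
          refine Fin.cases ?_ (fun j => ?_) j <;> simp
        rw [this]
        exact Fin.strictMono_cons.2 ⟨fun j => hsb j, hws⟩
      · intro j
        refine Fin.cases ?_ (fun j => ?_) j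
        · simpa using hbx
        · have := hsb j
          simp only [Fin.cons_succ]
          omega

/-- The words that can be appended to a prefix with state `t` without creating an increasing
subsequence of length `k + 1`: here `t i` exceeds by one the least possible last letter of an
increasing subsequence of length `i` in the prefix. -/
def IsGood (k : ℕ) (t : ℕ → ℕ) (w : Fin N → Fin n) : Prop :=
  ∀ i ≤ k, ¬ HasChain w (k + 1 - i) (t i)

lemma isGood_cons_iff {k : ℕ} {t : ℕ → ℕ} (ht : Monotone t) {i : ℕ} (hi : i < k) {x : Fin n}
    (h1 : t i ≤ x) (h2 : (x : ℕ) < t (i + 1)) (w : Fin N → Fin n) :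
    IsGood k t (Fin.cons x w : Fin (N + 1) → Fin n) ↔
      IsGood k (Function.update t (i + 1) (x + 1)) w := by
  constructor
  · intro h j hj hc
    rcases eq_or_ne j (i + 1) with rfl | hji
    · rw [Function.update_self] at hc
      refine h i hi.le ?_
      rw [Nat.sub_add_comm hi.le, hasChain_cons_succ]
      exact Or.inr ⟨h1, hc.mono (by omega) le_rfl⟩
    · rw [Function.update_of_ne hji] at hc
      refine h j hj ?_
      rw [Nat.sub_add_comm hj, hasChain_cons_succ]
      exact Or.inl (hc.mono (by omega) le_rfl)
  · intro h j hj hc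
    rw [Nat.sub_add_comm hj, hasChain_cons_succ] at hc
    rcases hc with hc | ⟨hjx, hc⟩
    · refine h j hj (hc.mono (by omega) ?_)
      rcases eq_or_ne j (i + 1) with rfl | hji
      · rw [Function.update_self]
        exact h2
      · rw [Function.update_of_ne hji]
    · have hji : j ≤ i := by
        by_contra! hlt
        have := ht (show i + 1 ≤ j from hlt)
        omega
      refine h (i + 1) hi (hc.mono (by omega) ?_)
      rw [Function.update_self]

lemma not_isGood_cons {k : ℕ} {t : ℕ → ℕ} {x : Fin n} (hx : t k ≤ x) (w : Fin N → Fin n) :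
    ¬ IsGood k t (Fin.cons x w : Fin (N + 1) → Fin n) := by
  intro h
  refine h k le_rfl ?_
  rw [Nat.sub_add_comm le_rfl, hasChain_cons_succ, Nat.sub_self]
  exact Or.inr ⟨hx, hasChain_zero _ _⟩

lemma monotone_update_succ {t : ℕ → ℕ} (ht : Monotone t) {i b : ℕ} (h1 : t i ≤ b)
    (h2 : b ≤ t (i + 1)) : Monotone (Function.update t (i + 1) b) := by
  refine monotone_nat_of_le_succ fun j => ?_
  have := ht (Nat.le_succ j)
  have := ht (Nat.le_succ (i + 1))
  simp only [Function.update_apply]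
  split_ifs <;> grind

open Classical in
/-- Indicator form of the transition of states when a letter is prepended. -/
lemma ite_isGood_cons {k : ℕ} {t : ℕ → ℕ} (ht : Monotone t) (h0 : t 0 = 0) (x : Fin n)
    (w : Fin N → Fin n) :
    (if IsGood k t (Fin.cons x w : Fin (N + 1) → Fin n) then (1 : ℚ) else 0) =
      ∑ i : Fin k, if t i ≤ x ∧ (x : ℕ) < t (i + 1) then
        (if IsGood k (Function.update t (i + 1) (x + 1)) w then 1 else 0) else 0 := by
  rcases le_or_gt (t k) x with hx | hx
  · rw [if_neg (not_isGood_cons hx w), Finset.sum_eq_zero]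
    intro i _
    rw [if_neg]
    rintro ⟨-, h⟩
    have := ht (show (i : ℕ) + 1 ≤ k by omega)
    omega
  · have hex : ∃ i < k, t i ≤ x ∧ (x : ℕ) < t (i + 1) := by
      have hP : ∃ j, (x : ℕ) < t j := ⟨k, hx⟩
      obtain ⟨i, hi⟩ : ∃ i, Nat.find hP = i + 1 := Nat.exists_eq_succ_of_ne_zero (by
        intro h
        have := Nat.find_spec hP
        rw [h, h0] at this
        omega)
      refine ⟨i, ?_, ?_, hi ▸ Nat.find_spec hP⟩
      · have := Nat.find_min' hP hx
        omega
      · exact not_lt.1 (Nat.find_min hP (by omega))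
    obtain ⟨i, hik, h1, h2⟩ := hex
    rw [Finset.sum_eq_single ⟨i, hik⟩]
    · simp only [h1, h2, and_self, if_true, isGood_cons_iff ht hik h1 h2 w]
    · intro j _ hj
      rw [if_neg]
      rintro ⟨h3, h4⟩
      apply hj
      apply Fin.ext
      simp only
      rcases lt_trichotomy (j : ℕ) i with h | h | h
      · have := ht (show (j : ℕ) + 1 ≤ i from h)
        omega
      · exact h
      · have := ht (show i + 1 ≤ (j : ℕ) from h)
        omega
    · simp

/-- The number of occurrences of each letter in a word. -/
def content (w : Fin N → Fin n) (v : Fin n) : ℕ := (Finset.univ.filter fun i => w i = v).card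

lemma content_cons (x : Fin n) (w : Fin N → Fin n) :
    content (Fin.cons x w : Fin (N + 1) → Fin n) = content w + Pi.single x 1 := by
  ext v
  simp only [content, Finset.card_filter, Fin.sum_univ_succ, Fin.cons_zero, Fin.cons_succ,
    Pi.add_apply, Pi.single_apply, eq_comm (a := v)]
  exact add_comm _ _

open Classical in
/-- The number of good words with prescribed content. -/
noncomputable def goodCount (k N : ℕ) (c : Fin n → ℕ) (t : ℕ → ℕ) : ℚ :=
  ∑ w : Fin N → Fin n, if content w = c ∧ IsGood k t w then 1 else 0

lemma goodCount_succ {k : ℕ} {t : ℕ → ℕ} (ht : Monotone t) (h0 : t 0 = 0) (c : Fin n → ℕ) :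
    goodCount k (N + 1) c t = ∑ i : Fin k, ∑ x : Fin n,
      if t i ≤ x ∧ (x : ℕ) < t (i + 1) then
        (if 0 < c x then goodCount k N (c - Pi.single x 1) (Function.update t (i + 1) (x + 1))
          else 0) else 0 := by
  classical
  rw [goodCount, ← (Fin.consEquiv fun _ : Fin (N + 1) => Fin n).sum_comp, Fintype.sum_prod_type,
    Finset.sum_comm (s := (Finset.univ : Finset (Fin k)))]
  refine Finset.sum_congr rfl fun x _ => ?_
  have hc : ∀ w : Fin N → Fin n, content (Fin.cons x w : Fin (N + 1) → Fin n) = c ↔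
      0 < c x ∧ content w = c - Pi.single x 1 := by
    intro w
    rw [content_cons]
    constructor
    · rintro rfl
      simp
    · rintro ⟨hx, hw⟩
      rw [hw]
      ext v
      rcases eq_or_ne v x with rfl | hv
      · simp; omega
      · simp [hv]
  have : ∀ w : Fin N → Fin n, (if content (Fin.cons x w : Fin (N + 1) → Fin n) = c ∧
      IsGood k t (Fin.cons x w : Fin (N + 1) → Fin n) then (1 : ℚ) else 0) =
      ∑ i : Fin k, if t i ≤ x ∧ (x : ℕ) < t (i + 1) then (if 0 < c x then
        (if content w = c - Pi.single x 1 ∧ IsGood k (Function.update t (i + 1) (x + 1)) w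
          then 1 else 0) else 0) else 0 := by
    intro w
    by_cases h : 0 < c x ∧ content w = c - Pi.single x 1
    · simp only [hc, h, true_and, and_self, if_true]
      exact ite_isGood_cons ht h0 x w
    · rw [if_neg fun h' => h ((hc w).1 h'.1), Finset.sum_eq_zero]
      intro i _
      split_ifs <;> tauto
  refine (Finset.sum_congr rfl fun w _ => this w).trans ?_
  rw [Finset.sum_comm]
  refine Finset.sum_congr rfl fun i _ => ?_
  split_ifs <;> simp [goodCount]

lemma goodCount_zero (k : ℕ) (t : ℕ → ℕ) : goodCount k 0 (0 : Fin n → ℕ) t = 1 := by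
  classical
  rw [goodCount, Fintype.sum_unique, if_pos]
  refine ⟨by ext v; simp [content], fun i hi => ?_⟩
  rintro ⟨s, -⟩
  exact (s ⟨0, by omega⟩).elim0

end Words

section CompleteHomogeneous

variable {R : Type*} [CommRing R] {ι : Type*}

/-- The complete homogeneous symmetric polynomial of degree `c` evaluated at `u j`, `j ∈ S`. -/
noncomputable def completeHom (u : ι → R) (S : Finset ι) (c : ℕ) : R :=
  PowerSeries.coeff c (∏ j ∈ S, PowerSeries.mk fun n => u j ^ n)

@[simp] lemma completeHom_zero (u : ι → R) (S : Finset ι) : completeHom u S 0 = 1 := by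
  rw [completeHom, PowerSeries.coeff_zero_eq_constantCoeff_apply, map_prod]
  exact Finset.prod_eq_one fun j _ => by
    rw [← PowerSeries.coeff_zero_eq_constantCoeff_apply, PowerSeries.coeff_mk, pow_zero]

lemma completeHom_empty_succ (u : ι → R) (c : ℕ) : completeHom u ∅ (c + 1) = 0 := by
  simp [completeHom, PowerSeries.coeff_one]

lemma completeHom_insert_succ [DecidableEq ι] (u : ι → R) {S : Finset ι} {j : ι} (hj : j ∉ S)
    (c : ℕ) : completeHom u (insert j S) (c + 1) =
      completeHom u S (c + 1) + u j * completeHom u (insert j S) c := by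
  have h : (PowerSeries.mk fun n => u j ^ n) =
      1 + PowerSeries.X * (PowerSeries.C (u j) * PowerSeries.mk fun n => u j ^ n) := by
    ext n
    cases n with
    | zero => simp
    | succ n => simp [PowerSeries.coeff_succ_X_mul, PowerSeries.coeff_one, pow_succ']
  rw [completeHom, Finset.prod_insert hj]
  conv_lhs => rw [h]
  rw [add_mul, one_mul, map_add, mul_assoc, PowerSeries.coeff_succ_X_mul, mul_assoc,
    PowerSeries.coeff_C_mul, completeHom, completeHom, Finset.prod_insert hj]

lemma map_completeHom {R' : Type*} [CommRing R'] (φ : R →+* R') (u : ι → R) (S : Finset ι) (c : ℕ) :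
    φ (completeHom u S c) = completeHom (φ ∘ u) S c := by
  rw [completeHom, ← PowerSeries.coeff_map, map_prod]
  congr 1
  refine Finset.prod_congr rfl fun j _ => ?_
  ext n
  simp

lemma completeHom_comp_perm (u : ι → R) (σ : Equiv.Perm ι) {S : Finset ι}
    (hS : ∀ j, σ j ∈ S ↔ j ∈ S) (c : ℕ) : completeHom (u ∘ σ) S c = completeHom u S c := by
  rw [completeHom, completeHom]
  congr 1
  exact Finset.prod_equiv σ (fun j => (hS j).symm) fun j _ => rfl

lemma completeHom_mem {B : Type*} [SetLike B R] [SubringClass B R] (b : B) {u : ι → R}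
    {S : Finset ι} (h : ∀ j ∈ S, u j ∈ b) (c : ℕ) : completeHom u S c ∈ b := by
  classical
  induction S using Finset.induction_on generalizing c with
  | empty =>
    cases c with
    | zero => simp
    | succ c => simp [completeHom_empty_succ]
  | insert j S hj ih =>
    have ih' := ih fun i hi => h i (Finset.mem_insert_of_mem hi)
    induction c with
    | zero => simp
    | succ c ihc =>
      rw [completeHom_insert_succ u hj]
      exact add_mem (ih' _) (mul_mem (h j (Finset.mem_insert_self _ _)) ihc)

variable {k n : ℕ}

/-- The product over the letters `m` of the complete homogeneous symmetric polynomials of degree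
`c m` in the variables whose threshold exceeds `m`. -/
noncomputable def kernelProd (u : Fin k → R) (c : Fin n → ℕ) (t : ℕ → ℕ) : R :=
  ∏ m : Fin n, completeHom u (Finset.univ.filter fun i : Fin k => (m : ℕ) < t (i + 1)) (c m)

lemma kernelProd_update_succ (u w : Fin k → R) (hwu : ∀ i, w i * u i = 1) (c : Fin n → ℕ)
    (t : ℕ → ℕ) (i : Fin k) (x : Fin n) :
    (if 0 < c x then kernelProd u (c - Pi.single x 1) (Function.update t (i + 1) (x + 1)) else 0) =
      w i * (kernelProd u c (Function.update t (i + 1) (x + 1)) -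
        kernelProd u c (Function.update t (i + 1) x)) := by
  have hne : ∀ m : Fin n, m ≠ x →
      (Finset.univ.filter fun j : Fin k =>
        (m : ℕ) < Function.update t (i + 1 : ℕ) (x + 1) (j + 1)) =
      Finset.univ.filter fun j : Fin k => (m : ℕ) < Function.update t (i + 1 : ℕ) x (j + 1) := by
    intro m hm
    have hm' : (m : ℕ) ≠ x := fun h => hm (Fin.ext h)
    refine Finset.filter_congr fun j _ => ?_
    simp only [Function.update_apply]
    split_ifs
    · omega
    · rfl
  set S := Finset.univ.filter fun j : Fin k => (x : ℕ) < Function.update t (i + 1 : ℕ) x (j + 1)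
    with hS
  have hiS : i ∉ S := by simp [hS]
  have hins : (Finset.univ.filter fun j : Fin k =>
      (x : ℕ) < Function.update t (i + 1 : ℕ) (x + 1) (j + 1)) = insert i S := by
    ext j
    rcases eq_or_ne j i with rfl | hj
    · simp
    · have : (j : ℕ) + 1 ≠ i + 1 := fun h => hj (Fin.ext (by omega))
      simp [hS, hj, Function.update_of_ne this]
  simp only [kernelProd]
  rw [← Finset.mul_prod_erase _ _ (Finset.mem_univ x),
    ← Finset.mul_prod_erase _ _ (Finset.mem_univ x),
    ← Finset.mul_prod_erase _ _ (Finset.mem_univ x), hins, ← hS]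
  have h1 : ∀ c' : Fin n → ℕ, (∀ m ≠ x, c' m = c m) → ∏ m ∈ Finset.univ.erase x,
      completeHom u (Finset.univ.filter fun j : Fin k =>
        (m : ℕ) < Function.update t (i + 1 : ℕ) (x + 1) (j + 1)) (c' m) =
      ∏ m ∈ Finset.univ.erase x, completeHom u (Finset.univ.filter fun j : Fin k =>
        (m : ℕ) < Function.update t (i + 1 : ℕ) x (j + 1)) (c m) := fun c' hc' =>
    Finset.prod_congr rfl fun m hm => by
      rw [hne m (Finset.ne_of_mem_erase hm), hc' m (Finset.ne_of_mem_erase hm)]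
  rw [h1 c fun _ _ => rfl, h1 (c - Pi.single x 1) fun m hm => by simp [hm], ← sub_mul, ← mul_assoc]
  rcases Nat.eq_zero_or_pos (c x) with h0 | h0
  · simp [h0]
  · obtain ⟨e, he⟩ := Nat.exists_eq_succ_of_ne_zero h0.ne'
    rw [if_pos h0, he, Nat.succ_eq_add_one, completeHom_insert_succ u hiS, add_sub_cancel_left,
      ← mul_assoc, hwu, one_mul]
    simp [he]

lemma sum_kernelProd_update (u w : Fin k → R) (hwu : ∀ i, w i * u i = 1) (c : Fin n → ℕ)
    (t : ℕ → ℕ) (ht : Monotone t) (i : Fin k) (hn : t (i + 1) ≤ n) :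
    (∑ x : Fin n, if t i ≤ x ∧ (x : ℕ) < t (i + 1) then
      (if 0 < c x then kernelProd u (c - Pi.single x 1) (Function.update t (i + 1) (x + 1)) else 0)
        else 0) =
      w i * (kernelProd u c t - kernelProd u c (Function.update t (i + 1) (t i))) := by
  simp only [kernelProd_update_succ u w hwu]
  rw [Fin.sum_univ_eq_sum_range (fun x => if t i ≤ x ∧ x < t (i + 1) then
    w i * (kernelProd u c (Function.update t (i + 1) (x + 1)) -
        kernelProd u c (Function.update t (i + 1) x)) else 0), ← Finset.sum_filter,
    ← Finset.mul_sum]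
  have : (Finset.range n).filter (fun x => t i ≤ x ∧ x < t (i + 1)) =
      Finset.Ico (t i) (t (i + 1)) := by
    ext x
    simp only [Finset.mem_filter, Finset.mem_range, Finset.mem_Ico]
    omega
  rw [this, Finset.sum_Ico_sub (fun x => kernelProd u c (Function.update t (i + 1) x))
    (ht (Nat.le_succ _)), Function.update_eq_self]

end CompleteHomogeneous

namespace LaurentMv

variable {k : ℕ}

/-- The constant term of a Laurent polynomial. -/
noncomputable def constTerm : LaurentMv k →ₗ[ℚ] ℚ :=
  Finsupp.lapply 0 ∘ₗ (AddMonoidAlgebra.coeffLinearEquiv ℚ).toLinearMap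

lemma constTerm_apply (f : LaurentMv k) : constTerm f = f.coeff 0 := rfl

lemma constTerm_mono (m : Fin k → ℤ) : constTerm (mono m) = if m = 0 then 1 else 0 := by
  simp [constTerm_apply, mono, Finsupp.single_apply]

/-- The automorphism permuting the variables. -/
noncomputable def permute (σ : Equiv.Perm (Fin k)) : LaurentMv k →ₐ[ℚ] LaurentMv k :=
  AddMonoidAlgebra.mapDomainAlgHom ℚ ℚ (LinearMap.funLeft ℤ ℤ σ).toAddMonoidHom

lemma permute_mono (σ : Equiv.Perm (Fin k)) (m : Fin k → ℤ) :
    permute σ (mono m) = mono (m ∘ σ) := by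
  simp [permute, mono, AddMonoidAlgebra.mapDomainAlgHom]
  rfl

lemma constTerm_permute (σ : Equiv.Perm (Fin k)) (f : LaurentMv k) :
    constTerm (permute σ f) = constTerm f := by
  have : constTerm ∘ₗ (permute σ).toLinearMap = constTerm := by
    refine linearMap_ext fun m => ?_
    have h : m ∘ σ = 0 ↔ m = 0 :=
      ⟨fun h => funext fun i => by simpa using congrFun h (σ.symm i), by rintro rfl; rfl⟩
    simp [permute_mono, constTerm_mono, h]
  exact LinearMap.congr_fun this f

/-- The sum of the variables. -/
noncomputable def sumVars (k : ℕ) : LaurentMv k := ∑ i, mono (Pi.single i 1)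

/-- The inverses of the variables. -/
noncomputable def invVar (i : Fin k) : LaurentMv k := mono (-Pi.single i 1)

lemma mono_mul_invVar (i : Fin k) : mono (Pi.single i 1) * invVar i = 1 := by
  simp [invVar, mono_mul]

/-- The Vandermonde determinant divided by its diagonal monomial. -/
noncomputable def vandermonde (k : ℕ) : LaurentMv k :=
  ∑ σ : Equiv.Perm (Fin k), ((Equiv.Perm.sign σ : ℤ) : ℚ) • mono fun i => ((σ i : ℕ) : ℤ) - (i : ℕ)

lemma constTerm_vandermonde : constTerm (vandermonde k) = 1 := by
  simp only [vandermonde, map_sum, map_smul, constTerm_mono]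
  rw [Finset.sum_eq_single 1]
  · simp [← Pi.zero_def]
  · intro σ _ hσ
    rw [if_neg, smul_zero]
    intro h
    refine hσ (Equiv.ext fun i => Fin.ext ?_)
    have := congrFun h i
    simp only [Pi.zero_apply] at this
    simp only [Equiv.Perm.coe_one, id_eq]
    omega
  · simp

lemma permute_invVar (σ : Equiv.Perm (Fin k)) (i : Fin k) :
    permute σ (invVar (σ i)) = invVar i := by
  rw [invVar, permute_mono, invVar]
  congr 1
  ext j
  simp [Pi.single_apply]

lemma permute_sumVars (σ : Equiv.Perm (Fin k)) : permute σ (sumVars k) = sumVars k := by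
  rw [sumVars, map_sum, ← Equiv.sum_comp σ]
  refine Finset.sum_congr rfl fun i _ => ?_
  rw [permute_mono]
  congr 1
  ext j
  simp [Pi.single_apply]

lemma permute_completeHom (σ : Equiv.Perm (Fin k)) {S : Finset (Fin k)}
    (hS : ∀ j, σ j ∈ S ↔ j ∈ S) (c : ℕ) :
    permute σ (completeHom invVar S c) = completeHom invVar S c := by
  rw [← completeHom_comp_perm invVar σ hS]
  refine (map_completeHom (permute σ).toRingHom (invVar ∘ σ) S c).trans ?_
  rw [completeHom_comp_perm invVar σ hS]
  congr 1
  ext1 i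
  exact permute_invVar σ i

lemma permute_swap_mul_vandermonde {i j : Fin k} (hij : (i : ℕ) = j + 1) :
    permute (Equiv.swap j i) (mono (Pi.single i 1) * vandermonde k) =
      -(mono (Pi.single i 1) * vandermonde k) := by
  have hne : j ≠ i := fun h => by rw [h] at hij; omega
  have h1 : ∀ l : Fin k, ((Equiv.swap j i l : ℕ) : ℤ) - (Pi.single i 1 : Fin k → ℤ)
      (Equiv.swap j i l) = (l : ℕ) - (Pi.single i 1 : Fin k → ℤ) l := by
    intro l
    rcases eq_or_ne l j with rfl | hlj
    · simp [hne, hij]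
    rcases eq_or_ne l i with rfl | hli
    · simp [hne, hij]
    · rw [Equiv.swap_apply_of_ne_of_ne hlj hli]
  simp only [vandermonde, Finset.mul_sum, mul_smul_comm, mono_mul, map_sum, map_smul, permute_mono,
    ← Finset.sum_neg_distrib, ← neg_smul]
  refine Fintype.sum_equiv (Equiv.mulRight (Equiv.swap j i)) _ _ fun σ => ?_
  simp only [Equiv.coe_mulRight, Equiv.Perm.sign_mul, Equiv.Perm.sign_swap hne]
  push_cast
  rw [mul_neg_one, neg_neg]
  congr 2
  ext l
  have := h1 l
  simp only [Function.comp_apply, Pi.add_apply]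
  linarith

lemma constTerm_eq_zero_of_permute_eq {i j : Fin k} (hij : (i : ℕ) = j + 1) {Q : LaurentMv k}
    (hQ : permute (Equiv.swap j i) Q = Q) :
    constTerm (mono (Pi.single i 1) * vandermonde k * Q) = 0 := by
  have h := constTerm_permute (Equiv.swap j i) (mono (Pi.single i 1) * vandermonde k * Q)
  rw [map_mul, permute_swap_mul_vandermonde hij, hQ, neg_mul, map_neg] at h
  linarith

/-- Laurent polynomials without negative powers of the `i`-th variable. -/
noncomputable def nonnegSubalgebra (i : Fin k) : Subalgebra ℚ (LaurentMv k) :=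
  Algebra.adjoin ℚ {f | ∃ m : Fin k → ℤ, 0 ≤ m i ∧ f = mono m}

lemma mono_mem_nonnegSubalgebra {i : Fin k} {m : Fin k → ℤ} (h : 0 ≤ m i) :
    mono m ∈ nonnegSubalgebra i :=
  Algebra.subset_adjoin ⟨m, h, rfl⟩

lemma constTerm_mono_mul_eq_zero {i : Fin k} {m : Fin k → ℤ} (hm : 0 < m i) {f : LaurentMv k}
    (hf : f ∈ nonnegSubalgebra i) : constTerm (mono m * f) = 0 := by
  rw [nonnegSubalgebra, ← Subalgebra.mem_toSubmodule, Algebra.adjoin_eq_span] at hf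
  have := map_mem_of_mem_span (constTerm ∘ₗ LinearMap.mulLeft ℚ (mono m)) (p := ⊥) ?_ hf
  · simpa using this
  · intro g hg
    obtain ⟨m', hm', rfl⟩ : ∃ m' : Fin k → ℤ, 0 ≤ m' i ∧ g = mono m' := by
      induction hg using Submonoid.closure_induction with
      | mem g hg => exact hg
      | one => exact ⟨0, le_rfl, rfl⟩
      | mul g g' _ _ h h' =>
        obtain ⟨m, hm, rfl⟩ := h
        obtain ⟨m', hm', rfl⟩ := h'
        exact ⟨m + m', add_nonneg hm hm', mono_mul _ _⟩
    have hne : m + m' ≠ 0 := fun h => by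
      have := congrFun h i
      simp only [Pi.add_apply, Pi.zero_apply] at this
      omega
    simp [mono_mul, constTerm_mono, hne]

lemma constTerm_eq_zero_of_mem_nonneg {i : Fin k} (hi : (i : ℕ) = 0) {Q : LaurentMv k}
    (hQ : Q ∈ nonnegSubalgebra i) :
    constTerm (mono (Pi.single i 1) * vandermonde k * Q) = 0 := by
  rw [mul_assoc]
  refine constTerm_mono_mul_eq_zero (i := i) (by simp) (mul_mem (sum_mem fun σ _ => ?_) hQ)
  exact Subalgebra.smul_mem _ (mono_mem_nonnegSubalgebra (by simp [hi])) _

lemma sumVars_mem_nonnegSubalgebra (i : Fin k) : sumVars k ∈ nonnegSubalgebra i :=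
  sum_mem fun j _ => mono_mem_nonnegSubalgebra (by
    rcases eq_or_ne i j with rfl | h <;> simp [*])

variable {n : ℕ}

lemma constTerm_update_eq_zero {t : ℕ → ℕ} (h0 : t 0 = 0) (c : Fin n → ℕ) (N : ℕ) (i : Fin k) :
    constTerm (mono (Pi.single i 1) * vandermonde k *
      (sumVars k ^ N * kernelProd invVar c (Function.update t (i + 1) (t i)))) = 0 := by
  rcases Nat.eq_zero_or_pos (i : ℕ) with hi | hi
  · refine constTerm_eq_zero_of_mem_nonneg hi (mul_mem (pow_mem (sumVars_mem_nonnegSubalgebra i) _)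
      (prod_mem fun m _ => completeHom_mem _ (fun j hj => mono_mem_nonnegSubalgebra ?_) _))
    rcases eq_or_ne i j with rfl | h
    · simp [hi, h0] at hj
    · simp [h]
  · obtain ⟨l, hij⟩ : ∃ l : Fin k, (i : ℕ) = l + 1 := ⟨⟨i - 1, by omega⟩, by simp; omega⟩
    refine constTerm_eq_zero_of_permute_eq hij ?_
    rw [map_mul, map_pow, permute_sumVars, kernelProd, map_prod]
    congr 1
    refine Finset.prod_congr rfl fun m _ => permute_completeHom _ (fun j => ?_) _
    simp only [Finset.mem_filter, Finset.mem_univ, true_and]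
    have hli : l ≠ i := fun h => by rw [h] at hij; omega
    rcases eq_or_ne j l with rfl | hjl
    · rw [Equiv.swap_apply_left, Function.update_self, Function.update_of_ne (by omega), hij]
    rcases eq_or_ne j i with rfl | hji
    · rw [Equiv.swap_apply_right, Function.update_self, Function.update_of_ne (by omega), hij]
    · rw [Equiv.swap_apply_of_ne_of_ne hjl hji]

/-- Good words are counted by a constant term. -/
theorem goodCount_eq_constTerm (N : ℕ) (c : Fin n → ℕ) (t : ℕ → ℕ) (hc : ∑ v, c v = N)
    (ht : Monotone t) (h0 : t 0 = 0) (htn : ∀ i, t i ≤ n) :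
    goodCount k N c t = constTerm (vandermonde k * (sumVars k ^ N * kernelProd invVar c t)) := by
  induction N generalizing c t with
  | zero =>
    obtain rfl : c = 0 := funext fun v => (Finset.sum_eq_zero_iff.1 hc) v (Finset.mem_univ v)
    simp [goodCount_zero, kernelProd, constTerm_vandermonde]
  | succ N ih =>
    rw [goodCount_succ ht h0]
    have hstep : ∀ i : Fin k, (∑ x : Fin n, if t i ≤ x ∧ (x : ℕ) < t (i + 1) then
        (if 0 < c x then goodCount k N (c - Pi.single x 1) (Function.update t (i + 1) (x + 1))
          else 0) else 0) =
        constTerm (mono (Pi.single i 1) * vandermonde k *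
          (sumVars k ^ N * kernelProd invVar c t)) := by
      intro i
      have h1 := constTerm_update_eq_zero h0 c N i
      have h2 := sum_kernelProd_update invVar (fun i : Fin k => mono (Pi.single i 1))
        mono_mul_invVar c t ht i (htn _)
      have h3 : mono (Pi.single i 1) * vandermonde k * (sumVars k ^ N * kernelProd invVar c t) =
          vandermonde k * (sumVars k ^ N * (mono (Pi.single i 1) * (kernelProd invVar c t -
            kernelProd invVar c (Function.update t (i + 1) (t i))))) +
          mono (Pi.single i 1) * vandermonde k * (sumVars k ^ N *
            kernelProd invVar c (Function.update t (i + 1) (t i))) := by ring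
      rw [h3, map_add, h1, add_zero, ← h2, Finset.mul_sum, Finset.mul_sum, map_sum]
      refine Finset.sum_congr rfl fun x _ => ?_
      split_ifs with hx hcx
      · refine ih _ _ ?_ (monotone_update_succ ht (by omega) hx.2) ?_ fun j => ?_
        · have : ∑ v, c v = ∑ v, (c - Pi.single x 1 : Fin n → ℕ) v +
              ∑ v, (Pi.single x 1 : Fin n → ℕ) v := by
            rw [← Finset.sum_add_distrib]
            refine Finset.sum_congr rfl fun v _ => ?_
            rcases eq_or_ne v x with rfl | hv
            · simp; omega
            · simp [hv]
          rw [Finset.sum_pi_single'] at this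
          simp at this
          simp
          omega
        · rw [Function.update_of_ne (by omega), h0]
        · rw [Function.update_apply]
          split_ifs
          · exact x.2
          · exact htn j
      · simp
      · simp
    rw [Finset.sum_congr rfl fun i _ => hstep i, ← map_sum, ← Finset.sum_mul, ← Finset.sum_mul,
      pow_succ', ← sumVars]
    congr 1
    ring

end LaurentMv

lemma hasChain_iff_not_avoids {N n : ℕ} (w : Fin N → Fin n) (d : ℕ) :
    HasChain w d 0 ↔ ¬ Avoids d w := by
  simp [HasChain, Avoids]

lemma isGood_iff_avoids {N n k : ℕ} (w : Fin N → Fin n) :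
    IsGood k (fun i => if i = 0 then 0 else n) w ↔ Avoids (k + 1) w := by
  constructor
  · intro h
    have := h 0 (Nat.zero_le _)
    dsimp only at this
    rwa [if_pos rfl, hasChain_iff_not_avoids, not_not] at this
  · intro h i hi hc
    rcases Nat.eq_zero_or_pos i with rfl | hi0
    · dsimp only at hc
      rw [if_pos rfl, hasChain_iff_not_avoids] at hc
      exact hc h
    · obtain ⟨s, -, -, hs⟩ := hc
      have := hs ⟨0, by omega⟩
      dsimp only at this
      rw [if_neg hi0.ne'] at this
      exact absurd this (by simp)

lemma A_eq_goodCount (k r n : ℕ) :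
    (A (k + 1) r n : ℚ) =
      goodCount k (n * r) (fun _ : Fin n => r) (fun i => if i = 0 then 0 else n) := by
  classical
  rw [A, goodCount, Finset.sum_boole, Nat.card_eq_fintype_card, Fintype.card_subtype]
  congr 2
  refine Finset.filter_congr fun w _ => ?_
  rw [isGood_iff_avoids, funext_iff]
  simp [content, Nat.card_eq_fintype_card, Fintype.card_subtype]

open LaurentMv in
/-- The number of `12...(k+1)`-avoiding words as a constant term. -/
theorem A_eq_coeff_zero (k r n : ℕ) :
    (A (k + 1) r n : ℚ) = (vandermonde k *
      (sumVars k ^ r * completeHom invVar Finset.univ r) ^ n).coeff 0 := by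
  rw [A_eq_goodCount, goodCount_eq_constTerm _ _ _ (by simp) ?_ (by simp) ?_,
    ← constTerm_apply]
  · congr 2
    rw [mul_pow, ← pow_mul, mul_comm r n]
    simp [kernelProd]
  · refine monotone_nat_of_le_succ fun i => ?_
    rw [if_neg (Nat.succ_ne_zero i)]
    split_ifs <;> simp
  · intro i
    split_ifs <;> omega

/-- For every `d ≥ 2` and `r ≥ 1`, the ordinary generating function
`f(x) = Σ_{n ≥ 0} A d r n · xⁿ` (a formal power series over `ℚ`) is D-finite:
some nontrivial linear combination of `f` and its formal derivatives, with
polynomial coefficients, vanishes. -/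
theorem A_genFun_isDFinite (d r : ℕ) (hd : 2 ≤ d) (hr : 1 ≤ r) :
    ∃ (m : ℕ) (c : Fin (m + 1) → Polynomial ℚ),
      (∃ i, c i ≠ 0) ∧
      ∑ i : Fin (m + 1),
        (c i : PowerSeries ℚ) *
          ((fun g : PowerSeries ℚ => PowerSeries.derivative ℚ g)^[(i : ℕ)]
            (PowerSeries.mk fun n => (A d r n : ℚ))) = 0 := by
  obtain ⟨k, rfl⟩ : ∃ k, d = k + 1 := ⟨d - 1, by omega⟩
  obtain ⟨M, J, S, e, hJS, he, h⟩ := LaurentMv.exists_recurrence_coeff_zero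
    (LaurentMv.sumVars k ^ r * completeHom LaurentMv.invVar Finset.univ r) (LaurentMv.vandermonde k)
  refine exists_differential_equation_of_recurrence _ M J S e hJS he fun n => ?_
  simpa only [A_eq_coeff_zero] using h n
end

section
/- For every integer r ≥ 1, the ordinary generating function f_r(x) = Σ_{n≥0} A_{3,r}(n) x^n, regarded as a formal power series with rational coefficients, is algebraic: there exists a nonzero polynomial P(x,y) in two variables with rational coefficients such that P(x, f_r(x)) = 0 as a formal power series. -/
/-- A derivation of `K(s)` that vanishes on the generators `s` is zero. -/
theorem derivation_adjoin_eq_zero {K L M : Type*} [Field K] [Field L] [Algebra K L]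
    {s : Set L} [AddCommGroup M] [Module K M] [Module (IntermediateField.adjoin K s) M]
    [IsScalarTower K (IntermediateField.adjoin K s) M]
    (d : Derivation K (IntermediateField.adjoin K s) M)
    (h : ∀ y (hy : y ∈ s), d ⟨y, IntermediateField.subset_adjoin K s hy⟩ = 0) : d = 0 := by
  ext ⟨x, hx⟩
  induction hx using IntermediateField.adjoin_induction with
  | mem x hx => exact h x hx
  | algebraMap x => exact d.map_algebraMap x
  | add x y hx hy ihx ihy =>
    have := d.map_add ⟨x, hx⟩ ⟨y, hy⟩
    rw [ihx, ihy] at this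
    simpa using this
  | inv x hx ihx =>
    have := d.leibniz_inv ⟨x, hx⟩
    rw [ihx] at this
    exact this.trans (by simp)
  | mul x y hx hy ihx ihy =>
    have := d.leibniz ⟨x, hx⟩ ⟨y, hy⟩
    rw [ihx, ihy] at this
    simpa using this

/-- Elements of a finite set `s` are algebraic over the field `K` if all derivations of `K(s)` into
the ambient field vanish on `s`. -/
theorem isAlgebraic_of_forall_derivation_field {K L : Type*} [Field K] [Field L]
    [Algebra K L] {s : Set L} (hs : s.Finite)
    (h : ∀ d : Derivation K (IntermediateField.adjoin K s) L,
      ∀ y (hy : y ∈ s), d ⟨y, IntermediateField.subset_adjoin K s hy⟩ = 0) :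
    ∀ y ∈ s, IsAlgebraic K y := by
  set S := IntermediateField.adjoin K s
  have : Algebra.EssFiniteType K S :=
    IntermediateField.essFiniteType_iff.2 (IntermediateField.fg_adjoin_of_finite hs)
  have hD : KaehlerDifferential.D K S = 0 := by
    refine derivation_adjoin_eq_zero _ fun y hy => ?_
    rw [← Module.forall_dual_apply_eq_zero_iff S]
    intro φ
    have := h (((Algebra.linearMap S L).comp φ).compDer (KaehlerDifferential.D K S)) y hy
    simpa using this
  have : Algebra.FormallyUnramified K S := by
    rw [Algebra.formallyUnramified_iff, ← Submodule.subsingleton_iff S,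
      ← subsingleton_iff_bot_eq_top, ← KaehlerDifferential.span_range_derivation, hD]
    refine (Submodule.span_eq_bot.2 ?_).symm
    rintro _ ⟨x, rfl⟩
    rfl
  have := Algebra.FormallyUnramified.isSeparable K S
  intro y hy
  have hy' := Algebra.IsAlgebraic.isAlgebraic (R := K)
    (⟨y, IntermediateField.subset_adjoin K s hy⟩ : S)
  exact hy'.algebraMap (A := L)

/-- Elements of a finite set `s` are algebraic over `A` if all derivations of `A[s]` into the
ambient domain vanish on `s`. -/
theorem isAlgebraic_of_forall_derivation {A P : Type*} [CommRing A] [IsDomain A] [CommRing P]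
    [IsDomain P] [Algebra A P] [FaithfulSMul A P] {s : Set P} (hs : s.Finite)
    (h : ∀ d : Derivation A (Algebra.adjoin A s) P,
      ∀ y (hy : y ∈ s), d ⟨y, Algebra.subset_adjoin hy⟩ = 0) :
    ∀ y ∈ s, IsAlgebraic A y := by
  let L := FractionRing P
  let K := FractionRing A
  let _ : Algebra K L := FractionRing.liftAlgebra A L
  have : IsScalarTower A K L := FractionRing.isScalarTower_liftAlgebra A L
  have hinj : Function.Injective (algebraMap P L) := IsFractionRing.injective P L
  set t : Set L := Set.image (algebraMap P L) s
  suffices H : ∀ y ∈ t, IsAlgebraic K y by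
    intro y hy
    have := (IsFractionRing.isAlgebraic_iff A K L).2 (H _ ⟨y, hy, rfl⟩)
    exact (isAlgebraic_algebraMap_iff hinj).1 this
  set S := IntermediateField.adjoin K t
  refine isAlgebraic_of_forall_derivation_field (hs.image _) fun δ => ?_
  have hmem : ∀ x ∈ Algebra.adjoin A s, algebraMap P L x ∈ S := by
    intro x hx
    induction hx using Algebra.adjoin_induction with
    | mem x hx => exact IntermediateField.subset_adjoin K t ⟨x, hx, rfl⟩
    | algebraMap r =>
      rw [← IsScalarTower.algebraMap_apply A P L, IsScalarTower.algebraMap_apply A K L]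
      exact S.algebraMap_mem _
    | add x y _ _ hx hy => rw [map_add]; exact add_mem hx hy
    | mul x y _ _ hx hy => rw [map_mul]; exact mul_mem hx hy
  let ι : Algebra.adjoin A s →+* S :=
    ((algebraMap P L).comp (Algebra.adjoin A s).val.toRingHom).codRestrict S
      fun x => hmem x x.2
  have hιA : ∀ a : A, ι (algebraMap A _ a) = algebraMap K S (algebraMap A K a) := by
    intro a
    apply Subtype.ext
    change algebraMap P L (algebraMap A P a) = algebraMap K L (algebraMap A K a)
    rw [← IsScalarTower.algebraMap_apply A P L, ← IsScalarTower.algebraMap_apply A K L]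
  have hδA : ∀ a : A, δ (ι (algebraMap A _ a)) = 0 := fun a => by
    rw [hιA, δ.map_algebraMap]
  have : Finite s := hs
  obtain ⟨b, hb⟩ := IsLocalization.exist_integer_multiples_of_finite (nonZeroDivisors P)
    (fun y : s => δ (ι ⟨y, Algebra.subset_adjoin y.2⟩))
  have hint : ∀ x : Algebra.adjoin A s, ∃ u : P, algebraMap P L u = (b : P) • δ (ι x) := by
    rintro ⟨x, hx⟩
    induction hx using Algebra.adjoin_induction with
    | mem x hx => exact hb ⟨x, hx⟩
    | algebraMap r => exact ⟨0, by rw [map_zero]; exact (by rw [hδA r, smul_zero] :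
        (b : P) • δ (ι (algebraMap A _ r)) = 0).symm⟩
    | add x y hx hy ihx ihy =>
      obtain ⟨u, hu⟩ := ihx
      obtain ⟨v, hv⟩ := ihy
      refine ⟨u + v, ?_⟩
      have : ι ⟨x + y, add_mem hx hy⟩ = ι ⟨x, hx⟩ + ι ⟨y, hy⟩ := ι.map_add ⟨x, hx⟩ ⟨y, hy⟩
      rw [this, δ.map_add, smul_add, map_add, hu, hv]
    | mul x y hx hy ihx ihy =>
      obtain ⟨u, hu⟩ := ihx
      obtain ⟨v, hv⟩ := ihy
      refine ⟨x * v + y * u, ?_⟩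
      have : ι ⟨x * y, mul_mem hx hy⟩ = ι ⟨x, hx⟩ * ι ⟨y, hy⟩ := ι.map_mul ⟨x, hx⟩ ⟨y, hy⟩
      rw [this, δ.leibniz, smul_add, map_add, map_mul, map_mul, hu, hv]
      simp only [Algebra.smul_def]
      change _ = _ * (algebraMap P L x * _) + _ * (algebraMap P L y * _)
      ring
  choose u hu using hint
  let d : Derivation A (Algebra.adjoin A s) P := Derivation.mk'
    { toFun := u
      map_add' := fun x y => hinj <| by
        simp only [map_add, hu, smul_add]
      map_smul' := fun a x => hinj <| by
        rw [RingHom.id_apply, Algebra.smul_def a (u x), map_mul, hu, hu, Algebra.smul_def a x,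
          map_mul, δ.leibniz, hδA, smul_zero, add_zero, hιA]
        simp only [Algebra.smul_def]
        change _ * (algebraMap K L (algebraMap A K a) * _) = _
        rw [← IsScalarTower.algebraMap_apply A P L, ← IsScalarTower.algebraMap_apply A K L]
        ring }
    fun x y => hinj <| by
      change algebraMap P L (u (x * y)) = algebraMap P L (x * u y + y * u x)
      simp only [map_add, map_mul, hu, δ.leibniz, Algebra.smul_def]
      change _ * (algebraMap P L x * _ + algebraMap P L y * _) = _
      ring
  rintro _ ⟨y, hy, rfl⟩
  have hz : algebraMap P L (u ⟨y, Algebra.subset_adjoin hy⟩) = 0 := by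
    rw [show u ⟨y, _⟩ = 0 from h d y hy, map_zero]
  rw [hu, Algebra.smul_def] at hz
  exact (mul_eq_zero.1 hz).resolve_left fun h0 =>
    nonZeroDivisors.coe_ne_zero b ((map_eq_zero_iff _ hinj).1 h0)

theorem dvd_matrix_mul_apply {R Q : Type*} [CommRing R] [Fintype Q] {x : R} {M : Matrix Q Q R}
    (N : Matrix Q Q R) (h : ∀ i j, x ∣ M i j) (i j : Q) : x ∣ (N * M) i j :=
  Finset.dvd_sum fun l _ => (h l j).mul_left _

theorem dvd_mul_matrix_apply {R Q : Type*} [CommRing R] [Fintype Q] {x : R} {M : Matrix Q Q R}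
    (N : Matrix Q Q R) (h : ∀ i j, x ∣ M i j) (i j : Q) : x ∣ (M * N) i j :=
  Finset.dvd_sum fun l _ => (h i l).mul_right _

theorem dvd_matrix_pow_sub_pow_apply {R Q : Type*} [CommRing R] [Fintype Q] [DecidableEq Q]
    {x : R} {M N : Matrix Q Q R} (h : ∀ i j, x ∣ (M - N) i j) (p : ℕ) :
    ∀ i j, x ∣ (M ^ p - N ^ p) i j := by
  induction p with
  | zero => simp
  | succ p ih =>
    intro i j
    have : M ^ (p + 1) - N ^ (p + 1) = M ^ p * (M - N) + (M ^ p - N ^ p) * N := by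
      rw [pow_succ, pow_succ]
      noncomm_ring
    rw [this]
    exact dvd_add (dvd_matrix_mul_apply _ h i j) (dvd_mul_matrix_apply _ ih i j)

/-- A map on families of power series that is contracting for the `X`-adic metric has a
fixed point. -/
theorem exists_fixedPoint_of_contracting {R ι : Type*} [CommRing R]
    (Φ : (ι → PowerSeries R) → ι → PowerSeries R)
    (h : ∀ n f g, (∀ i, PowerSeries.X ^ n ∣ f i - g i) →
      ∀ i, PowerSeries.X ^ (n + 1) ∣ Φ f i - Φ g i) :
    ∃ f, Φ f = f := by
  have hstep : ∀ n m i, PowerSeries.X ^ n ∣ Φ^[n + m] 0 i - Φ^[n] 0 i := by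
    intro n
    induction n with
    | zero => simp
    | succ n ih =>
      intro m i
      rw [show n + 1 + m = (n + m) + 1 by ring, Function.iterate_succ_apply',
        Function.iterate_succ_apply']
      exact h n _ _ (ih m) i
  let f : ι → PowerSeries R := fun i => PowerSeries.mk fun n => PowerSeries.coeff n (Φ^[n + 1] 0 i)
  have hf : ∀ n i, PowerSeries.X ^ n ∣ f i - Φ^[n] 0 i := by
    intro n i
    rw [PowerSeries.X_pow_dvd_iff]
    intro m hm
    obtain ⟨l, rfl⟩ := Nat.exists_eq_add_of_le (Nat.succ_le_of_lt hm)
    have := PowerSeries.X_pow_dvd_iff.1 (hstep (m + 1) l i) m (Nat.lt_succ_self m)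
    rw [map_sub, sub_eq_zero] at this
    rw [map_sub, PowerSeries.coeff_mk, sub_eq_zero, ← this]
  refine ⟨f, funext fun i => PowerSeries.ext fun n => ?_⟩
  have h₁ := h n _ _ (hf n) i
  rw [← Function.iterate_succ_apply' Φ] at h₁
  have h₂ := dvd_sub h₁ (hf (n + 1) i)
  rw [sub_sub_sub_cancel_right] at h₂
  have := PowerSeries.X_pow_dvd_iff.1 h₂ n (Nat.lt_succ_self n)
  rwa [map_sub, sub_eq_zero] at this

theorem PowerSeries.eq_zero_of_forall_X_pow_dvd {R : Type*} [Semiring R] {f : PowerSeries R}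
    (h : ∀ n, PowerSeries.X ^ n ∣ f) : f = 0 :=
  PowerSeries.ext fun n => PowerSeries.X_pow_dvd_iff.1 (h (n + 1)) n (Nat.lt_succ_self n)

section MatrixEquation

variable {k Q : Type*} [Field k] [Fintype Q] [DecidableEq Q]

open Polynomial

/-- The right-hand side of the matrix equation `G = D + X ∑ p < N, U p * G ^ p`. -/
noncomputable def matrixStep {T : Type*} [CommRing T] [Algebra k[X] T] (D : Matrix Q Q k[X])
    (U : ℕ → Matrix Q Q k[X]) (N : ℕ) (G : Matrix Q Q T) : Matrix Q Q T :=
  D.map (algebraMap k[X] T) +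
    algebraMap k[X] T X • ∑ p ∈ Finset.range N, (U p).map (algebraMap k[X] T) * G ^ p

theorem algebraMap_X_powerSeries : algebraMap k[X] (PowerSeries k) X = PowerSeries.X := by
  rw [PowerSeries.algebraMap_apply']
  simp

theorem exists_matrixStep_eq (D : Matrix Q Q k[X]) (U : ℕ → Matrix Q Q k[X]) (N : ℕ) :
    ∃ G : Matrix Q Q (PowerSeries k), matrixStep D U N G = G := by
  obtain ⟨f, hf⟩ := exists_fixedPoint_of_contracting (R := k) (ι := Q × Q)
    (fun f q => matrixStep D U N (Matrix.of fun i j => f (i, j)) q.1 q.2) <| by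
      intro n f g h q
      rw [← Matrix.sub_apply, matrixStep, matrixStep, add_sub_add_left_eq_sub, ← smul_sub,
        ← Finset.sum_sub_distrib, Matrix.smul_apply, smul_eq_mul, algebraMap_X_powerSeries,
        pow_succ']
      refine mul_dvd_mul_left _ ?_
      rw [Matrix.sum_apply]
      refine Finset.dvd_sum fun p _ => ?_
      rw [← mul_sub]
      exact dvd_matrix_mul_apply _
        (dvd_matrix_pow_sub_pow_apply (fun i j => by simpa using h (i, j)) p) _ _
  exact ⟨Matrix.of fun i j => f (i, j), Matrix.ext fun i j => congrFun hf (i, j)⟩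

theorem map_matrixStep {T S : Type*} [CommRing T] [Algebra k[X] T] [CommRing S] [Algebra k[X] S]
    (φ : T →ₐ[k[X]] S) (D : Matrix Q Q k[X]) (U : ℕ → Matrix Q Q k[X]) (N : ℕ)
    (G : Matrix Q Q T) :
    (matrixStep D U N G).map φ = matrixStep D U N (G.map φ) := by
  have hm : ∀ M : Matrix Q Q k[X], (M.map (algebraMap k[X] T)).map φ = M.map (algebraMap k[X] S) :=
    fun M => Matrix.ext fun i j => φ.commutes _
  have hφ : ∀ M : Matrix Q Q T, M.map φ = φ.mapMatrix M := fun _ => rfl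
  have hs : ∀ (x : T) (M : Matrix Q Q T), (x • M).map φ = φ x • M.map φ :=
    fun x M => Matrix.ext fun i j => map_mul φ _ _
  rw [matrixStep, matrixStep, Matrix.map_add _ (map_add φ), hm, hs, φ.commutes, hφ (∑ _ ∈ _, _),
    map_sum]
  congr 2
  refine Finset.sum_congr rfl fun p _ => ?_
  rw [map_mul, map_pow, ← hφ, ← hφ, hm]

theorem isAlgebraic_of_matrixStep_eq {D : Matrix Q Q k[X]} {U : ℕ → Matrix Q Q k[X]} {N : ℕ}
    {G : Matrix Q Q (PowerSeries k)} (hG : matrixStep D U N G = G) (i j : Q) :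
    IsAlgebraic k[X] (G i j) := by
  have : FaithfulSMul k[X] (PowerSeries k) :=
    (faithfulSMul_iff_algebraMap_injective _ _).2 <| by
      have : (algebraMap k[X] (PowerSeries k) : k[X] → PowerSeries k) = Polynomial.toPowerSeries :=
        funext fun p => by rw [PowerSeries.algebraMap_apply']; simp
      rw [this]
      exact Polynomial.coe_injective k
  let s : Set (PowerSeries k) := Set.range fun q : Q × Q => G q.1 q.2
  refine isAlgebraic_of_forall_derivation (A := k[X]) (s := s) (Set.finite_range _) ?_ _
    ⟨(i, j), rfl⟩
  intro d
  let T := Algebra.adjoin k[X] s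
  let GT : Matrix Q Q T := Matrix.of fun i j => ⟨G i j, Algebra.subset_adjoin ⟨(i, j), rfl⟩⟩
  have hGT : matrixStep D U N GT = GT := by
    have hv : GT.map T.val = G := rfl
    refine Matrix.map_injective (f := T.val) Subtype.val_injective ?_
    change Matrix.map _ _ = Matrix.map _ _
    rw [map_matrixStep, hv, hG]
  let R : ℕ → Subring T := fun n =>
    { carrier := {t | PowerSeries.X ^ n ∣ d t}
      mul_mem' := fun {a b} ha hb => by
        simp only [Set.mem_ofPred_eq, d.leibniz, Algebra.smul_def] at *
        exact dvd_add (hb.mul_left _) (ha.mul_left _)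
      one_mem' := by simp
      add_mem' := fun {a b} ha hb => by
        simp only [Set.mem_ofPred_eq, map_add] at *
        exact dvd_add ha hb
      zero_mem' := by simp
      neg_mem' := fun {a} ha => by simpa using ha }
  have hR : ∀ n, GT ∈ (R n).matrix := by
    have hconst : ∀ n (M : Matrix Q Q k[X]), M.map (algebraMap k[X] T) ∈ (R n).matrix := by
      intro n M i j
      change _ ∣ d (algebraMap k[X] T (M i j))
      rw [d.map_algebraMap]
      exact dvd_zero _
    intro n
    induction n with
    | zero => exact fun i j => by simp [R]
    | succ n ih =>
      rw [← hGT]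
      refine add_mem (hconst _ _) fun i j => ?_
      have hsum := (R n).matrix.sum_mem (t := Finset.range N)
        (f := fun p => (U p).map (algebraMap k[X] T) * GT ^ p)
        fun p _ => mul_mem (hconst _ _) (pow_mem ih p)
      change _ ∣ d (algebraMap k[X] T _ * _)
      rw [d.leibniz, d.map_algebraMap, smul_zero, add_zero, Algebra.smul_def,
        ← IsScalarTower.algebraMap_apply, algebraMap_X_powerSeries, pow_succ']
      exact mul_dvd_mul_left _ (hsum i j)
  rintro _ ⟨⟨i, j⟩, rfl⟩
  exact PowerSeries.eq_zero_of_forall_X_pow_dvd fun n => hR n i j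

/-- A sequence of vectors of power series which satisfies a linear recurrence `V (l + 1) = D V l +
X ∑ p < N, U p V (l + p)` with polynomial coefficients and polynomial initial value consists of
algebraic power series. -/
theorem isAlgebraic_of_recurrence {D : Matrix Q Q k[X]} {U : ℕ → Matrix Q Q k[X]} {N : ℕ}
    {V : ℕ → Q → PowerSeries k} {v : Q → k[X]}
    (h0 : V 0 = fun q => algebraMap k[X] _ (v q))
    (hV : ∀ l, V (l + 1) = (D.map (algebraMap k[X] (PowerSeries k))).mulVec (V l) +
      (PowerSeries.X : PowerSeries k) • ∑ p ∈ Finset.range N,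
        ((U p).map (algebraMap k[X] (PowerSeries k))).mulVec (V (l + p)))
    (l : ℕ) (q : Q) : IsAlgebraic k[X] (V l q) := by
  obtain ⟨G, hG⟩ := exists_matrixStep_eq D U N
  let B := Subalgebra.algebraicClosure k[X] (PowerSeries k)
  have hpow : ∀ l, V l = (G ^ l).mulVec (V 0) := by
    set W : ℕ → Q → PowerSeries k := fun l => (G ^ l).mulVec (V 0) with hW
    have hWs : ∀ l, W (l + 1) = (D.map (algebraMap k[X] (PowerSeries k))).mulVec (W l) +
      (PowerSeries.X : PowerSeries k) • ∑ p ∈ Finset.range N,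
        ((U p).map (algebraMap k[X] (PowerSeries k))).mulVec (W (l + p)) := by
      intro l
      simp only [hW, pow_succ', Matrix.mulVec_mulVec]
      nth_rewrite 1 [← hG]
      rw [matrixStep, algebraMap_X_powerSeries, add_mul, Matrix.add_mulVec, smul_mul_assoc,
        Matrix.smul_mulVec, Finset.sum_mul, Matrix.sum_mulVec]
      simp only [mul_assoc, ← pow_add, add_comm]
    have hn : ∀ n l q, PowerSeries.X ^ n ∣ V l q - W l q := by
      intro n
      induction n with
      | zero => simp
      | succ n ihn =>
        intro l
        induction l with
        | zero => simp [hW]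
        | succ l ihl =>
          intro q
          rw [hV, hWs]
          simp only [Pi.add_apply, Pi.smul_apply, Finset.sum_apply, add_sub_add_comm, ← smul_sub,
            ← Finset.sum_sub_distrib, ← Pi.sub_apply, ← Matrix.mulVec_sub]
          refine dvd_add (Finset.dvd_sum fun i _ => (ihl i).mul_left _) ?_
          rw [smul_eq_mul, pow_succ']
          exact mul_dvd_mul_left _ (Finset.dvd_sum fun p _ =>
            Finset.dvd_sum fun i _ => (ihn (l + p) i).mul_left _)
    intro l
    ext1 q
    exact sub_eq_zero.1 (PowerSeries.eq_zero_of_forall_X_pow_dvd fun n => hn n l q)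
  rw [hpow, h0]
  have hGB : G ^ l ∈ B.toSubring.matrix :=
    pow_mem (show G ∈ B.toSubring.matrix from fun i j => isAlgebraic_of_matrixStep_eq hG i j) l
  exact B.sum_mem fun i _ => B.mul_mem (hGB q i) (B.algebraMap_mem (v i))

end MatrixEquation

section InsertionSum

variable {R S : Type*} [AddCommMonoid R] [AddCommMonoid S]

/-- The sequence of partial sums of `g`. -/
def partialSums (g : ℕ → R) (k : ℕ) : R :=
  ∑ j ∈ Finset.range (k + 1), g j

theorem partialSums_zero (g : ℕ → R) : partialSums g 0 = g 0 := by
  simp [partialSums]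

theorem partialSums_succ (g : ℕ → R) (k : ℕ) :
    partialSums g (k + 1) = partialSums g k + g (k + 1) :=
  Finset.sum_range_succ _ _

theorem iterate_partialSums_zero (s : ℕ) (g : ℕ → R) : partialSums^[s] g 0 = g 0 := by
  induction s generalizing g with
  | zero => rfl
  | succ s ih => rw [Function.iterate_succ_apply, ih, partialSums_zero]

theorem multichoose_succ_eq_sum (k s : ℕ) :
    (k + 2).multichoose (s + 1) = 1 + ∑ j ∈ Finset.range (k + 1), (j + 2).multichoose s := by
  induction k with
  | zero => rw [Nat.multichoose_succ_succ]; simp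
  | succ k ih => rw [Nat.multichoose_succ_succ, ih, Finset.sum_range_succ _ (k + 1), add_assoc]

theorem iterate_partialSums_succ (s k : ℕ) (g : ℕ → R) :
    partialSums^[s + 1] g (k + 1) =
      (k + 2).multichoose s • g 0 + partialSums^[s + 1] (fun j => g (j + 1)) k := by
  induction s generalizing k with
  | zero =>
    simp only [zero_add, Function.iterate_one, Nat.multichoose_zero_right, one_smul, partialSums]
    rw [Finset.sum_range_succ', add_comm]
  | succ s ih =>
    rw [Function.iterate_succ_apply', partialSums, Finset.sum_range_succ',
      iterate_partialSums_zero, Finset.sum_congr rfl fun j _ => ih j, Finset.sum_add_distrib,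
      ← Finset.sum_smul, multichoose_succ_eq_sum, add_smul, one_smul,
      Function.iterate_succ_apply' _ (s + 1), partialSums]
    abel

/-- The sum of `g` over the lengths of the initial descending runs of all `123`-avoiding words
obtained by inserting `r` copies of a new largest letter into a `123`-avoiding word whose initial
descending run has the given length. -/
def insertionSum (r : ℕ) (g : ℕ → R) : ℕ → R
  | 0 => g r
  | k + 1 => g (k + 1 + r) +
      ∑ m ∈ Finset.range r, partialSums^[r - m] (fun j => g (j + 1 + m)) k

theorem insertionSum_succ_succ (r : ℕ) (g : ℕ → R) (k : ℕ) :
    insertionSum (r + 1) g (k + 1) = insertionSum r (fun j => g (j + 1)) (k + 1) +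
      partialSums^[r + 1] (fun j => g (j + 1)) k := by
  simp only [insertionSum]
  rw [Finset.sum_range_succ']
  simp only [Nat.add_sub_add_right, add_zero, Nat.sub_zero, ← add_assoc]

theorem map_iterate_partialSums {f : ℕ → R} {g : ℕ → S} (φ : R →+ S) (h : ∀ j, φ (f j) = g j)
    (s k : ℕ) : φ (partialSums^[s] f k) = partialSums^[s] g k := by
  induction s generalizing f g with
  | zero => exact h k
  | succ s ih =>
    exact ih fun j => by simp only [partialSums, map_sum, h]

theorem map_insertionSum {f : ℕ → R} {g : ℕ → S} (φ : R →+ S) (h : ∀ j, φ (f j) = g j)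
    (r k : ℕ) : φ (insertionSum r f k) = insertionSum r g k := by
  cases k with
  | zero => exact h r
  | succ k =>
    simp only [insertionSum, map_add, map_sum, h]
    congr 1
    exact Finset.sum_congr rfl fun m _ => map_iterate_partialSums φ (fun j => h _) _ _

end InsertionSum

/-- The length of the longest prefix of `l` that is weakly decreasing and starts with a letter
at most `a`. -/
def runLength (a : ℕ) : List ℕ → ℕ
  | [] => 0
  | b :: l => if b ≤ a then runLength b l + 1 else 0

theorem runLength_congr {a a' : ℕ} {l : List ℕ} (h : ∀ b ∈ l, b ≤ a) (h' : ∀ b ∈ l, b ≤ a') :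
    runLength a l = runLength a' l := by
  cases l with
  | nil => rfl
  | cons b l => simp [runLength, h b (by simp), h' b (by simp)]

/-- The words obtained by inserting `s` copies of `c` into `l`, where every copy comes before the
first ascent of the word `a :: l`. -/
def insertions (c : ℕ) : ℕ → ℕ → List ℕ → List (List ℕ)
  | _, 0, l => [l]
  | _, s + 1, [] => [List.replicate (s + 1) c]
  | a, s + 1, b :: l => (insertions c a s (b :: l)).map (c :: ·) ++
      if b ≤ a then (insertions c b (s + 1) l).map (b :: ·) else []
termination_by _ s l => s + l.length

theorem length_insertions (c a s : ℕ) (l : List ℕ) :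
    (insertions c a s l).length = (runLength a l + 1).multichoose s := by
  induction a, s, l using insertions.induct with
  | case1 => simp [insertions]
  | case2 => simp [insertions, runLength]
  | case3 a s b l ih₁ ih₂ =>
    rw [insertions, List.length_append, List.length_map, ih₁, runLength]
    split_ifs with h
    · rw [List.length_map, ih₂, Nat.multichoose_succ_succ (runLength b l + 1), add_comm]
    · simp

theorem sum_insertions_of_lt {c a : ℕ} (hac : a < c) (s : ℕ) {l : List ℕ} (hl : ∀ b ∈ l, b < c)
    (g : ℕ → ℕ) :
    ((insertions c a s l).map fun l' => g (runLength a l')).sum =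
      partialSums^[s] g (runLength a l) := by
  have key : ∀ L : List (List ℕ),
      (L.map fun t => g (runLength a (c :: t))).sum = L.length * g 0 := by
    intro L
    simp [runLength, not_le.2 hac]
  induction l generalizing a s g with
  | nil =>
    cases s with
    | zero => simp [insertions]
    | succ s => simp [insertions, runLength, iterate_partialSums_zero, List.replicate_succ,
        not_le.2 hac]
  | cons b l ih =>
    cases s with
    | zero => simp [insertions]
    | succ s =>
      rw [insertions, List.map_append, List.sum_append, List.map_map]
      simp only [Function.comp_def]
      rw [key, length_insertions]
      by_cases h : b ≤ a
      · have hbc : b < c := hl b (by simp)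
        have := ih hbc (s + 1) (fun x hx => hl x (by simp [hx])) (fun j => g (j + 1)) (by
          intro L
          simp [runLength, not_le.2 hbc])
        simp only [if_pos h, List.map_map, Function.comp_def, runLength, this]
        rw [iterate_partialSums_succ, smul_eq_mul]
      · simp [h, runLength, iterate_partialSums_zero]

theorem sum_insertions {c : ℕ} (s : ℕ) {l : List ℕ} (hl : ∀ b ∈ l, b < c) (g : ℕ → ℕ) :
    ((insertions c c s l).map fun l' => g (runLength c l')).sum =
      insertionSum s g (runLength c l) := by
  have hrep : ∀ s, runLength c (List.replicate s c) = s := by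
    intro s
    induction s with
    | zero => rfl
    | succ s ih => simp [List.replicate_succ, runLength, ih]
  cases l with
  | nil =>
    cases s with
    | zero => simp [insertions, runLength, insertionSum]
    | succ s => simp [insertions, hrep, runLength.eq_1, insertionSum]
  | cons b l =>
    have hbc : b < c := hl b (by simp)
    induction s generalizing g with
    | zero => simp [insertions, runLength, hbc.le, insertionSum]
    | succ s ih =>
      have h₁ := ih fun j => g (j + 1)
      have h₂ := sum_insertions_of_lt hbc (s + 1) (l := l) (fun x hx => hl x (by simp [hx]))
        fun j => g (j + 1)
      simp only [runLength, hbc.le, if_true] at h₁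
      rw [insertions, List.map_append, List.sum_append]
      simp only [hbc.le, if_true, List.map_map, Function.comp_def, runLength, le_refl, h₁, h₂,
        insertionSum_succ_succ]

theorem nodup_insertions {c a : ℕ} (s : ℕ) {l : List ℕ} (hl : ∀ b ∈ l, b < c) :
    (insertions c a s l).Nodup := by
  induction a, s, l using insertions.induct with
  | case1 => simp [insertions]
  | case2 => simp [insertions]
  | case3 a s b l ih₁ ih₂ =>
    rw [insertions]
    split_ifs with h
    · refine List.Nodup.append ((ih₁ hl).map List.cons_injective)
        ((ih₂ fun x hx => hl x (by simp [hx])).map List.cons_injective) ?_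
      rw [List.disjoint_left]
      intro x hx hx'
      obtain ⟨t, -, rfl⟩ := List.mem_map.1 hx
      obtain ⟨t', -, h⟩ := List.mem_map.1 hx'
      exact (hl b (by simp)).ne (List.cons_eq_cons.1 h).1
    · rw [List.append_nil]
      exact (ih₁ hl).map List.cons_injective

theorem forall_not_sublist_cons_cons_iff {a b c : ℕ} {l : List ℕ} (hbc : b < c) (hc : c ∈ l) :
    (∀ x y, x < y → y < c → ¬ [x, y, c].Sublist (a :: b :: l)) ↔
      b ≤ a ∧ ∀ x y, x < y → y < c → ¬ [x, y, c].Sublist (b :: l) := by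
  constructor
  · refine fun h => ⟨?_, fun x y hxy hy hs => h x y hxy hy (hs.cons a)⟩
    by_contra! hab
    exact h a b hab hbc (((List.singleton_sublist.2 hc).cons_cons b).cons_cons a)
  · rintro ⟨hba, h⟩ x y hxy hy hs
    rcases List.sublist_cons_iff.1 hs with hs | ⟨t, ht, hs⟩
    · exact h x y hxy hy hs
    · obtain ⟨rfl, rfl⟩ := List.cons_eq_cons.1 ht
      rcases List.sublist_cons_iff.1 hs with hs | ⟨t, ht, -⟩
      · exact h b y (by omega) hy (hs.cons_cons b)
      · have := (List.cons_eq_cons.1 ht).1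
        omega

theorem forall_not_sublist_cons_self_iff {a c : ℕ} {l : List ℕ} :
    (∀ x y, x < y → y < c → ¬ [x, y, c].Sublist (a :: c :: l)) ↔
      ∀ x y, x < y → y < c → ¬ [x, y, c].Sublist (a :: l) := by
  refine forall₄_congr fun x y hxy hy => not_congr ?_
  have hx : x ≠ c := by omega
  have hy : y ≠ c := by omega
  constructor
  · intro h
    rcases List.sublist_cons_iff.1 h with h | ⟨t, ht, h⟩
    · rcases List.sublist_cons_iff.1 h with h | ⟨t, ht, h⟩
      · exact h.cons a
      · exact absurd (List.cons_eq_cons.1 ht).1 hx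
    · obtain ⟨rfl, rfl⟩ := List.cons_eq_cons.1 ht
      rcases List.sublist_cons_iff.1 h with h | ⟨t, ht, h⟩
      · exact h.cons_cons x
      · exact absurd (List.cons_eq_cons.1 ht).1 hy
  · exact fun h => h.trans ((List.sublist_cons_self c l).cons_cons a)

theorem mem_insertions {c a s : ℕ} {l l' : List ℕ} (hl : ∀ b ∈ l, b < c) :
    l' ∈ insertions c a s l ↔ l'.filter (· ≠ c) = l ∧ l'.count c = s ∧
      ∀ x y, x < y → y < c → ¬ [x, y, c].Sublist (a :: l') := by
  have aux : ∀ {x y a : ℕ} {t : List ℕ}, [x, y, c].Sublist (a :: t) → y ∈ t ∧ c ∈ t := by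
    intro x y a t h
    have h' : [y, c].Sublist t := List.Sublist.tail h
    exact ⟨h'.subset (by simp), h'.subset (by simp)⟩
  induction a, s, l using insertions.induct generalizing l' with
  | case1 a l =>
    rw [insertions, List.mem_singleton]
    constructor
    · rintro rfl
      have hc : c ∉ l' := fun h => lt_irrefl _ (hl c h)
      refine ⟨List.filter_eq_self.2 ?_, List.count_eq_zero.2 hc, ?_⟩
      · intro b hb
        simpa using (hl b hb).ne
      · exact fun x y _ _ h => hc (aux h).2
    · rintro ⟨h, hc, -⟩
      rw [← h, List.filter_eq_self.2]
      intro b hb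
      have : b ≠ c := fun h => List.count_eq_zero.1 hc (h ▸ hb)
      simpa using this
  | case2 a s =>
    rw [insertions, List.mem_singleton]
    constructor
    · rintro rfl
      refine ⟨by simp, by simp, fun x y _ hy h => hy.ne ?_⟩
      exact List.eq_of_mem_replicate (aux h).1
    · rintro ⟨h, hc, -⟩
      rw [List.filter_eq_nil_iff] at h
      have h' : ∀ b ∈ l', b = c := by simpa using h
      rw [List.eq_replicate_of_mem h', List.count_replicate_self] at hc
      rw [List.eq_replicate_of_mem h', hc]
  | case3 a s b l ih₁ ih₂ =>
    have hbc : b < c := hl b (by simp)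
    have hl' : ∀ x ∈ l, x < c := fun x hx => hl x (by simp [hx])
    rw [insertions, List.mem_append]
    cases l' with
    | nil => split_ifs <;> simp
    | cons e t =>
      by_cases he : e = c
      · subst he
        rw [forall_not_sublist_cons_self_iff]
        have : ¬ (e :: t ∈ if b ≤ a then (insertions e b (s + 1) l).map (b :: ·) else []) := by
          split_ifs
          · simp [hbc.ne]
          · simp
        simp [this, ih₁ hl]
      · have h₁ : e :: t ∉ (insertions c a s (b :: l)).map (c :: ·) := by
          simp [Ne.symm he]
        rw [or_iff_right h₁, List.filter_cons_of_pos (by simpa using he),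
          List.count_cons_of_ne he, List.cons_eq_cons]
        have h₂ : e :: t ∈ (if b ≤ a then (insertions c b (s + 1) l).map (b :: ·) else []) ↔
            b ≤ a ∧ e = b ∧ t ∈ insertions c b (s + 1) l := by
          split_ifs with h
          · simp [h, and_comm, eq_comm]
          · simp [h]
        rw [h₂, show t ∈ insertions c b (s + 1) l ↔ _ from ih₂ hl']
        constructor
        · rintro ⟨hba, rfl, hf, hc, h⟩
          refine ⟨⟨rfl, hf⟩, hc, (forall_not_sublist_cons_cons_iff hbc ?_).2 ⟨hba, h⟩⟩
          exact List.count_pos_iff.1 (by omega)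
        · rintro ⟨⟨rfl, hf⟩, hc, h⟩
          have hct : c ∈ t := List.count_pos_iff.1 (by omega)
          obtain ⟨hba, h⟩ := (forall_not_sublist_cons_cons_iff hbc hct).1 h
          exact ⟨hba, rfl, hf, hc, h⟩

/-- The `123`-avoiding words with `r` occurrences of each of the letters `0, …, n - 1`. -/
def avoidingWords (r : ℕ) : ℕ → List (List ℕ)
  | 0 => [[]]
  | n + 1 => (avoidingWords r n).flatMap (insertions n n r)

theorem mem_avoidingWords {r n : ℕ} {l : List ℕ} :
    l ∈ avoidingWords r n ↔ (∀ v < n, l.count v = r) ∧ (∀ v ∈ l, v < n) ∧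
      ∀ x y z, x < y → y < z → ¬ [x, y, z].Sublist l := by
  induction n generalizing l with
  | zero =>
    rw [avoidingWords, List.mem_singleton]
    constructor
    · rintro rfl
      simp
    · rintro ⟨-, h, -⟩
      exact List.eq_nil_iff_forall_not_mem.2 fun v hv => absurd (h v hv) (by simp)
  | succ n ih =>
    rw [avoidingWords, List.mem_flatMap]
    constructor
    · rintro ⟨l₀, hl₀, hl⟩
      obtain ⟨hcount, hlt, hav⟩ := ih.1 hl₀
      obtain ⟨hf, hc, hn⟩ := (mem_insertions hlt).1 hl
      have hlt' : ∀ v ∈ l, v < n + 1 := by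
        intro v hv
        by_cases h : v = n
        · omega
        · have : v ∈ l₀ := hf ▸ List.mem_filter.2 ⟨hv, by simpa using h⟩
          have := hlt v this
          omega
      refine ⟨fun v hv => ?_, hlt', fun x y z hxy hyz hs => ?_⟩
      · by_cases h : v = n
        · rw [h, hc]
        · rw [← hcount v (by omega), ← hf, List.count_filter (by simpa using h)]
      · have hz := hlt' z (hs.subset (by simp))
        by_cases h : z = n
        · exact hn x y hxy (h ▸ hyz) (h ▸ hs.cons n)
        · refine hav x y z hxy hyz ?_
          have := hs.filter (· ≠ n)
          rwa [hf, List.filter_eq_self.2] at this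
          intro b hb
          simp only [List.mem_cons, List.not_mem_nil, or_false] at hb
          simp only [decide_eq_true_eq]
          omega
    · rintro ⟨hcount, hlt, hav⟩
      have hlt' : ∀ v ∈ l.filter (· ≠ n), v < n := by
        intro v hv
        obtain ⟨hv, h⟩ := List.mem_filter.1 hv
        have := hlt v hv
        simp only [decide_eq_true_eq] at h
        omega
      refine ⟨l.filter (· ≠ n), ih.2 ⟨fun v hv => ?_, hlt', fun x y z hxy hyz hs => ?_⟩,
        (mem_insertions hlt').2 ⟨rfl, hcount n (by omega), fun x y hxy hy hs => ?_⟩⟩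
      · rw [List.count_filter (by simpa using hv.ne), hcount v (by omega)]
      · exact hav x y z hxy hyz (hs.trans List.filter_sublist)
      · rcases List.sublist_cons_iff.1 hs with hs | ⟨t, ht, -⟩
        · exact hav x y n hxy hy hs
        · have := (List.cons_eq_cons.1 ht).1
          omega

theorem nodup_avoidingWords (r n : ℕ) : (avoidingWords r n).Nodup := by
  induction n with
  | zero => simp [avoidingWords]
  | succ n ih =>
    rw [avoidingWords, List.nodup_flatMap]
    refine ⟨fun l hl => nodup_insertions r (mem_avoidingWords.1 hl).2.1,
      ih.imp_of_mem fun {l₁ l₂} h₁ h₂ hne => ?_⟩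
    rw [Function.onFun, List.disjoint_left]
    intro l hl hl'
    refine hne ?_
    rw [← ((mem_insertions (mem_avoidingWords.1 h₁).2.1).1 hl).1,
      ((mem_insertions (mem_avoidingWords.1 h₂).2.1).1 hl').1]

/-- The number of ways to extend a `123`-avoiding word whose initial descending run has length `k`
by `r` copies of each of `n` new largest letters. -/
def extensionCount (r : ℕ) : ℕ → ℕ → ℕ
  | 0, _ => 1
  | n + 1, k => insertionSum r (extensionCount r n) k

theorem sum_extensionCount (r n m : ℕ) :
    ((avoidingWords r n).map fun l => extensionCount r m (runLength n l)).sum =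
      (avoidingWords r (n + m)).length := by
  induction m generalizing n with
  | zero => simp [extensionCount]
  | succ m ih =>
    rw [← Nat.add_assoc, Nat.add_right_comm, ← ih (n + 1), avoidingWords, List.map_flatMap,
      List.flatMap_def, List.sum_flatten, List.map_map]
    congr 1
    refine List.map_congr_left fun l hl => ?_
    have hlt := (mem_avoidingWords.1 hl).2.1
    rw [extensionCount, ← sum_insertions r hlt]
    congr 1
    refine List.map_congr_left fun l' hl' => ?_
    have hl'' : l' ∈ avoidingWords r (n + 1) := List.mem_flatMap.2 ⟨l, hl, hl'⟩
    have h := (mem_avoidingWords.1 hl'').2.1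
    rw [runLength_congr (fun b hb => Nat.lt_succ_iff.1 (h b hb)) fun b hb => (h b hb).le]

theorem length_avoidingWords (r n : ℕ) : (avoidingWords r n).length = extensionCount r n 0 := by
  have := sum_extensionCount r 0 n
  simpa [avoidingWords, runLength, eq_comm] using this

theorem count_ofFn_eq_card {α : Type*} [DecidableEq α] {N : ℕ} (f : Fin N → α) (v : α) :
    (List.ofFn f).count v = Nat.card {i // f i = v} := by
  rw [Nat.card_eq_fintype_card, Fintype.card_subtype, List.ofFn_eq_map, List.count,
    List.countP_map, List.countP_eq_length_filter]
  rfl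

theorem avoids_three_iff {N n : ℕ} (w : Fin N → Fin n) :
    Avoids 3 w ↔ ∀ x y z : ℕ, x < y → y < z →
      ¬ [x, y, z].Sublist (List.ofFn fun i => (w i : ℕ)) := by
  rw [Avoids, not_iff_comm]
  push Not
  simp only [List.sublist_iff_exists_fin_orderEmbedding_get_eq]
  constructor
  · rintro ⟨x, y, z, hxy, hyz, f, hf⟩
    refine ⟨fun i => Fin.cast (by simp) (f (Fin.cast (by simp) i)), fun i j hij => ?_, ?_⟩
    · exact f.strictMono hij
    · have h := fun i : Fin 3 => hf i
      simp only [List.get_ofFn] at h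
      rw [Fin.strictMono_iff_lt_succ]
      intro i
      rw [Fin.lt_def]
      refine lt_of_eq_of_lt (h i.castSucc).symm (lt_of_lt_of_eq ?_ (h i.succ))
      fin_cases i
      · exact hxy
      · exact hyz
  · rintro ⟨s, hs, hw⟩
    refine ⟨w (s 0), w (s 1), w (s 2), hw (by decide), hw (by decide),
      OrderEmbedding.ofStrictMono (fun i => Fin.cast (by simp) (s i)) fun i j hij => hs hij, ?_⟩
    intro i
    simp only [List.get_ofFn]
    fin_cases i <;> rfl

theorem A_three_eq_extensionCount (r n : ℕ) : A 3 r n = extensionCount r n 0 := by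
  rw [← length_avoidingWords, ← List.toFinset_card_of_nodup (nodup_avoidingWords r n),
    ← Fintype.card_coe, ← Nat.card_eq_fintype_card]
  have hmem : ∀ w : Fin (n * r) → Fin n,
      (List.ofFn fun i => (w i : ℕ)) ∈ (avoidingWords r n).toFinset ↔
        (∀ v : Fin n, Nat.card {i : Fin (n * r) // w i = v} = r) ∧ Avoids 3 w := by
    intro w
    rw [List.mem_toFinset, mem_avoidingWords, avoids_three_iff]
    refine and_congr ?_ (and_iff_right fun v hv => ?_)
    · simp only [count_ofFn_eq_card]
      constructor
      · intro h v
        simpa only [Fin.ext_iff] using h v v.2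
      · intro h v hv
        simpa only [Fin.ext_iff] using h ⟨v, hv⟩
    · obtain ⟨i, rfl⟩ := (List.mem_ofFn' _ _).1 hv
      exact (w i).2
  refine Nat.card_eq_of_bijective
    (fun w => ⟨List.ofFn fun i => (w.1 i : ℕ), (hmem w.1).2 w.2⟩) ⟨fun w w' h => ?_, ?_⟩
  · have := List.ofFn_injective (Subtype.ext_iff.1 h)
    exact Subtype.ext (funext fun i => Fin.ext (congrFun this i))
  · rintro ⟨l, hl⟩
    obtain ⟨hcount, hlt, -⟩ := mem_avoidingWords.1 (List.mem_toFinset.1 hl)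
    have hlen : l.length = n * r := by
      have := Multiset.sum_count_eq_card (s := Finset.range n) (m := (l : Multiset ℕ))
        fun a ha => Finset.mem_range.2 (hlt a ha)
      rw [Multiset.coe_card] at this
      rw [← this, Finset.sum_congr rfl fun v hv =>
        (Multiset.coe_count v l).trans (hcount v (Finset.mem_range.1 hv))]
      simp
    let w : Fin (n * r) → Fin n := fun i => ⟨l.get (Fin.cast hlen.symm i), hlt _ (l.get_mem _)⟩
    have hw : (List.ofFn fun i => (w i : ℕ)) = l :=
      List.ext_get (by simp [hlen]) fun i h₁ h₂ => by simp [w]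
    exact ⟨⟨w, (hmem w).1 (hw.symm ▸ hl)⟩, Subtype.ext hw⟩

section Descent

variable {R : Type*} [AddCommMonoid R]

theorem iterate_partialSums_succ_eq_sum (a k : ℕ) (g : ℕ → R) :
    partialSums^[a] g (k + 1) =
      ∑ b ∈ Finset.range a, partialSums^[b + 1] g k + g (k + 1) := by
  induction a with
  | zero => simp
  | succ a ih =>
    rw [Function.iterate_succ_apply', partialSums_succ, ih, ← Function.iterate_succ_apply'
      partialSums, Finset.sum_range_succ]
    abel

/-- The iterated partial sums of `g`, shifted so that they satisfy a recurrence of order one. -/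
def shiftedPartialSums (g : ℕ → R) : ℕ → ℕ → R
  | _, 0 => 0
  | 0, l + 1 => g l
  | _ + 1, 1 => 0
  | a + 1, k + 2 => partialSums^[a + 1] g k

theorem shiftedPartialSums_succ (g : ℕ → R) (a l : ℕ) :
    shiftedPartialSums g (a + 1) (l + 1) =
      ∑ b ∈ Finset.range (a + 2), shiftedPartialSums g b l := by
  match l with
  | 0 => simp [shiftedPartialSums]
  | 1 =>
    rw [Finset.sum_range_succ']
    simp [shiftedPartialSums, iterate_partialSums_zero]
  | k + 2 =>
    rw [Finset.sum_range_succ']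
    simp only [shiftedPartialSums]
    exact iterate_partialSums_succ_eq_sum _ _ _

end Descent

/-- The generating function of the number of extensions of a word whose initial descending run has
length `k`. -/
noncomputable def extensionGenFun (r k : ℕ) : PowerSeries ℚ :=
  PowerSeries.mk fun n => (extensionCount r n k : ℚ)

/-- The functional equation satisfied by the generating functions `extensionGenFun`. -/
theorem extensionGenFun_eq (r k : ℕ) :
    extensionGenFun r k =
      1 + insertionSum r (fun j => PowerSeries.X * extensionGenFun r j) k := by
  rw [← map_insertionSum (AddMonoidHom.mulLeft (PowerSeries.X : PowerSeries ℚ))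
    (f := extensionGenFun r) (g := fun j => PowerSeries.X * extensionGenFun r j) fun j => rfl,
    AddMonoidHom.coe_mulLeft]
  ext n
  cases n with
  | zero => simp [extensionGenFun, extensionCount]
  | succ n =>
    rw [map_add, PowerSeries.coeff_succ_X_mul, PowerSeries.coeff_one, if_neg (by omega), zero_add,
      extensionGenFun, PowerSeries.coeff_mk, extensionCount]
    exact (map_insertionSum (Nat.castAddMonoidHom ℚ) (fun j => rfl) _ _).trans
      (map_insertionSum (PowerSeries.coeff n : PowerSeries ℚ →ₗ[ℚ] ℚ).toAddMonoidHom
        (g := fun j => (extensionCount r n j : ℚ))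
        (fun j => PowerSeries.coeff_mk n fun m => (extensionCount r m j : ℚ)) _ _).symm

open Polynomial in
theorem isAlgebraic_extensionGenFun {r : ℕ} (hr : 1 ≤ r) (l : ℕ) :
    IsAlgebraic ℚ[X] (extensionGenFun r l) := by
  let F := extensionGenFun r
  let g : ℕ → ℕ → PowerSeries ℚ := fun i j => PowerSeries.X * F (j + i + 1)
  let V : ℕ → Option (Fin r × Fin (r + 1)) → PowerSeries ℚ := fun l q =>
    q.elim 1 fun q => shiftedPartialSums (g q.1) q.2 l
  let c : Option (Fin r × Fin (r + 1)) → ℚ[X] := fun q =>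
    q.elim 1 fun q => (if (q.2 : ℕ) = r - q.1 then 1 else 0) +
      if q.1 = ⟨r - 1, by omega⟩ then (if q.2 = 0 then 1 else 0) else 0
  let D : Matrix (Option (Fin r × Fin (r + 1))) (Option (Fin r × Fin (r + 1))) ℚ[X] :=
    Matrix.of fun q q' => q.elim (q'.elim 1 0) fun q => q'.elim 0 fun q' =>
      if q.1 = q'.1 then (if q.2 ≠ 0 ∧ q'.2 ≤ q.2 then 1 else 0) else 0
  let U : ℕ → Matrix (Option (Fin r × Fin (r + 1))) (Option (Fin r × Fin (r + 1))) ℚ[X] :=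
    fun p => Matrix.of fun q q' => q.elim 0 fun q => if q.2 = 0 ∧ p = q.1 + 2 then c q' else 0
  have hc : ∀ l, ∑ q, algebraMap ℚ[X] (PowerSeries ℚ) (c q) * V (l + 1) q = F l := by
    intro l
    have hrow (i : Fin r) : ∑ a, algebraMap ℚ[X] (PowerSeries ℚ) (c (some (i, a))) *
        V (l + 1) (some (i, a)) = shiftedPartialSums (g i) (r - i) (l + 1) +
          if i = ⟨r - 1, by omega⟩ then g i l else 0 := by
      simp only [c, V, Option.elim_some, map_add, add_mul, Finset.sum_add_distrib]
      congr 1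
      · rw [Finset.sum_eq_single (⟨r - i, by omega⟩ : Fin (r + 1))]
        · simp
        · intro a _ ha
          rw [if_neg fun h => ha (Fin.ext h), map_zero, zero_mul]
        · simp
      · rw [Finset.sum_eq_single (0 : Fin (r + 1))]
        · rw [if_pos rfl]
          split_ifs <;> simp [shiftedPartialSums]
        · intro a _ ha
          simp [ha]
        · simp
    rw [show F l = _ from extensionGenFun_eq r l, Fintype.sum_option, Fintype.sum_prod_type,
      Finset.sum_congr rfl fun i _ => hrow i, Finset.sum_add_distrib, Finset.sum_ite_eq',
      if_pos (Finset.mem_univ _)]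
    congr 1
    · simp [c, V]
    · have hr' : ∀ j, j + (r - 1) + 1 = j + r := by omega
      cases l with
      | zero =>
        rw [Finset.sum_eq_zero, zero_add]
        · simp [insertionSum, g, F, Nat.sub_add_cancel hr]
        · intro i _
          obtain ⟨m, hm⟩ : ∃ m, r - (i : ℕ) = m + 1 := ⟨r - i - 1, by omega⟩
          rw [hm, shiftedPartialSums]
      | succ k =>
        rw [insertionSum, add_comm, ← Fin.sum_univ_eq_sum_range fun m => partialSums^[r - m]
          (fun j => PowerSeries.X * extensionGenFun r (j + 1 + m)) k]
        congr 1
        · simp only [g, F, hr']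
        · refine Finset.sum_congr rfl fun i _ => ?_
          obtain ⟨m, hm⟩ : ∃ m, r - (i : ℕ) = m + 1 := ⟨r - i - 1, by omega⟩
          rw [hm, shiftedPartialSums]
          simp only [g, F, Nat.add_right_comm]
  have h0 : V 0 = fun q => algebraMap ℚ[X] _ (q.elim 1 0) := by
    ext1 q
    cases q with
    | none => simp [V]
    | some q => simp [V, shiftedPartialSums]
  have hV : ∀ l, V (l + 1) = (D.map (algebraMap ℚ[X] (PowerSeries ℚ))).mulVec (V l) +
      (PowerSeries.X : PowerSeries ℚ) • ∑ p ∈ Finset.range (r + 2),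
        ((U p).map (algebraMap ℚ[X] (PowerSeries ℚ))).mulVec (V (l + p)) := by
    intro l
    ext1 q
    simp only [Pi.add_apply, Pi.smul_apply, Finset.sum_apply, Matrix.mulVec, dotProduct,
      Matrix.map_apply, smul_eq_mul]
    cases q with
    | none => simp [D, U, V]
    | some q =>
      obtain ⟨i, a⟩ := q
      by_cases ha : a = 0
      · subst ha
        rw [Finset.sum_eq_single (i + 2 : ℕ)]
        · simp only [U, D, Matrix.of_apply, Option.elim_some, and_self, if_true]
          rw [← Nat.add_assoc, hc, Finset.sum_eq_zero, zero_add]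
          · simp only [V, Option.elim_some, Fin.val_zero, shiftedPartialSums, g]
          · rintro (_ | q') _ <;> simp
        · intro p _ hp
          simp [U, hp]
        · simp
      · obtain ⟨a, rfl⟩ := Fin.exists_succ_eq.2 ha
        have hrow (i' : Fin r) : ∑ b, algebraMap ℚ[X] (PowerSeries ℚ)
            (D (some (i, a.succ)) (some (i', b))) * V l (some (i', b)) =
              if i = i' then ∑ b ∈ Finset.range (a + 2), shiftedPartialSums (g i') b l else 0 := by
          split_ifs with hi
          · have ha' := a.is_lt
            have hrange : Finset.range (a + 2) =
                (Finset.range (r + 1)).filter (· < (a : ℕ) + 2) := by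
              ext b
              simp only [Finset.mem_range, Finset.mem_filter]
              omega
            rw [hrange, Finset.sum_filter, ← Fin.sum_univ_eq_sum_range fun b =>
              if b < (a : ℕ) + 2 then shiftedPartialSums (g i') b l else 0]
            refine Finset.sum_congr rfl fun b _ => ?_
            have hb : b ≤ a.succ ↔ (b : ℕ) < a + 2 := by
              rw [Fin.le_def, Fin.val_succ]
              omega
            simp [D, V, hi, hb]
          · simp [D, hi]
        rw [Fintype.sum_option, Fintype.sum_prod_type, Finset.sum_congr rfl fun i' _ => hrow i',
          Finset.sum_ite_eq, if_pos (Finset.mem_univ _), ← shiftedPartialSums_succ]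
        simp [D, U, V]
  change IsAlgebraic ℚ[X] (F l)
  rw [← hc l]
  exact (Subalgebra.algebraicClosure ℚ[X] (PowerSeries ℚ)).sum_mem fun q _ =>
    Subalgebra.mul_mem _ (Subalgebra.algebraMap_mem _ _) (isAlgebraic_of_recurrence h0 hV _ q)

theorem algebraMap_polynomial_powerSeries_eq {k : Type*} [CommRing k] :
    algebraMap (Polynomial k) (PowerSeries k) = Polynomial.coeToPowerSeries.ringHom :=
  RingHom.ext fun p => by simp [PowerSeries.algebraMap_apply']

/-- For every `r ≥ 1`, the ordinary generating function
`f_r(x) = Σ_{n ≥ 0} A 3 r n · xⁿ` of `123`-avoiding words with `r` occurrences of each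
letter is algebraic: there is a nonzero two-variable polynomial `P(x, y)` over `ℚ`
(encoded as a polynomial in `y` with coefficients in `ℚ[x]`) with `P(x, f_r(x)) = 0`. -/
theorem A3_genFun_isAlgebraic (r : ℕ) (hr : 1 ≤ r) :
    ∃ P : Polynomial (Polynomial ℚ), P ≠ 0 ∧
      Polynomial.eval₂ (Polynomial.coeToPowerSeries.ringHom)
        (PowerSeries.mk fun n => (A 3 r n : ℚ)) P = 0 := by
  obtain ⟨P, hP, h⟩ := isAlgebraic_extensionGenFun hr 0
  refine ⟨P, hP, ?_⟩
  simp only [A_three_eq_extensionCount]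
  rwa [Polynomial.aeval_def, algebraMap_polynomial_powerSeries_eq] at h
end
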